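/- arXiv:1409.7468 — 9 statements merged into one kernel-verified Lean document; each statement's English description precedes it below -/
import Mathlib

section
/- Fix θ ∈ (0,1) and b ∈ (0,∞), and let a : [0,∞) → [0,∞) be measurable, non-increasing and bounded. Then there exists one and only one measurable function f : (0,∞) → [0,∞) such that f(t) = a(t) + b ∫₀ᵗ f(s) (t-s)^{-θ} ds for all t > 0 and limsup_{t→∞} (1/t) log f(t) < ∞. Moreover this f satisfies f(t) = O(e^{ct}) as t → ∞, where c := (b Γ(1-θ))^{1/(1-θ)}. -/
open MeasureTheory Filter Asymptotics

/-- The Volterra operator with kernel `k`, on `[0, ∞]`-valued functions on `(0, ∞)`. -/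
noncomputable def volterra (k u : ℝ → ENNReal) (t : ℝ) : ENNReal :=
  ∫⁻ s in Set.Ioi (0 : ℝ), u s * k (t - s)

/-- The exponential weight `e^{-lt}`. -/
noncomputable def expWeight (l t : ℝ) : ENNReal := ENNReal.ofReal (Real.exp (-l * t))

theorem measurable_expWeight (l : ℝ) : Measurable (expWeight l) := by
  unfold expWeight; fun_prop

theorem expWeight_ne_zero (l t : ℝ) : expWeight l t ≠ 0 := by
  simp [expWeight, Real.exp_pos]

theorem expWeight_ne_top (l t : ℝ) : expWeight l t ≠ ⊤ := ENNReal.ofReal_ne_top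

theorem expWeight_eq_mul (l t s : ℝ) :
    expWeight l t = expWeight l s * expWeight l (t - s) := by
  rw [expWeight, expWeight, expWeight, ← ENNReal.ofReal_mul (Real.exp_pos _).le, ← Real.exp_add]
  ring_nf

theorem expWeight_le_one {l t : ℝ} (hl : 0 ≤ l) (ht : 0 ≤ t) : expWeight l t ≤ 1 := by
  rw [expWeight, ENNReal.ofReal_le_one, Real.exp_le_one_iff]
  nlinarith

theorem lintegral_expWeight_ne_top {l : ℝ} (hl : 0 < l) :
    ∫⁻ t in Set.Ioi (0 : ℝ), expWeight l t ≠ ⊤ :=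
  (exp_neg_integrableOn_Ioi 0 hl).lintegral_lt_top.ne

theorem measurable_volterra {k u : ℝ → ENNReal} (hk : Measurable k) (hu : Measurable u) :
    Measurable (volterra k u) := by
  unfold volterra
  exact Measurable.lintegral_prod_right' (f := fun p : ℝ × ℝ => u p.2 * k (p.1 - p.2))
    (by fun_prop)

theorem volterra_mono {k u v : ℝ → ENNReal} (h : ∀ t > 0, u t ≤ v t) (t : ℝ) :
    volterra k u t ≤ volterra k v t :=
  setLIntegral_mono' measurableSet_Ioi fun s hs => by gcongr; exact h s hs

theorem volterra_congr_ae {k u v : ℝ → ENNReal}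
    (h : u =ᵐ[volume.restrict (Set.Ioi 0)] v) (t : ℝ) : volterra k u t = volterra k v t :=
  lintegral_congr_ae (by filter_upwards [h] with s hs; rw [hs])

theorem volterra_add {k u v : ℝ → ENNReal} (hk : Measurable k) (hu : Measurable u) (t : ℝ) :
    volterra k (u + v) t = volterra k u t + volterra k v t := by
  unfold volterra
  simp only [Pi.add_apply, add_mul]
  rw [lintegral_add_left (by fun_prop)]

theorem volterra_iSup {k : ℝ → ENNReal} (hk : Measurable k) {u : ℕ → ℝ → ENNReal}
    (hu : ∀ n, Measurable (u n)) (hmono : Monotone u) (t : ℝ) :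
    volterra k (fun s => ⨆ n, u n s) t = ⨆ n, volterra k (u n) t := by
  unfold volterra
  simp only [ENNReal.iSup_mul]
  refine lintegral_iSup (fun n => by have := hu n; fun_prop) fun m n hmn s => ?_
  dsimp only
  gcongr
  exact hmono hmn s

theorem volterra_eq_setLIntegral {k : ℝ → ENNReal} (hk0 : ∀ x ≤ 0, k x = 0)
    (u : ℝ → ENNReal) {t T : ℝ} (htT : t ≤ T) :
    volterra k u t = ∫⁻ s in Set.Ioo 0 T, u s * k (t - s) := by
  unfold volterra
  rw [← lintegral_indicator measurableSet_Ioi, ← lintegral_indicator measurableSet_Ioo]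
  congr 1 with s
  by_cases h0 : 0 < s <;> by_cases h1 : s < T <;> simp [h0, h1]
  right
  exact hk0 _ (by linarith)

theorem lintegral_expWeight_mul_volterra_le {k u : ℝ → ENNReal} (hk : Measurable k)
    (hk0 : ∀ x ≤ 0, k x = 0) (hu : Measurable u) (l T : ℝ) :
    ∫⁻ t in Set.Ioo 0 T, expWeight l t * volterra k u t ≤
      (∫⁻ x, expWeight l x * k x) * ∫⁻ s in Set.Ioo 0 T, expWeight l s * u s := by
  have hw := measurable_expWeight l
  calc ∫⁻ t in Set.Ioo 0 T, expWeight l t * volterra k u t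
      = ∫⁻ t in Set.Ioo 0 T, ∫⁻ s in Set.Ioo 0 T,
          (expWeight l s * u s) * (expWeight l (t - s) * k (t - s)) := by
        refine setLIntegral_congr_fun measurableSet_Ioo fun t ht => ?_
        rw [volterra_eq_setLIntegral hk0 u ht.2.le, ← lintegral_const_mul _ (by fun_prop)]
        refine lintegral_congr fun s => ?_
        rw [expWeight_eq_mul l t s]
        ring
    _ = ∫⁻ s in Set.Ioo 0 T, ∫⁻ t in Set.Ioo 0 T,
          (expWeight l s * u s) * (expWeight l (t - s) * k (t - s)) :=
        lintegral_lintegral_swap (by fun_prop)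
    _ ≤ ∫⁻ s in Set.Ioo 0 T, (∫⁻ x, expWeight l x * k x) * (expWeight l s * u s) := by
        refine lintegral_mono fun s => ?_
        dsimp only
        rw [lintegral_const_mul _ (by fun_prop), mul_comm]
        refine mul_le_mul' ((setLIntegral_le_lintegral _ _).trans_eq ?_) le_rfl
        exact lintegral_sub_right_eq_self (fun x => expWeight l x * k x) s
    _ = _ := lintegral_const_mul _ (by fun_prop)

theorem ENNReal.le_two_mul_of_le_add_half {x y : ENNReal} (hx : x ≠ ⊤) (h : x ≤ y + 2⁻¹ * x) :
    x ≤ 2 * y := by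
  have h1 : 2⁻¹ * x ≠ ⊤ := ENNReal.mul_ne_top (by simp) hx
  have h2 : x = 2⁻¹ * x + 2⁻¹ * x := by
    rw [← add_mul, ENNReal.inv_two_add_inv_two, one_mul]
  have h3 : 2⁻¹ * x ≤ y := by
    rw [← ENNReal.add_le_add_iff_right h1, ← h2]
    exact h
  calc x = 2 * (2⁻¹ * x) := by
        rw [← mul_assoc, ENNReal.mul_inv_cancel (by simp) (by simp), one_mul]
    _ ≤ 2 * y := by gcongr

/-- A function dominated by a constant plus its Volterra transform (and by the constant alone
where the transform is infinite) is locally integrable. -/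
theorem lintegral_expWeight_mul_ne_top {k u : ℝ → ENNReal} (hk : Measurable k)
    (hk0 : ∀ x ≤ 0, k x = 0) (hklow : ∀ T > 0, ∃ δ ≠ 0, ∀ x ∈ Set.Ioo 0 T, δ ≤ k x)
    (hu : Measurable u) {l : ℝ} (hl : 0 < l)
    (hkl : ∫⁻ x, expWeight l x * k x ≤ 2⁻¹) {C : ENNReal} (hC : C ≠ ⊤)
    (hle : ∀ t > 0, u t ≤ C + volterra k u t)
    (htop : ∀ t > 0, volterra k u t = ⊤ → u t ≤ C) (T : ℝ) :
    ∫⁻ s in Set.Ioo 0 T, expWeight l s * u s ≠ ⊤ := by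
  have hw := measurable_expWeight l
  set G : ℝ → ENNReal := fun t => ∫⁻ s in Set.Ioo 0 t, expWeight l s * u s with hG
  have hGmono : Monotone G := fun s t hst => lintegral_mono_set (Set.Ioo_subset_Ioo_right hst)
  set W := ∫⁻ t in Set.Ioi (0 : ℝ), expWeight l t with hW
  have hWtop : W ≠ ⊤ := lintegral_expWeight_ne_top hl
  have hKm := measurable_volterra hk hu
  have hbound : ∀ t, G t ≠ ⊤ → G t ≤ 2 * (C * W) := by
    intro t ht
    refine ENNReal.le_two_mul_of_le_add_half ht ?_
    calc G t ≤ ∫⁻ s in Set.Ioo 0 t, (C * expWeight l s + expWeight l s * volterra k u s) := by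
          refine setLIntegral_mono' measurableSet_Ioo fun s hs => ?_
          calc expWeight l s * u s ≤ expWeight l s * (C + volterra k u s) := by
                gcongr; exact hle s hs.1
            _ = _ := by ring
      _ = C * (∫⁻ s in Set.Ioo 0 t, expWeight l s)
            + ∫⁻ s in Set.Ioo 0 t, expWeight l s * volterra k u s := by
          rw [lintegral_add_left (by fun_prop), lintegral_const_mul _ hw]
      _ ≤ C * W + 2⁻¹ * G t := by
          refine add_le_add (mul_le_mul' le_rfl (lintegral_mono_set fun x hx => hx.1)) ?_
          exact (lintegral_expWeight_mul_volterra_le hk hk0 hu l t).trans (by gcongr)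
  intro hT
  set S : Set ℝ := {t | G t = ⊤} with hS
  have hTS : T ∈ S := hT
  have hSpos : ∀ t ∈ S, 0 ≤ t := by
    intro t ht
    by_contra! h
    have : G t = 0 := by simp [hG, Set.Ioo_eq_empty_of_le h.le]
    rw [hS, Set.mem_ofPred_eq, this] at ht
    exact ENNReal.zero_ne_top ht
  have hbdd : BddBelow S := ⟨0, hSpos⟩
  set τ := sInf S with hτ
  have hτ0 : 0 ≤ τ := le_csInf ⟨T, hTS⟩ hSpos
  have hGτ : G τ ≤ 2 * (C * W) := by
    have hun : Set.Ioo 0 τ = ⋃ n : ℕ, Set.Ioo 0 (τ - 1 / ((n : ℝ) + 1)) := by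
      ext x
      simp only [Set.mem_Ioo, Set.mem_iUnion]
      constructor
      · rintro ⟨h0, h1⟩
        obtain ⟨n, hn⟩ := exists_nat_one_div_lt (sub_pos.2 h1)
        exact ⟨n, h0, by linarith⟩
      · rintro ⟨n, h0, h1⟩
        have : 0 < 1 / ((n : ℝ) + 1) := by positivity
        exact ⟨h0, by linarith⟩
    have hmono : Monotone fun n : ℕ => Set.Ioo 0 (τ - 1 / ((n : ℝ) + 1)) := by
      intro m n hmn
      refine Set.Ioo_subset_Ioo_right ?_
      have : 1 / ((n : ℝ) + 1) ≤ 1 / ((m : ℝ) + 1) := by gcongr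
      linarith
    simp only [hG]
    rw [hun, setLIntegral_iUnion_of_directed _ hmono.directed_le]
    refine iSup_le fun n => hbound _ fun hn => ?_
    have h1 : τ ≤ τ - 1 / ((n : ℝ) + 1) := csInf_le hbdd hn
    have : 0 < 1 / ((n : ℝ) + 1) := by positivity
    linarith
  have hafter : ∀ t > τ, u t ≤ C := by
    intro t ht
    obtain ⟨t', ht', htt'⟩ := exists_lt_of_csInf_lt ⟨T, hTS⟩ ht
    have hGt : G t = ⊤ := top_le_iff.1 (ht'.symm.le.trans (hGmono htt'.le))
    have htpos : 0 < t := hτ0.trans_lt ht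
    refine htop t htpos (top_le_iff.1 ?_)
    obtain ⟨δ, hδ, hδk⟩ := hklow t htpos
    calc (⊤ : ENNReal) = δ * G t := by rw [hGt, ENNReal.mul_top hδ]
      _ = ∫⁻ s in Set.Ioo 0 t, δ * (expWeight l s * u s) :=
          (lintegral_const_mul _ (by fun_prop)).symm
      _ ≤ ∫⁻ s in Set.Ioo 0 t, u s * k (t - s) := by
          refine setLIntegral_mono' measurableSet_Ioo fun s hs => ?_
          calc δ * (expWeight l s * u s) ≤ k (t - s) * (1 * u s) := by
                gcongr
                · exact hδk _ ⟨by linarith [hs.2], by linarith [hs.1]⟩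
                · exact expWeight_le_one hl.le hs.1.le
            _ = _ := by ring
      _ = volterra k u t := (volterra_eq_setLIntegral hk0 u le_rfl).symm
  have hGT : G (τ + 1) ≤ G τ + C * W := by
    have hsub : Set.Ioo 0 (τ + 1) ⊆ Set.Ioc 0 τ ∪ Set.Ioo τ (τ + 1) := by
      intro x hx
      rcases le_or_gt x τ with h | h
      · exact Or.inl ⟨hx.1, h⟩
      · exact Or.inr ⟨h, hx.2⟩
    calc G (τ + 1) ≤ ∫⁻ s in Set.Ioc 0 τ ∪ Set.Ioo τ (τ + 1), expWeight l s * u s :=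
          lintegral_mono_set hsub
      _ ≤ _ := lintegral_union_le _ _ _
      _ ≤ G τ + C * W := by
          refine add_le_add ?_ ?_
          · simp only [hG]
            rw [restrict_Ioo_eq_restrict_Ioc]
          · calc ∫⁻ s in Set.Ioo τ (τ + 1), expWeight l s * u s
                ≤ ∫⁻ s in Set.Ioo τ (τ + 1), C * expWeight l s := by
                  refine setLIntegral_mono' measurableSet_Ioo fun s hs => ?_
                  rw [mul_comm]
                  gcongr
                  exact hafter s hs.1
              _ = C * ∫⁻ s in Set.Ioo τ (τ + 1), expWeight l s := lintegral_const_mul _ hw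
              _ ≤ C * W := by
                  exact mul_le_mul' le_rfl (lintegral_mono_set fun x hx => hτ0.trans_lt hx.1)
  have htop' : G (τ + 1) = ⊤ := by
    obtain ⟨t', ht', htt'⟩ := exists_lt_of_csInf_lt ⟨T, hTS⟩ (lt_add_one τ)
    exact top_le_iff.1 (ht'.symm.le.trans (hGmono htt'.le))
  have hCW : C * W ≠ ⊤ := ENNReal.mul_ne_top hC hWtop
  have : G τ + C * W ≠ ⊤ :=
    ENNReal.add_ne_top.2 ⟨ne_top_of_le_ne_top (ENNReal.mul_ne_top (by simp) hCW) hGτ, hCW⟩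
  exact this (top_le_iff.1 (htop'.symm.le.trans hGT))

/-- Comparison principle for locally integrable sub- and supersolutions of the Volterra equation,
where the supersolution inequality is required only where the transform is finite. -/
theorem volterra_comparison {k u v A : ℝ → ENNReal} (hk : Measurable k)
    (hk0 : ∀ x ≤ 0, k x = 0) (hu : Measurable u) (hv : Measurable v) {l : ℝ}
    (hkl : ∫⁻ x, expWeight l x * k x ≤ 2⁻¹)
    (hufin : ∀ T, ∫⁻ s in Set.Ioo 0 T, expWeight l s * u s ≠ ⊤)
    (hvfin : ∀ T, ∫⁻ s in Set.Ioo 0 T, expWeight l s * v s ≠ ⊤)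
    (hule : ∀ t > 0, u t ≤ A t + volterra k u t)
    (hvge : ∀ t > 0, volterra k v t ≠ ⊤ → A t + volterra k v t ≤ v t) :
    ∀ᵐ t ∂volume.restrict (Set.Ioi 0), u t ≤ v t := by
  have hw := measurable_expWeight l
  have hKv := measurable_volterra hk hv
  have key : ∀ T, ∀ᵐ t ∂volume.restrict (Set.Ioo 0 T), u t ≤ v t := by
    intro T
    have hfin : ∀ᵐ t ∂volume.restrict (Set.Ioo 0 T), volterra k v t ≠ ⊤ := by
      have h1 : ∫⁻ t in Set.Ioo 0 T, expWeight l t * volterra k v t ≠ ⊤ :=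
        ne_top_of_le_ne_top
          (ENNReal.mul_ne_top (ne_top_of_le_ne_top (by simp) hkl) (hvfin T))
          (lintegral_expWeight_mul_volterra_le hk hk0 hv l T)
      filter_upwards [ae_lt_top (by fun_prop) h1] with t ht htop
      rw [htop, ENNReal.mul_top (expWeight_ne_zero l t)] at ht
      exact lt_irrefl _ ht
    set h : ℝ → ENNReal := fun t => u t - v t with hh
    have hhm : Measurable h := hu.sub hv
    have hhK : ∀ᵐ t ∂volume.restrict (Set.Ioo 0 T), h t ≤ volterra k h t := by
      filter_upwards [hfin, ae_restrict_mem measurableSet_Ioo] with t ht htm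
      rw [hh, tsub_le_iff_left]
      calc u t ≤ A t + volterra k u t := hule t htm.1
        _ ≤ A t + volterra k (v + h) t := by
            gcongr
            exact volterra_mono (fun s _ => le_add_tsub) t
        _ = (A t + volterra k v t) + volterra k h t := by
            rw [volterra_add hk hv, add_assoc]
        _ ≤ v t + volterra k h t := by
            gcongr
            exact hvge t htm.1 ht
    have hle : ∫⁻ s in Set.Ioo 0 T, expWeight l s * h s
        ≤ 0 + 2⁻¹ * ∫⁻ s in Set.Ioo 0 T, expWeight l s * h s := by
      rw [zero_add]
      calc ∫⁻ s in Set.Ioo 0 T, expWeight l s * h s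
          ≤ ∫⁻ s in Set.Ioo 0 T, expWeight l s * volterra k h s := by
            refine lintegral_mono_ae ?_
            filter_upwards [hhK] with t ht
            gcongr
        _ ≤ _ := (lintegral_expWeight_mul_volterra_le hk hk0 hhm l T).trans (by gcongr)
    have hne : ∫⁻ s in Set.Ioo 0 T, expWeight l s * h s ≠ ⊤ := by
      refine ne_top_of_le_ne_top (hufin T) (lintegral_mono fun s => ?_)
      dsimp only
      gcongr
      exact tsub_le_self
    have hzero := ENNReal.le_two_mul_of_le_add_half hne hle
    rw [mul_zero, nonpos_iff_eq_zero, lintegral_eq_zero_iff (by fun_prop)] at hzero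
    filter_upwards [hzero] with t ht
    have : h t = 0 := (mul_eq_zero.1 ht).resolve_left (expWeight_ne_zero l t)
    exact tsub_eq_zero_iff_le.1 this
  have hun : Set.Ioi (0 : ℝ) = ⋃ n : ℕ, Set.Ioo (0 : ℝ) n := by
    ext x
    simp only [Set.mem_Ioi, Set.mem_iUnion, Set.mem_Ioo, exists_and_left]
    exact ⟨fun h => ⟨h, exists_nat_gt x⟩, fun h => h.1⟩
  rw [hun, ae_restrict_iUnion_iff]
  exact fun n => key n

/-- The least solution of the Volterra equation lies below every supersolution. -/
theorem exists_volterra_solution_le {k A φ : ℝ → ENNReal} (hk : Measurable k)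
    (hA : Measurable A) (hφ : ∀ t > 0, A t + volterra k φ t ≤ φ t) :
    ∃ F : ℝ → ENNReal, Measurable F ∧ (∀ t, F t = A t + volterra k F t) ∧
      ∀ t > 0, F t ≤ φ t := by
  let u : ℕ → ℝ → ENNReal := fun n => Nat.rec 0 (fun _ v t => A t + volterra k v t) n
  have hu : ∀ n t, u (n + 1) t = A t + volterra k (u n) t := fun n t => rfl
  have hum : ∀ n, Measurable (u n) := by
    intro n
    induction n with
    | zero => exact measurable_const
    | succ n ih => exact hA.add (measurable_volterra hk ih)
  have hmono : Monotone u := by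
    refine monotone_nat_of_le_succ fun n => ?_
    induction n with
    | zero => exact fun t => zero_le
    | succ n ih =>
      intro t
      rw [hu n, hu (n + 1)]
      gcongr
      exact volterra_mono (fun s _ => ih s) t
  refine ⟨fun t => ⨆ n, u n t, .iSup hum, fun t => ?_, fun t ht => iSup_le fun n => ?_⟩
  · rw [volterra_iSup hk hum hmono, ENNReal.add_iSup]
    simp only [← hu]
    exact ((show Monotone fun n => u n t from fun m n h => hmono h t).iSup_nat_add 1).symm
  · induction n generalizing t with
    | zero => exact zero_le
    | succ n ih =>
      rw [hu]
      exact le_trans (by gcongr; exact volterra_mono ih t) (hφ t ht)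

/-- The kernel `b x^{-θ}` on `(0, ∞)`, extended by zero. -/
noncomputable def powerKernel (θ b : ℝ) : ℝ → ENNReal :=
  (Set.Ioi 0).indicator fun x => ENNReal.ofReal (b * x ^ (-θ))

theorem measurable_powerKernel (θ b : ℝ) : Measurable (powerKernel θ b) := by
  unfold powerKernel
  exact Measurable.indicator (by fun_prop) measurableSet_Ioi

theorem powerKernel_of_pos (θ b : ℝ) {x : ℝ} (hx : 0 < x) :
    powerKernel θ b x = ENNReal.ofReal (b * x ^ (-θ)) :=
  Set.indicator_of_mem (Set.mem_Ioi.2 hx) _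

theorem powerKernel_of_nonpos (θ b : ℝ) {x : ℝ} (hx : x ≤ 0) : powerKernel θ b x = 0 :=
  Set.indicator_of_notMem (by simpa using hx) _

theorem exists_le_powerKernel {θ b : ℝ} (hθ : 0 ≤ θ) (hb : 0 < b) {T : ℝ} (hT : 0 < T) :
    ∃ δ ≠ 0, ∀ x ∈ Set.Ioo 0 T, δ ≤ powerKernel θ b x := by
  refine ⟨ENNReal.ofReal (b * T ^ (-θ)), ?_, fun x hx => ?_⟩
  · have : 0 < b * T ^ (-θ) := by positivity
    simpa using this
  · rw [powerKernel_of_pos θ b hx.1]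
    refine ENNReal.ofReal_le_ofReal (mul_le_mul_of_nonneg_left ?_ hb.le)
    exact Real.rpow_le_rpow_of_nonpos hx.1 hx.2.le (by linarith)

theorem volterra_powerKernel_ofReal {θ b : ℝ} {g : ℝ → ℝ} (hg : ∀ t > 0, 0 ≤ g t) (t : ℝ) :
    volterra (powerKernel θ b) (fun s => ENNReal.ofReal (g s)) t =
      ∫⁻ s in Set.Ioo 0 t, ENNReal.ofReal (b * (g s * (t - s) ^ (-θ))) := by
  rw [volterra_eq_setLIntegral (fun x hx => powerKernel_of_nonpos θ b hx) _ le_rfl]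
  refine setLIntegral_congr_fun measurableSet_Ioo fun s hs => ?_
  rw [powerKernel_of_pos θ b (sub_pos.2 hs.2), ← ENNReal.ofReal_mul (hg s hs.1)]
  ring_nf

theorem mul_integral_eq_toReal_volterra {θ b : ℝ} (hb : 0 < b) {g : ℝ → ℝ} (hgm : Measurable g)
    (hg : ∀ t > 0, 0 ≤ g t) (t : ℝ) :
    b * ∫ s in Set.Ioo (0 : ℝ) t, g s * (t - s) ^ (-θ) =
      (volterra (powerKernel θ b) (fun s => ENNReal.ofReal (g s)) t).toReal := by
  rw [volterra_powerKernel_ofReal hg, ← integral_const_mul]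
  refine integral_eq_lintegral_of_nonneg_ae ?_ (by fun_prop)
  filter_upwards [ae_restrict_mem measurableSet_Ioo] with s hs
  have := hg s hs.1
  have := Real.rpow_nonneg (sub_pos.2 hs.2).le (-θ)
  simp only [Pi.zero_apply]
  positivity

theorem integral_rpow_neg_mul_exp_neg {θ l : ℝ} (hθ : θ < 1) (hl : 0 < l) :
    ∫ x in Set.Ioi (0 : ℝ), x ^ (-θ) * Real.exp (-l * x) =
      (1 / l) ^ (1 - θ) * Real.Gamma (1 - θ) := by
  rw [← Real.integral_rpow_mul_exp_neg_mul_Ioi (by linarith) hl]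
  simp only [neg_mul]
  congr! 4
  ring

theorem integrableOn_rpow_neg_mul_exp_neg {θ l : ℝ} (hθ : θ < 1) (hl : 0 < l) :
    IntegrableOn (fun x : ℝ => x ^ (-θ) * Real.exp (-l * x)) (Set.Ioi 0) := by
  simpa using integrableOn_rpow_mul_exp_neg_mul_rpow (s := -θ) (by linarith) zero_lt_one hl

theorem lintegral_expWeight_mul_powerKernel {θ b l : ℝ} (hθ : θ < 1) (hb : 0 < b) (hl : 0 < l) :
    ∫⁻ x, expWeight l x * powerKernel θ b x =
      ENNReal.ofReal (b * ((1 / l) ^ (1 - θ) * Real.Gamma (1 - θ))) := by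
  rw [← integral_rpow_neg_mul_exp_neg hθ hl, ← integral_const_mul,
    ofReal_integral_eq_lintegral_ofReal ((integrableOn_rpow_neg_mul_exp_neg hθ hl).const_mul b),
    ← lintegral_indicator measurableSet_Ioi]
  · congr 1 with x
    by_cases hx : 0 < x
    · rw [powerKernel_of_pos θ b hx, Set.indicator_of_mem (Set.mem_Ioi.2 hx), expWeight,
        ← ENNReal.ofReal_mul (Real.exp_pos _).le]
      ring_nf
    · rw [powerKernel_of_nonpos θ b (not_lt.1 hx), Set.indicator_of_notMem (by simpa using hx),
        mul_zero]
  · filter_upwards [ae_restrict_mem measurableSet_Ioi] with x hx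
    have := Real.rpow_nonneg (le_of_lt hx) (-θ)
    simp only [Pi.zero_apply]
    positivity

theorem mul_one_div_rpow_self {θ κ : ℝ} (hθ : θ < 1) (hκ : 0 < κ) :
    κ * (1 / κ ^ (1 / (1 - θ))) ^ (1 - θ) = 1 := by
  have h1 : 1 - θ ≠ 0 := by linarith
  rw [one_div, Real.inv_rpow (by positivity), ← Real.rpow_mul hκ.le, one_div,
    inv_mul_cancel₀ h1, Real.rpow_one, mul_inv_cancel₀ hκ.ne']

theorem exists_lintegral_expWeight_mul_powerKernel_le {θ b : ℝ} (hθ : θ < 1) (hb : 0 < b) :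
    ∃ l > 0, ∫⁻ x, expWeight l x * powerKernel θ b x ≤ 2⁻¹ := by
  have hΓ : 0 < Real.Gamma (1 - θ) := Real.Gamma_pos_of_pos (by linarith)
  have hκ : 0 < 2 * (b * Real.Gamma (1 - θ)) := by positivity
  refine ⟨(2 * (b * Real.Gamma (1 - θ))) ^ (1 / (1 - θ)), by positivity, ?_⟩
  rw [lintegral_expWeight_mul_powerKernel hθ hb (by positivity)]
  have h := mul_one_div_rpow_self hθ hκ
  refine (congrArg ENNReal.ofReal ?_).trans_le
    (ENNReal.ofReal_inv_of_pos (zero_lt_two' ℝ)).le |>.trans (by simp)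
  linear_combination h / 2

theorem mul_integral_rpow_neg_mul_exp_neg_le {θ b l : ℝ} (hθ0 : 0 ≤ θ) (hθ : θ < 1) (hb : 0 < b)
    (hl : 0 < l) (hone : b * ((1 / l) ^ (1 - θ) * Real.Gamma (1 - θ)) = 1) {t : ℝ} (ht : 0 < t) :
    b * ∫ x in (0 : ℝ)..t, x ^ (-θ) * Real.exp (-l * x) ≤
      1 - b * ((t + 1) ^ (-θ) * Real.exp (-l * (t + 1))) := by
  have hint := integrableOn_rpow_neg_mul_exp_neg hθ hl
  have h1 : (∫ x in Set.Ioc 0 t, x ^ (-θ) * Real.exp (-l * x))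
      + ∫ x in Set.Ioc t (t + 1), x ^ (-θ) * Real.exp (-l * x)
      ≤ ∫ x in Set.Ioi (0 : ℝ), x ^ (-θ) * Real.exp (-l * x) := by
    rw [← setIntegral_union (Set.Ioc_disjoint_Ioc_of_le le_rfl) measurableSet_Ioc
      (hint.mono_set Set.Ioc_subset_Ioi_self)
      (hint.mono_set fun x hx => ht.trans hx.1)]
    refine setIntegral_mono_set hint ?_ (LE.le.eventuallyLE ?_)
    · filter_upwards [ae_restrict_mem measurableSet_Ioi] with x hx
      have := Real.rpow_nonneg (le_of_lt hx) (-θ)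
      simp only [Pi.zero_apply]
      positivity
    · rintro x (hx | hx)
      · exact hx.1
      · exact ht.trans hx.1
  have h2 : (t + 1) ^ (-θ) * Real.exp (-l * (t + 1))
      ≤ ∫ x in Set.Ioc t (t + 1), x ^ (-θ) * Real.exp (-l * x) := by
    have h3 : ∫ _ in Set.Ioc t (t + 1), (t + 1) ^ (-θ) * Real.exp (-l * (t + 1))
        = (t + 1) ^ (-θ) * Real.exp (-l * (t + 1)) := by
      simp
    rw [← h3]
    refine setIntegral_mono_on (integrableOn_const (by simp)) (hint.mono_set fun x hx => ht.trans hx.1)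
      measurableSet_Ioc fun x hx => ?_
    have hx0 : 0 < x := ht.trans hx.1
    refine mul_le_mul (Real.rpow_le_rpow_of_nonpos hx0 hx.2 (by linarith))
      (Real.exp_le_exp.2 ?_) (Real.exp_pos _).le (Real.rpow_nonneg hx0.le _)
    nlinarith [hx.2]
  rw [integral_rpow_neg_mul_exp_neg hθ hl] at h1
  rw [intervalIntegral.integral_of_le ht.le]
  linear_combination b * h1 + b * h2 + hone

theorem integral_exp_sub_const_mul_rpow {θ l M D : ℝ} (hθ : θ < 1) {t : ℝ} (ht : 0 < t)
    (hl : 0 < l) :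
    IntegrableOn (fun s => (M * Real.exp (l * s) - D) * (t - s) ^ (-θ)) (Set.Ioo 0 t) ∧
    ∫ s in Set.Ioo 0 t, (M * Real.exp (l * s) - D) * (t - s) ^ (-θ) =
      M * Real.exp (l * t) * (∫ x in (0 : ℝ)..t, x ^ (-θ) * Real.exp (-l * x))
        - D * (t ^ (1 - θ) / (1 - θ)) := by
  have hI1 : IntervalIntegrable (fun x : ℝ => x ^ (-θ) * Real.exp (-l * x)) volume 0 t :=
    (intervalIntegrable_iff_integrableOn_Ioc_of_le ht.le).2
      ((integrableOn_rpow_neg_mul_exp_neg hθ hl).mono_set Set.Ioc_subset_Ioi_self)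
  have hI2 : IntervalIntegrable (fun x : ℝ => x ^ (-θ)) volume 0 t :=
    intervalIntegral.intervalIntegrable_rpow' (by linarith)
  have hfun : (fun s => (M * Real.exp (l * s) - D) * (t - s) ^ (-θ)) = fun s =>
      (fun x => M * Real.exp (l * t) * (x ^ (-θ) * Real.exp (-l * x)) - D * x ^ (-θ)) (t - s) := by
    ext s
    have : Real.exp (l * s) = Real.exp (l * t) * Real.exp (-l * (t - s)) := by
      rw [← Real.exp_add]; ring_nf
    simp only [this]
    ring
  have hI := (hI1.const_mul (M * Real.exp (l * t))).sub (hI2.const_mul D)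
  constructor
  · rw [hfun, ← integrableOn_Ioc_iff_integrableOn_Ioo,
      ← intervalIntegrable_iff_integrableOn_Ioc_of_le ht.le]
    simpa using (hI.comp_sub_left t).symm
  · rw [← integral_Ioc_eq_integral_Ioo, ← intervalIntegral.integral_of_le ht.le, hfun,
      intervalIntegral.integral_comp_sub_left (fun x : ℝ =>
        M * Real.exp (l * t) * (x ^ (-θ) * Real.exp (-l * x)) - D * x ^ (-θ)),
      sub_self, sub_zero, intervalIntegral.integral_sub (hI1.const_mul _) (hI2.const_mul _),
      intervalIntegral.integral_const_mul, intervalIntegral.integral_const_mul,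
      integral_rpow (Or.inl (by linarith)), Real.zero_rpow (by linarith)]
    ring_nf

/-- For the critical rate `l`, the function `M e^{lt} - C` is a supersolution of the Volterra
equation with constant forcing `C`, provided `M` is large enough. -/
theorem exists_exp_supersolution {θ b l : ℝ} (hθ0 : 0 ≤ θ) (hθ : θ < 1) (hb : 0 < b)
    (hl : 0 < l) (hone : b * ((1 / l) ^ (1 - θ) * Real.Gamma (1 - θ)) = 1) {C : ℝ} (hC : 0 < C) :
    ∃ M, C ≤ M ∧ ∀ t > 0, ENNReal.ofReal C + volterra (powerKernel θ b)
      (fun s => ENNReal.ofReal (M * Real.exp (l * s) - C)) t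
        ≤ ENNReal.ofReal (M * Real.exp (l * t) - C) := by
  have hθ' : 0 < 1 - θ := by linarith
  set t₁ : ℝ := (2 * (1 - θ) / b) ^ (1 / (1 - θ)) with ht₁
  have ht₁0 : 0 < t₁ := by positivity
  have ht₁pow : b * (t₁ ^ (1 - θ) / (1 - θ)) = 2 := by
    rw [ht₁, ← Real.rpow_mul (by positivity), one_div, inv_mul_cancel₀ hθ'.ne', Real.rpow_one]
    field_simp
  set q : ℝ := b * ((t₁ + 1) ^ (-θ) * Real.exp (-l)) with hq
  have hq0 : 0 < q := by positivity
  set M : ℝ := C + 2 * C / q with hM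
  have hMC : C ≤ M := le_add_of_nonneg_right (by positivity)
  have hMq : 2 * C ≤ M * q := by
    rw [hM, add_mul, div_mul_cancel₀ _ hq0.ne']
    nlinarith
  have hM0 : 0 < M := hC.trans_le hMC
  have hφ : ∀ t > 0, 0 ≤ M * Real.exp (l * t) - C := by
    intro t ht
    have : 1 ≤ Real.exp (l * t) := Real.one_le_exp (by positivity)
    nlinarith
  refine ⟨M, hMC, fun t ht => ?_⟩
  obtain ⟨hint, heq⟩ := integral_exp_sub_const_mul_rpow (θ := θ) (l := l) (M := M) (D := C) hθ ht hl
  have hnn : ∀ s ∈ Set.Ioo 0 t, 0 ≤ b * ((M * Real.exp (l * s) - C) * (t - s) ^ (-θ)) :=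
    fun s hs => mul_nonneg hb.le (mul_nonneg (hφ s hs.1) (Real.rpow_nonneg (sub_pos.2 hs.2).le _))
  rw [volterra_powerKernel_ofReal hφ, ← ofReal_integral_eq_lintegral_ofReal (hint.const_mul b)
    (by filter_upwards [ae_restrict_mem measurableSet_Ioo] with s hs using hnn s hs),
    ← ENNReal.ofReal_add hC.le (setIntegral_nonneg measurableSet_Ioo hnn), integral_const_mul, heq]
  refine ENNReal.ofReal_le_ofReal ?_
  have hE := mul_le_mul_of_nonneg_left
    (mul_integral_rpow_neg_mul_exp_neg_le hθ0 hθ hb hl hone ht)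
    (show 0 ≤ M * Real.exp (l * t) by positivity)
  have hexp : Real.exp (l * t) * Real.exp (-l * (t + 1)) = Real.exp (-l) := by
    rw [← Real.exp_add]; ring_nf
  have hpow0 : 0 ≤ b * (t ^ (1 - θ) / (1 - θ)) := by positivity
  have hmain : 2 * C ≤ M * (b * ((t + 1) ^ (-θ) * Real.exp (-l)))
      + C * (b * (t ^ (1 - θ) / (1 - θ))) := by
    rcases le_total t t₁ with h | h
    · have : q ≤ b * ((t + 1) ^ (-θ) * Real.exp (-l)) := by
        rw [hq]
        gcongr ?_ * (?_ * ?_)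
        exact Real.rpow_le_rpow_of_nonpos (by positivity) (by linarith) (by linarith)
      nlinarith [mul_le_mul_of_nonneg_left this hM0.le]
    · have h2 : 2 ≤ b * (t ^ (1 - θ) / (1 - θ)) := by
        rw [← ht₁pow]
        gcongr
      have : 0 ≤ M * (b * ((t + 1) ^ (-θ) * Real.exp (-l))) := by positivity
      nlinarith
  rw [← hexp] at hmain
  linear_combination hE + hmain

theorem limsup_log_div_lt_top {f : ℝ → ℝ} {M l : ℝ} (hM : 1 ≤ M) (hl : 0 ≤ l)
    (hf0 : ∀ t > 0, 0 ≤ f t) (hf : ∀ t > 0, f t ≤ M * Real.exp (l * t)) :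
    limsup (fun t : ℝ => ((Real.log (f t) / t : ℝ) : EReal)) atTop < ⊤ := by
  refine lt_of_le_of_lt (limsup_le_of_le (a := ((Real.log M + l : ℝ) : EReal)) ?_ ?_)
    (EReal.coe_lt_top _)
  · isBoundedDefault
  filter_upwards [eventually_ge_atTop 1] with t ht
  have ht0 : 0 < t := by linarith
  have hlogM : 0 ≤ Real.log M := Real.log_nonneg hM
  rw [EReal.coe_le_coe_iff, div_le_iff₀ ht0]
  have h1 : Real.log M ≤ Real.log M * t := le_mul_of_one_le_right hlogM ht
  rcases (hf0 t ht0).eq_or_lt with h | h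
  · rw [← h, Real.log_zero]
    positivity
  · have := Real.log_le_log h (hf t ht0)
    rw [Real.log_mul (by positivity) (Real.exp_pos _).ne', Real.log_exp] at this
    linarith

/-- Measurable nonnegative solutions of the renewal equation are unique. -/
theorem renewal_solution_unique {θ b : ℝ} (hθ : θ ∈ Set.Ioo (0 : ℝ) 1) (hb : 0 < b)
    {a : ℝ → ℝ} {C : ℝ} (ha0 : ∀ t > 0, 0 ≤ a t) (haC : ∀ t > 0, a t ≤ C) {f g : ℝ → ℝ}
    (hfm : Measurable f) (hf0 : ∀ t > 0, 0 ≤ f t)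
    (hf : ∀ t > 0, f t = a t + b * ∫ s in Set.Ioo (0 : ℝ) t, f s * (t - s) ^ (-θ))
    (hgm : Measurable g) (hg0 : ∀ t > 0, 0 ≤ g t)
    (hg : ∀ t > 0, g t = a t + b * ∫ s in Set.Ioo (0 : ℝ) t, g s * (t - s) ^ (-θ)) :
    ∀ t > 0, g t = f t := by
  obtain ⟨l, hl, hkl⟩ := exists_lintegral_expWeight_mul_powerKernel_le hθ.2 hb
  have hk := measurable_powerKernel θ b
  have hk0 : ∀ x ≤ 0, powerKernel θ b x = 0 := fun x hx => powerKernel_of_nonpos θ b hx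
  have key : ∀ h : ℝ → ℝ, Measurable h → (∀ t > 0, 0 ≤ h t) →
      (∀ t > 0, h t = a t + b * ∫ s in Set.Ioo (0 : ℝ) t, h s * (t - s) ^ (-θ)) →
      ∀ t > 0, ENNReal.ofReal (h t) = ENNReal.ofReal (a t) + ENNReal.ofReal
        (volterra (powerKernel θ b) (fun s => ENNReal.ofReal (h s)) t).toReal := by
    intro h hm h0 heq t ht
    rw [heq t ht, mul_integral_eq_toReal_volterra hb hm h0,
      ENNReal.ofReal_add (ha0 t ht) ENNReal.toReal_nonneg]
  have hsub : ∀ h : ℝ → ℝ, Measurable h → (∀ t > 0, 0 ≤ h t) →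
      (∀ t > 0, h t = a t + b * ∫ s in Set.Ioo (0 : ℝ) t, h s * (t - s) ^ (-θ)) →
      ∀ t > 0, ENNReal.ofReal (h t) ≤ ENNReal.ofReal (a t)
        + volterra (powerKernel θ b) (fun s => ENNReal.ofReal (h s)) t := by
    intro h hm h0 heq t ht
    rw [key h hm h0 heq t ht]
    gcongr
    exact ENNReal.ofReal_toReal_le
  have hfin : ∀ h : ℝ → ℝ, Measurable h → (∀ t > 0, 0 ≤ h t) →
      (∀ t > 0, h t = a t + b * ∫ s in Set.Ioo (0 : ℝ) t, h s * (t - s) ^ (-θ)) →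
      ∀ T, ∫⁻ s in Set.Ioo 0 T, expWeight l s * ENNReal.ofReal (h s) ≠ ⊤ := by
    intro h hm h0 heq
    refine lintegral_expWeight_mul_ne_top hk hk0
      (fun T hT => exists_le_powerKernel hθ.1.le hb hT) hm.ennreal_ofReal hl hkl
      (C := ENNReal.ofReal C) ENNReal.ofReal_ne_top (fun t ht => ?_) fun t ht htop => ?_
    · refine (hsub h hm h0 heq t ht).trans ?_
      gcongr
      exact haC t ht
    · rw [key h hm h0 heq t ht, htop, ENNReal.toReal_top, ENNReal.ofReal_zero, add_zero]
      exact ENNReal.ofReal_le_ofReal (haC t ht)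
  have hle : ∀ h₁ : ℝ → ℝ, Measurable h₁ → (∀ t > 0, 0 ≤ h₁ t) →
      (∀ t > 0, h₁ t = a t + b * ∫ s in Set.Ioo (0 : ℝ) t, h₁ s * (t - s) ^ (-θ)) →
      ∀ h₂ : ℝ → ℝ, Measurable h₂ → (∀ t > 0, 0 ≤ h₂ t) →
      (∀ t > 0, h₂ t = a t + b * ∫ s in Set.Ioo (0 : ℝ) t, h₂ s * (t - s) ^ (-θ)) →
      ∀ᵐ t ∂volume.restrict (Set.Ioi 0), ENNReal.ofReal (h₁ t) ≤ ENNReal.ofReal (h₂ t) := by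
    intro h₁ hm₁ h0₁ heq₁ h₂ hm₂ h0₂ heq₂
    refine volterra_comparison hk hk0 hm₁.ennreal_ofReal hm₂.ennreal_ofReal hkl
      (hfin h₁ hm₁ h0₁ heq₁) (hfin h₂ hm₂ h0₂ heq₂) (hsub h₁ hm₁ h0₁ heq₁) fun t ht htop => ?_
    rw [key h₂ hm₂ h0₂ heq₂ t ht, ENNReal.ofReal_toReal htop]
  intro t ht
  rw [hf t ht, hg t ht, mul_integral_eq_toReal_volterra hb hfm hf0,
    mul_integral_eq_toReal_volterra hb hgm hg0]
  congr 2
  refine volterra_congr_ae ?_ t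
  filter_upwards [hle f hfm hf0 hf g hgm hg0 hg, hle g hgm hg0 hg f hfm hf0 hf] with s h₁ h₂
  exact le_antisymm h₂ h₁

/-- Existence and uniqueness for the renewal equation
`f(t) = a(t) + b ∫₀ᵗ f(s) (t-s)^{-θ} ds` among nonnegative measurable
functions of at most exponential growth; moreover the solution is
`O(e^{ct})` with `c = (b Γ(1-θ))^{1/(1-θ)}`. -/
theorem renewal_equation_exists_unique
    (θ b : ℝ) (hθ : θ ∈ Set.Ioo (0 : ℝ) 1) (hb : 0 < b)
    (a : ℝ → ℝ) (ha_meas : Measurable a)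
    (ha_nonneg : ∀ t ≥ (0 : ℝ), 0 ≤ a t)
    (ha_anti : ∀ s t : ℝ, 0 ≤ s → s ≤ t → a t ≤ a s)
    (ha_bdd : ∃ C : ℝ, ∀ t ≥ (0 : ℝ), a t ≤ C) :
    ∃ f : ℝ → ℝ,
      (Measurable f ∧ (∀ t > (0 : ℝ), 0 ≤ f t) ∧
        (∀ t > (0 : ℝ),
          f t = a t + b * ∫ s in Set.Ioo (0 : ℝ) t, f s * (t - s) ^ (-θ)) ∧
        limsup (fun t : ℝ => ((Real.log (f t) / t : ℝ) : EReal)) atTop < ⊤) ∧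
      (f =O[atTop]
        fun t : ℝ => Real.exp ((b * Real.Gamma (1 - θ)) ^ (1 / (1 - θ)) * t)) ∧
      (∀ g : ℝ → ℝ,
        (Measurable g ∧ (∀ t > (0 : ℝ), 0 ≤ g t) ∧
          (∀ t > (0 : ℝ),
            g t = a t + b * ∫ s in Set.Ioo (0 : ℝ) t, g s * (t - s) ^ (-θ)) ∧
          limsup (fun t : ℝ => ((Real.log (g t) / t : ℝ) : EReal)) atTop < ⊤) →
        ∀ t > (0 : ℝ), g t = f t) := by

  obtain ⟨C₀, hC₀⟩ := ha_bdd
  set C : ℝ := max C₀ 1 with hC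
  have hC1 : 1 ≤ C := le_max_right _ _
  have haC : ∀ t > 0, a t ≤ C := fun t ht => (hC₀ t (le_of_lt ht)).trans (le_max_left _ _)
  have ha0 : ∀ t > 0, 0 ≤ a t := fun t ht => ha_nonneg t (le_of_lt ht)
  have hΓ : 0 < Real.Gamma (1 - θ) := Real.Gamma_pos_of_pos (by linarith [hθ.2])
  have hκ : 0 < b * Real.Gamma (1 - θ) := by positivity
  set c : ℝ := (b * Real.Gamma (1 - θ)) ^ (1 / (1 - θ)) with hc
  have hc0 : 0 < c := by positivity
  have hone : b * ((1 / c) ^ (1 - θ) * Real.Gamma (1 - θ)) = 1 := by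
    linear_combination mul_one_div_rpow_self hθ.2 hκ
  obtain ⟨M, hCM, hM⟩ := exists_exp_supersolution hθ.1.le hθ.2 hb hc0 hone
    (zero_lt_one.trans_le hC1)
  obtain ⟨F, hFm, hF, hFle⟩ := exists_volterra_solution_le (measurable_powerKernel θ b)
    ha_meas.ennreal_ofReal (φ := fun s => ENNReal.ofReal (M * Real.exp (c * s) - C))
    fun t ht => le_trans (by gcongr; exact haC t ht) (hM t ht)
  have hFtop : ∀ t > 0, F t ≠ ⊤ := fun t ht => ne_top_of_le_ne_top ENNReal.ofReal_ne_top (hFle t ht)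
  have hfm : Measurable fun t => (F t).toReal := hFm.ennreal_toReal
  have hf0 : ∀ t > 0, 0 ≤ (F t).toReal := fun t _ => ENNReal.toReal_nonneg
  have hfle : ∀ t > 0, (F t).toReal ≤ M * Real.exp (c * t) := by
    intro t ht
    have hpos : 0 ≤ M * Real.exp (c * t) :=
      mul_nonneg (by linarith) (Real.exp_pos _).le
    refine ENNReal.toReal_le_of_le_ofReal hpos ((hFle t ht).trans ?_)
    exact ENNReal.ofReal_le_ofReal (by linarith)
  have hfeq : ∀ t > 0, (F t).toReal =
      a t + b * ∫ s in Set.Ioo (0 : ℝ) t, (F s).toReal * (t - s) ^ (-θ) := by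
    intro t ht
    rw [mul_integral_eq_toReal_volterra hb hfm hf0]
    have h1 : volterra (powerKernel θ b) (fun s => ENNReal.ofReal (F s).toReal) t =
        volterra (powerKernel θ b) F t := by
      refine volterra_congr_ae ?_ t
      filter_upwards [ae_restrict_mem measurableSet_Ioi] with s hs
      exact ENNReal.ofReal_toReal (hFtop s hs)
    have h2 : volterra (powerKernel θ b) F t ≠ ⊤ :=
      ne_top_of_le_ne_top (hFtop t ht) (by rw [hF t]; exact le_add_self)
    rw [h1, hF t, ENNReal.toReal_add ENNReal.ofReal_ne_top h2, ENNReal.toReal_ofReal (ha0 t ht)]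
  refine ⟨fun t => (F t).toReal, ⟨hfm, hf0, hfeq,
    limsup_log_div_lt_top (hC1.trans hCM) hc0.le hf0 hfle⟩, ?_, ?_⟩
  · refine IsBigO.of_bound M ?_
    filter_upwards [eventually_gt_atTop 0] with t ht
    rw [Real.norm_of_nonneg (hf0 t ht), Real.norm_of_nonneg (Real.exp_pos _).le]
    exact hfle t ht
  · rintro g ⟨hgm, hg0, hg, -⟩
    exact renewal_solution_unique hθ hb ha0 haC hfm hf0 hfeq hgm hg0 hg
end

section
/- Fix θ ∈ (0,1) and b ∈ (0,∞), and let a : [0,∞) → [0,∞) be measurable, non-increasing and bounded. If f : (0,∞) → [0,∞) is measurable, satisfies f(t) = a(t) + b ∫₀ᵗ f(s) (t-s)^{-θ} ds for all t > 0, and limsup_{t→∞} (1/t) log f(t) < ∞, then lim_{t→∞} e^{-ct} f(t) = (c/(1-θ)) ∫₀^∞ a(y) e^{-cy} dy, where c := (b Γ(1-θ))^{1/(1-θ)}. -/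
open MeasureTheory Filter
open scoped ENNReal

/-- The half line `[0, ∞)` is the disjoint union of the intervals `[nα, (n+1)α)`. -/
lemma lintegral_Ici_eq_tsum_Ico {α : ℝ} (hα : 0 < α) (q : ℝ → ℝ≥0∞) :
    ∫⁻ u in Set.Ici 0, q u = ∑' n : ℕ, ∫⁻ u in Set.Ico (n * α) ((n + 1 : ℕ) * α), q u := by
  have hmono : Monotone fun n : ℕ => (n : ℝ) * α := fun m n h => by
    simp only; gcongr
  have hdisj : Pairwise (Function.onFun Disjoint
      fun n : ℕ => Set.Ico ((n : ℝ) * α) ((n + 1 : ℕ) * α)) := hmono.pairwise_disjoint_on_Ico_succ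
  rw [← lintegral_iUnion (fun _ => measurableSet_Ico) hdisj]
  congr 2
  ext u
  simp only [Set.mem_Ici, Set.mem_iUnion, Set.mem_Ico]
  constructor
  · intro hu
    refine ⟨⌊u / α⌋₊, ?_, ?_⟩
    · rw [← le_div_iff₀ hα]; exact Nat.floor_le (by positivity)
    · rw [← div_lt_iff₀ hα]; push_cast; exact Nat.lt_floor_add_one _
  · rintro ⟨n, hn, -⟩
    exact le_trans (by positivity) hn

lemma lintegral_Ici_le_tsum_of_unimodal {α m : ℝ} (hα : 0 < α) (hm : 0 ≤ m) {q : ℝ → ℝ≥0∞}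
    (h0 : q 0 = 0) (hmono : MonotoneOn q (Set.Icc 0 m)) (hanti : AntitoneOn q (Set.Ici m)) :
    ∫⁻ u in Set.Ici 0, q u ≤ ENNReal.ofReal α * (∑' n : ℕ, q (n * α)) + ENNReal.ofReal α * q m := by
  have hmax : ∀ u, 0 ≤ u → q u ≤ q m := fun u hu => by
    rcases le_total u m with h | h
    · exact hmono ⟨hu, h⟩ ⟨hm, le_rfl⟩ h
    · exact hanti (Set.mem_Ici.2 le_rfl) h h
  set N := ⌊m / α⌋₊ with hN
  have hN1 : N * α ≤ m := by
    rw [← le_div_iff₀ hα]; exact Nat.floor_le (by positivity)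
  have hN2 : m < (N + 1 : ℕ) * α := by
    rw [← div_lt_iff₀ hα]; push_cast; exact Nat.lt_floor_add_one _
  obtain ⟨I, hI⟩ : ∃ I : ℕ → ℝ≥0∞,
      ∀ n : ℕ, I n = ∫⁻ u in Set.Ico (n * α) ((n + 1 : ℕ) * α), q u :=
    ⟨fun n => ∫⁻ u in Set.Ico (n * α) ((n + 1 : ℕ) * α), q u, fun _ => rfl⟩
  obtain ⟨s, hs⟩ : ∃ s : ℕ → ℝ≥0∞, ∀ n : ℕ, s n = q (n * α) :=
    ⟨fun n => q (n * α), fun _ => rfl⟩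
  have bnd : ∀ (n : ℕ) (B : ℝ≥0∞),
      (∀ u ∈ Set.Ico (n * α) ((n + 1 : ℕ) * α), q u ≤ B) →
      I n ≤ ENNReal.ofReal α * B := by
    intro n B hB
    rw [hI]
    calc _ ≤ ∫⁻ u in Set.Ico (n * α) ((n + 1 : ℕ) * α), B := setLIntegral_mono measurable_const hB
      _ = _ := by
        rw [setLIntegral_const, Real.volume_Ico, mul_comm]; congr 2; push_cast; ring
  rw [lintegral_Ici_eq_tsum_Ico hα, ← tsum_congr hI, ← tsum_congr hs]
  have e1 : ∑ n ∈ Finset.range (N + 1), I n + ∑' n, I (n + (N + 1)) = ∑' n, I n :=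
    Summable.sum_add_tsum_nat_add' ENNReal.summable
  have e2 : ∑ n ∈ Finset.range (N + 1), s n + ∑' n, s (n + (N + 1)) = ∑' n, s n :=
    Summable.sum_add_tsum_nat_add' ENNReal.summable
  have s0 : s 0 = 0 := by simp [hs, h0]
  have t1 : ∑ n ∈ Finset.range N, I n ≤
      ∑ n ∈ Finset.range N, ENNReal.ofReal α * s (n + 1) := by
    refine Finset.sum_le_sum fun n hn => bnd n _ fun u hu => ?_
    have : ((n + 1 : ℕ) : ℝ) * α ≤ m := le_trans (by
      have : n + 1 ≤ N := Finset.mem_range.1 hn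
      gcongr) hN1
    have h0 : 0 ≤ u := le_trans (by positivity) hu.1
    rw [hs]
    exact hmono ⟨h0, hu.2.le.trans this⟩ ⟨h0.trans hu.2.le, this⟩ hu.2.le
  have t2 : I N ≤ ENNReal.ofReal α * q m :=
    bnd N _ fun u hu => hmax u (le_trans (by positivity) hu.1)
  have t3 : ∑' n : ℕ, I (n + (N + 1)) ≤ ∑' n : ℕ, ENNReal.ofReal α * s (n + (N + 1)) := by
    refine ENNReal.tsum_le_tsum fun n => bnd _ _ fun u hu => ?_
    have : m ≤ ((n + (N + 1) : ℕ) : ℝ) * α := hN2.le.trans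
      (mul_le_mul_of_nonneg_right (Nat.cast_le.2 (Nat.le_add_left _ _)) hα.le)
    rw [hs]
    exact hanti this (this.trans hu.1) hu.1
  calc ∑' n, I n = ∑ n ∈ Finset.range N, I n + I N + ∑' n : ℕ, I (n + (N + 1)) := by
        rw [← e1, Finset.sum_range_succ]
    _ ≤ _ := add_le_add (add_le_add t1 t2) t3
    _ = ENNReal.ofReal α * ∑' n, s n + ENNReal.ofReal α * q m := by
      rw [← e2, Finset.sum_range_succ', ENNReal.tsum_mul_left, ← Finset.mul_sum, s0]
      ring

lemma tsum_le_lintegral_Ici_of_unimodal {α m : ℝ} (hα : 0 < α) (hm : 0 ≤ m) {q : ℝ → ℝ≥0∞}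
    (hmono : MonotoneOn q (Set.Icc 0 m)) (hanti : AntitoneOn q (Set.Ici m)) :
    ENNReal.ofReal α * (∑' n : ℕ, q (n * α)) ≤
      (∫⁻ u in Set.Ici 0, q u) + ENNReal.ofReal α * q m := by
  have hmax : ∀ u, 0 ≤ u → q u ≤ q m := fun u hu => by
    rcases le_total u m with h | h
    · exact hmono ⟨hu, h⟩ ⟨hm, le_rfl⟩ h
    · exact hanti (Set.mem_Ici.2 le_rfl) h h
  set N := ⌊m / α⌋₊ with hN
  have hN1 : N * α ≤ m := by
    rw [← le_div_iff₀ hα]; exact Nat.floor_le (by positivity)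
  have hN2 : m < (N + 1 : ℕ) * α := by
    rw [← div_lt_iff₀ hα]; push_cast; exact Nat.lt_floor_add_one _
  obtain ⟨I, hI⟩ : ∃ I : ℕ → ℝ≥0∞,
      ∀ n : ℕ, I n = ∫⁻ u in Set.Ico (n * α) ((n + 1 : ℕ) * α), q u :=
    ⟨fun n => ∫⁻ u in Set.Ico (n * α) ((n + 1 : ℕ) * α), q u, fun _ => rfl⟩
  obtain ⟨s, hs⟩ : ∃ s : ℕ → ℝ≥0∞, ∀ n : ℕ, s n = q (n * α) :=
    ⟨fun n => q (n * α), fun _ => rfl⟩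
  have bnd : ∀ (n : ℕ) (B : ℝ≥0∞),
      (∀ u ∈ Set.Ico (n * α) ((n + 1 : ℕ) * α), B ≤ q u) →
      ENNReal.ofReal α * B ≤ I n := by
    intro n B hB
    rw [hI]
    calc _ = ∫⁻ u in Set.Ico (n * α) ((n + 1 : ℕ) * α), B := by
          rw [setLIntegral_const, Real.volume_Ico, mul_comm]; congr 2; push_cast; ring
      _ ≤ _ := setLIntegral_mono' measurableSet_Ico hB
  rw [lintegral_Ici_eq_tsum_Ico hα, ← tsum_congr hI, ← tsum_congr hs]
  have e1 : ∑ n ∈ Finset.range (N + 1), I n + ∑' n, I (n + (N + 1)) = ∑' n, I n :=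
    Summable.sum_add_tsum_nat_add' ENNReal.summable
  have e2 : ∑ n ∈ Finset.range (N + 2), s n + ∑' n, s (n + (N + 2)) = ∑' n, s n :=
    Summable.sum_add_tsum_nat_add' ENNReal.summable
  have t1 : ∑ n ∈ Finset.range N, ENNReal.ofReal α * s n ≤ ∑ n ∈ Finset.range N, I n := by
    refine Finset.sum_le_sum fun n hn => bnd n _ fun u hu => ?_
    have : ((n + 1 : ℕ) : ℝ) * α ≤ m := le_trans (by
      have : n + 1 ≤ N := Finset.mem_range.1 hn
      gcongr) hN1
    have h0 : 0 ≤ (n : ℝ) * α := by positivity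
    rw [hs]
    exact hmono ⟨h0, hu.1.trans (hu.2.le.trans this)⟩ ⟨h0.trans hu.1, hu.2.le.trans this⟩ hu.1
  have t2 : ENNReal.ofReal α * min (s N) (s (N + 1)) ≤ I N :=
    bnd N _ fun u hu => by
      have h0 : 0 ≤ (N : ℝ) * α := by positivity
      rw [hs, hs]
      rcases le_total u m with h | h
      · exact (min_le_left _ _).trans (hmono ⟨h0, hN1⟩ ⟨h0.trans hu.1, h⟩ hu.1)
      · exact (min_le_right _ _).trans (hanti h (h.trans hu.2.le) hu.2.le)
  have t3 : ∑' n : ℕ, ENNReal.ofReal α * s (n + (N + 2)) ≤ ∑' n : ℕ, I (n + (N + 1)) := by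
    refine ENNReal.tsum_le_tsum fun n => bnd _ _ fun u hu => ?_
    have : m ≤ ((n + (N + 1) : ℕ) : ℝ) * α := hN2.le.trans
      (mul_le_mul_of_nonneg_right (Nat.cast_le.2 (Nat.le_add_left _ _)) hα.le)
    rw [hs]
    exact hanti (this.trans hu.1) (this.trans (hu.1.trans hu.2.le)) hu.2.le
  have t4 : s N + s (N + 1) ≤ min (s N) (s (N + 1)) + q m := by
    rw [← min_add_max]
    gcongr
    rw [hs, hs]
    exact max_le (hmax _ (by positivity)) (hmax _ (by positivity))
  calc ENNReal.ofReal α * ∑' n, s n = ∑ n ∈ Finset.range N, ENNReal.ofReal α * s n +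
          ENNReal.ofReal α * (s N + s (N + 1)) +
          ∑' n : ℕ, ENNReal.ofReal α * s (n + (N + 2)) := by
        rw [← e2, Finset.sum_range_succ, Finset.sum_range_succ, ENNReal.tsum_mul_left,
          ← Finset.mul_sum]
        ring
    _ ≤ ∑ n ∈ Finset.range N, I n + ENNReal.ofReal α * (min (s N) (s (N + 1)) + q m) +
          ∑' n : ℕ, I (n + (N + 1)) := by gcongr
    _ = ∑ n ∈ Finset.range N, I n + ENNReal.ofReal α * min (s N) (s (N + 1)) +
          ∑' n : ℕ, I (n + (N + 1)) + ENNReal.ofReal α * q m := by ring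
    _ ≤ ∑ n ∈ Finset.range N, I n + I N +
          ∑' n : ℕ, I (n + (N + 1)) + ENNReal.ofReal α * q m := by gcongr
    _ = ∑' n, I n + ENNReal.ofReal α * q m := by rw [← e1, Finset.sum_range_succ]

/-- The density at `x` of the Gamma distribution with shape `u` and unit rate. -/
noncomputable def gammaWeight (x u : ℝ) : ℝ := x ^ (u - 1) * Real.exp (-x) / Real.Gamma u

lemma gammaWeight_zero (x : ℝ) : gammaWeight x 0 = 0 := by
  simp [gammaWeight, Real.Gamma_zero]

lemma gammaWeight_pos {x u : ℝ} (hx : 0 < x) (hu : 0 < u) : 0 < gammaWeight x u :=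
  div_pos (mul_pos (Real.rpow_pos_of_pos hx _) (Real.exp_pos _)) (Real.Gamma_pos_of_pos hu)

lemma gammaWeight_nonneg {x u : ℝ} (hx : 0 < x) (hu : 0 ≤ u) : 0 ≤ gammaWeight x u := by
  rcases hu.eq_or_lt with rfl | h
  · rw [gammaWeight_zero]
  · exact (gammaWeight_pos hx h).le

lemma gammaWeight_add_one {x u : ℝ} (hx : 0 < x) (hu : 0 < u) :
    gammaWeight x (u + 1) = x / u * gammaWeight x u := by
  have h1 : x ^ (u + 1 - 1) = x * x ^ (u - 1) := by
    rw [add_sub_right_comm, Real.rpow_add_one hx.ne', mul_comm]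
  have := (Real.Gamma_pos_of_pos hu).ne'
  rw [gammaWeight, gammaWeight, h1, Real.Gamma_add_one hu.ne']
  field_simp

lemma concaveOn_log_gammaWeight {x : ℝ} (hx : 0 < x) :
    ConcaveOn ℝ (Set.Ioi 0) fun u => Real.log (gammaWeight x u) := by
  have h : ConcaveOn ℝ (Set.Ioi (0 : ℝ)) fun u : ℝ => (u * Real.log x + (-Real.log x - x)) -
      (Real.log ∘ Real.Gamma) u := by
    refine ConcaveOn.sub ⟨convex_Ioi 0, fun u _ v _ s t _ _ hst => ?_⟩ Real.convexOn_log_Gamma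
    simp only [smul_eq_mul]
    have : t = 1 - s := by linarith
    subst this
    apply le_of_eq; ring
  refine h.congr fun u hu => ?_
  have := Real.Gamma_pos_of_pos (Set.mem_Ioi.1 hu)
  have := Real.rpow_pos_of_pos hx (u - 1)
  simp only [gammaWeight, Function.comp]
  rw [Real.log_div (by positivity) (by positivity), Real.log_mul (by positivity) (by positivity),
    Real.log_exp, Real.log_rpow hx]
  ring

lemma gammaWeight_le_of_le_right {x u v w : ℝ} (hx : 0 < x) (hu : 0 < u) (huv : u < v)
    (hvw : v < w) (h : gammaWeight x v ≤ gammaWeight x w) :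
    gammaWeight x u ≤ gammaWeight x v := by
  have hv := hu.trans huv
  have s := (concaveOn_log_gammaWeight hx).slope_anti_adjacent hu (hv.trans hvw) huv hvw
  have h1 : 0 ≤ (Real.log (gammaWeight x w) - Real.log (gammaWeight x v)) / (w - v) :=
    div_nonneg (sub_nonneg.2 (Real.log_le_log (gammaWeight_pos hx hv) h)) (by linarith)
  have h2 := h1.trans s
  rw [le_div_iff₀ (by linarith), zero_mul, sub_nonneg] at h2
  exact (Real.log_le_log_iff (gammaWeight_pos hx hu) (gammaWeight_pos hx hv)).1 h2

lemma gammaWeight_le_of_le_left {x u v w : ℝ} (hx : 0 < x) (hu : 0 < u) (huv : u < v)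
    (hvw : v < w) (h : gammaWeight x v ≤ gammaWeight x u) :
    gammaWeight x w ≤ gammaWeight x v := by
  have hv := hu.trans huv
  have hw := hv.trans hvw
  have s := (concaveOn_log_gammaWeight hx).slope_anti_adjacent hu hw huv hvw
  have h1 : (Real.log (gammaWeight x v) - Real.log (gammaWeight x u)) / (v - u) ≤ 0 :=
    div_nonpos_of_nonpos_of_nonneg
      (sub_nonpos.2 (Real.log_le_log (gammaWeight_pos hx hv) h)) (by linarith)
  have h2 := s.trans h1
  rw [div_le_iff₀ (by linarith), zero_mul, sub_nonpos] at h2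
  exact (Real.log_le_log_iff (gammaWeight_pos hx hw) (gammaWeight_pos hx hv)).1 h2

/-- For fixed `x`, the Gamma density is unimodal as a function of the shape parameter. -/
lemma exists_mode_gammaWeight {x : ℝ} (hx : 0 < x) :
    ∃ m ∈ Set.Icc x (x + 1), MonotoneOn (gammaWeight x) (Set.Icc 0 m) ∧
      AntitoneOn (gammaWeight x) (Set.Ici m) := by
  have hcont : ContinuousOn (gammaWeight x) (Set.Icc x (x + 1)) := by
    have hG : ContinuousOn Real.Gamma (Set.Icc x (x + 1)) := fun u hu =>
      (Real.differentiableAt_Gamma fun k => by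
        have := hu.1
        have : (0 : ℝ) ≤ k := k.cast_nonneg
        intro h; linarith).continuousAt.continuousWithinAt
    refine ContinuousOn.div (ContinuousOn.mul ?_ continuousOn_const) hG fun u hu =>
      (Real.Gamma_pos_of_pos (hx.trans_le hu.1)).ne'
    exact ContinuousOn.rpow continuousOn_const (by fun_prop) fun _ _ => Or.inl hx.ne'
  obtain ⟨m, hm, hmax⟩ := isCompact_Icc.exists_isMaxOn (Set.nonempty_Icc.2 (by linarith)) hcont
  have hm0 : 0 < m := hx.trans_le hm.1
  have hmax' : ∀ u, 0 < u → gammaWeight x u ≤ gammaWeight x m := by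
    intro u hu
    rcases lt_or_ge u x with h | h
    · refine (gammaWeight_le_of_le_right hx hu h (lt_add_one x) ?_).trans
        (hmax ⟨le_rfl, by linarith⟩)
      rw [gammaWeight_add_one hx hx, div_self hx.ne', one_mul]
    · rcases le_or_gt u (x + 1) with h' | h'
      · exact hmax ⟨h, h'⟩
      · refine (gammaWeight_le_of_le_left hx hx (lt_add_one x) h' ?_).trans
          (hmax ⟨by linarith, le_rfl⟩)
        rw [gammaWeight_add_one hx hx, div_self hx.ne', one_mul]
  refine ⟨m, hm, fun u hu v hv huv => ?_, fun u hu v hv huv => ?_⟩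
  · rcases hu.1.eq_or_lt with rfl | hu0
    · rw [gammaWeight_zero]; exact gammaWeight_nonneg hx hv.1
    rcases huv.eq_or_lt with rfl | huv
    · exact le_rfl
    rcases hv.2.eq_or_lt with rfl | hvm
    · exact hmax' u hu0
    · exact gammaWeight_le_of_le_right hx hu0 huv hvm (hmax' v (hu0.trans huv))
  · rcases huv.eq_or_lt with rfl | huv
    · exact le_rfl
    rcases (Set.mem_Ici.1 hu).eq_or_lt with rfl | hum
    · exact hmax' v (hm0.trans huv)
    · exact gammaWeight_le_of_le_left hx hm0 hum huv (hmax' u (hm0.trans hum))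

lemma hasSum_gammaWeight_nat (x : ℝ) : HasSum (fun n : ℕ => gammaWeight x n) 1 := by
  rw [← hasSum_nat_add_iff' 1]
  simp only [Finset.range_one, Finset.sum_singleton, Nat.cast_zero, gammaWeight_zero, sub_zero]
  have h := (NormedSpace.expSeries_div_hasSum_exp x).mul_right (Real.exp (-x))
  rw [← Real.exp_eq_exp_ℝ, ← Real.exp_add, add_neg_cancel, Real.exp_zero] at h
  refine h.congr_fun fun n => ?_
  simp only [gammaWeight]
  rw [Nat.cast_add_one, Real.Gamma_nat_eq_factorial, add_sub_cancel_right, Real.rpow_natCast]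
  ring

lemma gammaWeight_add_nat_ge {x m : ℝ} (hx : 0 < x) (hm : m ∈ Set.Icc x (x + 1)) (N k : ℕ)
    (hk : k ≤ N) : (x / (x + 1 + N)) ^ k * gammaWeight x m ≤ gammaWeight x (m + k) := by
  have hm0 : 0 < m := hx.trans_le hm.1
  induction k with
  | zero => simp
  | succ k ih =>
    have hk' : (k : ℝ) ≤ N := by exact_mod_cast (by omega : k ≤ N)
    have hmk : 0 < m + k := by positivity
    rw [Nat.cast_add_one, ← add_assoc, gammaWeight_add_one hx hmk, pow_succ']
    rw [mul_assoc]
    refine mul_le_mul ?_ (ih (by omega)) ?_ (by positivity)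
    · have := hm.2
      gcongr
    · have := gammaWeight_pos hx hm0
      positivity

lemma gammaWeight_mode_bound {x m : ℝ} (hx : 0 < x) (hm : m ∈ Set.Icc x (x + 1))
    (hanti : AntitoneOn (gammaWeight x) (Set.Ici m)) (N : ℕ) :
    N * ((x / (x + 1 + N)) ^ N * gammaWeight x m) ≤ 1 := by
  have hm0 : 0 < m := hx.trans_le hm.1
  have hsum := hasSum_gammaWeight_nat x
  have hr : x / (x + 1 + N) ≤ 1 := by
    rw [div_le_one (by positivity)]
    have : (0 : ℝ) ≤ N := N.cast_nonneg
    linarith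
  calc N * ((x / (x + 1 + N)) ^ N * gammaWeight x m)
      = ∑ k ∈ Finset.range N, (x / (x + 1 + N)) ^ N * gammaWeight x m := by simp
    _ ≤ ∑ k ∈ Finset.range N, gammaWeight x (k + ⌈m⌉₊ : ℕ) := by
      refine Finset.sum_le_sum fun k hk => ?_
      have hk' := Finset.mem_range.1 hk
      calc _ ≤ (x / (x + 1 + N)) ^ (k + 1) * gammaWeight x m := by
            have := gammaWeight_pos hx hm0
            gcongr ?_ * _
            exact pow_le_pow_of_le_one (by positivity) hr hk'
        _ ≤ gammaWeight x (m + (k + 1 : ℕ)) := gammaWeight_add_nat_ge hx hm N _ hk'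
        _ ≤ _ := by
          have h1 := Nat.le_ceil m
          have h2 := Nat.ceil_lt_add_one hm0.le
          have h3 : (0 : ℝ) ≤ k := k.cast_nonneg
          refine hanti ?_ ?_ ?_
          · simp only [Set.mem_Ici]; push_cast; linarith
          · simp only [Set.mem_Ici]; push_cast; linarith
          · push_cast; linarith
    _ ≤ ∑' k : ℕ, gammaWeight x (k + ⌈m⌉₊ : ℕ) :=
      Summable.sum_le_tsum _ (fun k _ => gammaWeight_nonneg hx (Nat.cast_nonneg _))
        ((summable_nat_add_iff (f := fun n : ℕ => gammaWeight x n) ⌈m⌉₊).2 hsum.summable)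
    _ ≤ ∑' k : ℕ, gammaWeight x k := by
      rw [← hsum.summable.sum_add_tsum_nat_add ⌈m⌉₊]
      exact le_add_of_nonneg_left
        (Finset.sum_nonneg fun k _ => gammaWeight_nonneg hx (Nat.cast_nonneg _))
    _ = 1 := hsum.tsum_eq

/-- A choice of mode of the unimodal function `gammaWeight x`. -/
noncomputable def gammaMode (x : ℝ) : ℝ :=
  if hx : 0 < x then (exists_mode_gammaWeight hx).choose else 0

lemma gammaMode_spec {x : ℝ} (hx : 0 < x) : gammaMode x ∈ Set.Icc x (x + 1) ∧
    MonotoneOn (gammaWeight x) (Set.Icc 0 (gammaMode x)) ∧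
      AntitoneOn (gammaWeight x) (Set.Ici (gammaMode x)) := by
  rw [gammaMode, dif_pos hx]
  exact (exists_mode_gammaWeight hx).choose_spec

lemma tendsto_gammaWeight_gammaMode :
    Tendsto (fun x => gammaWeight x (gammaMode x)) atTop (nhds 0) := by
  have hpos : ∀ x : ℝ, 0 < x → 0 < gammaWeight x (gammaMode x) := fun x hx =>
    gammaWeight_pos hx (hx.trans_le (gammaMode_spec hx).1.1)
  refine Metric.tendsto_atTop'.2 fun ε hε => ?_
  obtain ⟨N, hN⟩ := exists_nat_gt (2 / ε)
  have hN0 : (0 : ℝ) < N := lt_trans (by positivity) hN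
  have hlim : Tendsto (fun x : ℝ => (x / (x + 1 + N)) ^ N) atTop (nhds (1 ^ N)) := by
    refine Tendsto.pow ?_ N
    have h : Tendsto (fun x : ℝ => 1 - (1 + N) / (x + (1 + N))) atTop (nhds (1 - 0)) :=
      tendsto_const_nhds.sub
        (tendsto_const_nhds.div_atTop (tendsto_atTop_add_const_right _ _ tendsto_id))
    rw [sub_zero] at h
    refine h.congr' ?_
    filter_upwards [eventually_gt_atTop 0] with x hx
    have : 0 < x + (1 + N) := by positivity
    have : 0 < x + 1 + N := by positivity
    field_simp
    ring
  rw [one_pow] at hlim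
  obtain ⟨X, hX⟩ := eventually_atTop.1 (hlim.eventually (lt_mem_nhds (by norm_num : (1 / 2 : ℝ) < 1)))
  refine ⟨max X 0, fun x hx => ?_⟩
  have hx0 : 0 < x := (le_max_right _ _).trans_lt hx
  have hx1 := hX x ((le_max_left _ _).trans hx.le)
  have hb := gammaWeight_mode_bound hx0 (gammaMode_spec hx0).1 (gammaMode_spec hx0).2.2 N
  have hp := hpos x hx0
  rw [Real.dist_eq, sub_zero, abs_of_pos hp]
  have h1 : N * (1 / 2 * gammaWeight x (gammaMode x)) ≤ 1 := le_trans (by gcongr) hb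
  rw [div_lt_iff₀ hε] at hN
  by_contra! hcon
  have : N * ε ≤ N * gammaWeight x (gammaMode x) := by gcongr
  linarith

lemma lattice_sum_gammaWeight_bounds {α x : ℝ} (hα : 0 < α) (hx : 0 < x) :
    ENNReal.ofReal α * (∑' n : ℕ, ENNReal.ofReal (gammaWeight x (n * α))) ≤
      1 + (1 + ENNReal.ofReal α) * ENNReal.ofReal (gammaWeight x (gammaMode x)) ∧
    1 ≤ ENNReal.ofReal α * (∑' n : ℕ, ENNReal.ofReal (gammaWeight x (n * α))) +
      (1 + ENNReal.ofReal α) * ENNReal.ofReal (gammaWeight x (gammaMode x)) := by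
  obtain ⟨hm, hmono, hanti⟩ := gammaMode_spec hx
  have hm0 : 0 ≤ gammaMode x := hx.le.trans hm.1
  set q : ℝ → ℝ≥0∞ := fun u => ENNReal.ofReal (gammaWeight x u) with hq
  have q0 : q 0 = 0 := by simp [hq, gammaWeight_zero]
  have qm : MonotoneOn q (Set.Icc 0 (gammaMode x)) := fun u hu v hv h =>
    ENNReal.ofReal_le_ofReal (hmono hu hv h)
  have qa : AntitoneOn q (Set.Ici (gammaMode x)) := fun u hu v hv h =>
    ENNReal.ofReal_le_ofReal (hanti hu hv h)
  have hone : ∑' n : ℕ, q (n * 1) = 1 := by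
    simp only [hq, mul_one]
    rw [← ENNReal.ofReal_tsum_of_nonneg (fun n => gammaWeight_nonneg hx n.cast_nonneg)
      (hasSum_gammaWeight_nat x).summable, (hasSum_gammaWeight_nat x).tsum_eq, ENNReal.ofReal_one]
  have a1 := lintegral_Ici_le_tsum_of_unimodal one_pos hm0 q0 qm qa
  have a2 := tsum_le_lintegral_Ici_of_unimodal one_pos hm0 qm qa
  have b1 := lintegral_Ici_le_tsum_of_unimodal hα hm0 q0 qm qa
  have b2 := tsum_le_lintegral_Ici_of_unimodal hα hm0 qm qa
  rw [hone, ENNReal.ofReal_one, one_mul, one_mul] at a1 a2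
  constructor
  · calc _ ≤ _ := b2
      _ ≤ _ := add_le_add_left a1 _
      _ = _ := by simp only [hq]; ring
  · calc _ ≤ _ := a2
      _ ≤ _ := add_le_add_left b1 _
      _ = _ := by simp only [hq]; ring

lemma tendsto_lattice_sum_gammaWeight {α : ℝ} (hα : 0 < α) :
    Tendsto (fun x => ENNReal.ofReal α * ∑' n : ℕ, ENNReal.ofReal (gammaWeight x (n * α)))
      atTop (nhds 1) := by
  have h : Tendsto (fun x => (1 + ENNReal.ofReal α) * ENNReal.ofReal (gammaWeight x (gammaMode x)))
      atTop (nhds 0) := by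
    have := ENNReal.Tendsto.const_mul (a := 1 + ENNReal.ofReal α)
      (ENNReal.tendsto_ofReal tendsto_gammaWeight_gammaMode) (Or.inr (by simp))
    simpa using this
  have h1 := (tendsto_const_nhds (x := (1 : ℝ≥0∞))).add h
  have h2 := ENNReal.Tendsto.sub (tendsto_const_nhds (x := (1 : ℝ≥0∞))) h (Or.inl (by simp))
  rw [add_zero] at h1
  rw [tsub_zero] at h2
  refine tendsto_of_tendsto_of_tendsto_of_le_of_le' h2 h1 ?_ ?_
  · filter_upwards [eventually_gt_atTop 0] with x hx
    exact tsub_le_iff_right.2 (lattice_sum_gammaWeight_bounds hα hx).2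
  · filter_upwards [eventually_gt_atTop 0] with x hx
    exact (lattice_sum_gammaWeight_bounds hα hx).1

lemma tsum_gammaWeight_ne_top {α x : ℝ} (hα : 0 < α) (hx : 0 < x) :
    ∑' n : ℕ, ENNReal.ofReal (gammaWeight x (n * α)) ≠ ∞ := by
  intro h
  have := (lattice_sum_gammaWeight_bounds hα hx).1
  rw [h, ENNReal.mul_top (by simpa using hα)] at this
  refine (lt_of_le_of_lt this ?_).ne rfl
  finiteness

/-- The density of the Gamma distribution with shape `u` and rate `c`, supported on `(0, ∞)`. -/
noncomputable def gammaKernel (c u : ℝ) : ℝ → ℝ≥0∞ :=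
  (Set.Ioi 0).indicator fun t => ENNReal.ofReal (c * gammaWeight (c * t) u)

lemma gammaKernel_of_pos (c u : ℝ) {t : ℝ} (ht : 0 < t) :
    gammaKernel c u t = ENNReal.ofReal (c * gammaWeight (c * t) u) :=
  Set.indicator_of_mem (Set.mem_Ioi.2 ht) _

lemma gammaKernel_of_nonpos (c u : ℝ) {t : ℝ} (ht : t ≤ 0) : gammaKernel c u t = 0 :=
  Set.indicator_of_notMem (Set.notMem_Ioi.2 ht) _

lemma gammaKernel_zero_shape (c : ℝ) : gammaKernel c 0 = 0 := by
  ext t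
  rcases le_or_gt t 0 with h | h
  · rw [gammaKernel_of_nonpos _ _ h, Pi.zero_apply]
  · simp [gammaKernel_of_pos _ _ h, gammaWeight_zero]

@[fun_prop]
lemma measurable_gammaKernel (c u : ℝ) : Measurable (gammaKernel c u) := by
  refine Measurable.indicator ?_ measurableSet_Ioi
  unfold gammaWeight
  fun_prop

lemma gammaKernel_pos {c u t : ℝ} (hc : 0 < c) (hu : 0 < u) (ht : 0 < t) :
    0 < gammaKernel c u t := by
  rw [gammaKernel_of_pos _ _ ht, ENNReal.ofReal_pos]
  exact mul_pos hc (gammaWeight_pos (by positivity) hu)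

lemma lintegral_gammaKernel {c u : ℝ} (hc : 0 < c) (hu : 0 < u) :
    ∫⁻ t, gammaKernel c u t = 1 := by
  rw [← ProbabilityTheory.lintegral_gammaPDF_eq_one hu hc]
  refine lintegral_congr_ae ?_
  filter_upwards [Measure.ae_ne volume (0 : ℝ)] with t ht
  rcases ht.lt_or_gt with h | h
  · rw [gammaKernel_of_nonpos _ _ h.le, ProbabilityTheory.gammaPDF_of_neg h]
  · rw [gammaKernel_of_pos _ _ h, ProbabilityTheory.gammaPDF_of_nonneg h.le, gammaWeight,
      Real.mul_rpow hc.le h.le, Real.rpow_sub_one hc.ne']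
    congr 1
    field_simp

lemma lintegral_eq_mul_lintegral_comp_mul_left {t : ℝ} (ht : 0 < t) {g : ℝ → ℝ≥0∞}
    (hg : Measurable g) : ∫⁻ y, g y = ENNReal.ofReal t * ∫⁻ z, g (t * z) := by
  conv_lhs => rw [← Real.smul_map_volume_mul_left ht.ne']
  rw [lintegral_smul_measure, lintegral_map hg (by fun_prop), abs_of_pos ht, smul_eq_mul]

/-- Gamma densities with a common rate form a convolution semigroup. -/
lemma gammaKernel_lconvolution {c u v : ℝ} (hc : 0 < c) (hu : 0 < u) (hv : 0 < v) :
    gammaKernel c u ⋆ₗ gammaKernel c v = gammaKernel c (u + v) := by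
  ext t
  rw [lconvolution_def]
  rcases le_or_gt t 0 with ht | ht
  · rw [gammaKernel_of_nonpos _ _ ht, lintegral_eq_zero_iff (by fun_prop)]
    refine Eventually.of_forall fun y => ?_
    rcases le_or_gt y 0 with hy | hy
    · simp [gammaKernel_of_nonpos _ _ hy]
    · simp [gammaKernel_of_nonpos c v (by linarith : -y + t ≤ 0)]
  have hb : Measurable (ProbabilityTheory.betaPDF u v) :=
    (ProbabilityTheory.measurable_betaPDFReal u v).ennreal_ofReal
  rw [lintegral_eq_mul_lintegral_comp_mul_left ht (by fun_prop),
    ← lintegral_const_mul _ (by fun_prop),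
    ← mul_one (gammaKernel c (u + v) t), ← ProbabilityTheory.lintegral_betaPDF_eq_one hu hv,
    ← lintegral_const_mul _ hb]
  refine lintegral_congr fun z => ?_
  rcases le_or_gt z 0 with hz | hz
  · rw [gammaKernel_of_nonpos c u (mul_nonpos_of_nonneg_of_nonpos ht.le hz),
      ProbabilityTheory.betaPDF_eq_zero_of_nonpos hz]
    simp
  rcases le_or_gt 1 z with hz1 | hz1
  · rw [gammaKernel_of_nonpos c v (by nlinarith : -(t * z) + t ≤ 0),
      ProbabilityTheory.betaPDF_eq_zero_of_one_le hz1]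
    simp
  have hw : 0 < 1 - z := by linarith
  have e : -(t * z) + t = t * (1 - z) := by ring
  rw [e, gammaKernel_of_pos _ _ ht, gammaKernel_of_pos _ _ (by positivity),
    gammaKernel_of_pos _ _ (by positivity), ProbabilityTheory.betaPDF_of_pos_lt_one hz hz1]
  have g1 := Real.Gamma_pos_of_pos hu
  have g2 := Real.Gamma_pos_of_pos hv
  have g3 := Real.Gamma_pos_of_pos (add_pos hu hv)
  have p1 := gammaWeight_pos (x := c * (t * z)) (by positivity) hu
  have p2 := gammaWeight_pos (x := c * t) (by positivity) (add_pos hu hv)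
  rw [← ENNReal.ofReal_mul (by positivity), ← ENNReal.ofReal_mul (by positivity),
    ← ENNReal.ofReal_mul (by positivity)]
  congr 1
  have hct : 0 < c * t := by positivity
  simp only [gammaWeight, ProbabilityTheory.beta]
  rw [← mul_assoc c t z, ← mul_assoc c t (1 - z), Real.mul_rpow hct.le hz.le,
    Real.mul_rpow hct.le hw.le]
  have ex : Real.exp (-(c * t)) = Real.exp (-(c * t * z)) * Real.exp (-(c * t * (1 - z))) := by
    rw [← Real.exp_add]; congr 1; ring
  have er : (c * t) ^ (u + v - 1) = (c * t) * ((c * t) ^ (u - 1) * (c * t) ^ (v - 1)) := by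
    rw [← Real.rpow_add hct, mul_comm (c * t), ← Real.rpow_add_one hct.ne']; congr 1; ring
  rw [ex, er]
  field_simp

lemma gammaKernel_le_exp_mul {c u s t : ℝ} (hc : 0 < c) (hu : 1 ≤ u) (hs : 0 < s) (hst : s ≤ t) :
    gammaKernel c u s ≤ ENNReal.ofReal (Real.exp (c * t)) * gammaKernel c u t := by
  have ht := hs.trans_le hst
  rw [gammaKernel_of_pos _ _ hs, gammaKernel_of_pos _ _ ht,
    ← ENNReal.ofReal_mul (Real.exp_pos _).le]
  refine ENNReal.ofReal_le_ofReal ?_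
  have g := Real.Gamma_pos_of_pos (by linarith : 0 < u)
  have e : Real.exp (c * t) * (c * gammaWeight (c * t) u) =
      c * ((c * t) ^ (u - 1) * 1 / Real.Gamma u) := by
    rw [gammaWeight, Real.exp_neg]
    field_simp
  rw [e, gammaWeight]
  have h1 : Real.exp (-(c * s)) ≤ 1 :=
    Real.exp_le_one_iff.2 (by have := mul_pos hc hs; linarith)
  have h2 : (c * s) ^ (u - 1) ≤ (c * t) ^ (u - 1) :=
    Real.rpow_le_rpow (by positivity) (by gcongr) (by linarith)
  gcongr

lemma gammaKernel_antitoneOn {c u : ℝ} (hc : 0 < c) (hu : 0 < u) (hu1 : u ≤ 1) :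
    AntitoneOn (gammaKernel c u) (Set.Ioi 0) := by
  intro s hs t ht hst
  rw [Set.mem_Ioi] at hs ht
  rw [gammaKernel_of_pos _ _ hs, gammaKernel_of_pos _ _ ht]
  refine ENNReal.ofReal_le_ofReal ?_
  have g := Real.Gamma_pos_of_pos hu
  unfold gammaWeight
  have : (c * t) ^ (u - 1) ≤ (c * s) ^ (u - 1) :=
    Real.rpow_le_rpow_of_nonpos (by positivity) (by gcongr) (by linarith)
  gcongr

/-- The renewal density associated with the Gamma distribution of shape `α` and rate `c`. -/
noncomputable def gammaRenewal (c α : ℝ) (t : ℝ) : ℝ≥0∞ := ∑' n : ℕ, gammaKernel c (n * α) t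

@[fun_prop]
lemma measurable_gammaRenewal (c α : ℝ) : Measurable (gammaRenewal c α) :=
  Measurable.tsum fun _ => measurable_gammaKernel c _

lemma gammaRenewal_of_nonpos (c α : ℝ) {t : ℝ} (ht : t ≤ 0) : gammaRenewal c α t = 0 := by
  simp [gammaRenewal, gammaKernel_of_nonpos _ _ ht]

lemma gammaRenewal_of_pos {c : ℝ} (hc : 0 < c) (α : ℝ) {t : ℝ} (ht : 0 < t) :
    gammaRenewal c α t =
      ENNReal.ofReal c * ∑' n : ℕ, ENNReal.ofReal (gammaWeight (c * t) (n * α)) := by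
  simp only [gammaRenewal, gammaKernel_of_pos _ _ ht, ENNReal.ofReal_mul hc.le,
    ENNReal.tsum_mul_left]

lemma gammaRenewal_ne_top {c α : ℝ} (hc : 0 < c) (hα : 0 < α) (t : ℝ) :
    gammaRenewal c α t ≠ ∞ := by
  rcases le_or_gt t 0 with ht | ht
  · rw [gammaRenewal_of_nonpos _ _ ht]; simp
  · rw [gammaRenewal_of_pos hc _ ht]
    exact ENNReal.mul_ne_top ENNReal.ofReal_ne_top
      (tsum_gammaWeight_ne_top hα (mul_pos hc ht))

lemma tendsto_gammaRenewal {c α : ℝ} (hc : 0 < c) (hα : 0 < α) :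
    Tendsto (gammaRenewal c α) atTop (nhds (ENNReal.ofReal (c / α))) := by
  have h := (tendsto_lattice_sum_gammaWeight hα).comp (tendsto_id.const_mul_atTop hc)
  have h2 := ENNReal.Tendsto.const_mul (a := ENNReal.ofReal (c / α)) h
    (Or.inr ENNReal.ofReal_ne_top)
  rw [mul_one] at h2
  refine h2.congr' ?_
  filter_upwards [eventually_gt_atTop 0] with t ht
  rw [gammaRenewal_of_pos hc _ ht]
  simp only [Function.comp, id]
  rw [← mul_assoc, ← ENNReal.ofReal_mul (by positivity), div_mul_cancel₀ _ hα.ne']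

lemma lconvolution_tsum {f : ℝ → ℝ≥0∞} {g : ℕ → ℝ → ℝ≥0∞} (hf : Measurable f)
    (hg : ∀ n, Measurable (g n)) (t : ℝ) :
    (f ⋆ₗ fun s => ∑' n, g n s) t = ∑' n, (f ⋆ₗ g n) t := by
  simp only [lconvolution_def, ← ENNReal.tsum_mul_left]
  exact lintegral_tsum fun n => by fun_prop

lemma lconvolution_add {f g h : ℝ → ℝ≥0∞} (hf : Measurable f) (hg : Measurable g) :
    f ⋆ₗ (g + h) = f ⋆ₗ g + f ⋆ₗ h := by
  ext t
  simp only [lconvolution_def, Pi.add_apply, mul_add]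
  exact lintegral_add_left (by fun_prop) _

lemma add_lconvolution {f g h : ℝ → ℝ≥0∞} (hf : Measurable f) (hh : Measurable h) :
    (f + g) ⋆ₗ h = f ⋆ₗ h + g ⋆ₗ h := by
  ext t
  simp only [lconvolution_def, Pi.add_apply, add_mul]
  exact lintegral_add_left (by fun_prop) _

lemma lconvolution_congr_ae {f g : ℝ → ℝ≥0∞} (h : f =ᵐ[volume] g) (k : ℝ → ℝ≥0∞) :
    f ⋆ₗ k = g ⋆ₗ k := by
  ext t
  simp only [lconvolution_def]
  refine lintegral_congr_ae ?_
  filter_upwards [h] with s hs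
  rw [hs]

/-- The renewal density solves the renewal equation. -/
lemma gammaRenewal_eq {c α : ℝ} (hc : 0 < c) (hα : 0 < α) :
    gammaRenewal c α = gammaKernel c α + gammaRenewal c α ⋆ₗ gammaKernel c α := by
  ext t
  have h : (gammaKernel c α ⋆ₗ gammaRenewal c α) t =
      ∑' n : ℕ, gammaKernel c ((n + 2 : ℕ) * α) t := by
    change (gammaKernel c α ⋆ₗ fun s => ∑' n : ℕ, gammaKernel c (n * α) s) t = _
    rw [lconvolution_tsum (by fun_prop) (fun n => by fun_prop),
      tsum_eq_zero_add' ENNReal.summable]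
    simp only [Nat.cast_zero, zero_mul, gammaKernel_zero_shape, lconvolution_zero, Pi.zero_apply,
      zero_add]
    refine tsum_congr fun n => ?_
    rw [gammaKernel_lconvolution hc hα (by positivity)]
    congr 1
    push_cast
    ring
  rw [Pi.add_apply, lconvolution_comm, h, gammaRenewal, tsum_eq_zero_add' ENNReal.summable,
    tsum_eq_zero_add' ENNReal.summable]
  simp [gammaKernel_zero_shape, add_assoc, one_add_one_eq_two]

lemma lintegral_gammaRenewal_Ioo_ne_top {c α : ℝ} (hc : 0 < c) (hα : 0 < α) (T : ℝ) :
    ∫⁻ t in Set.Ioo 0 T, gammaRenewal c α t ≠ ∞ := by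
  obtain ⟨N, hN⟩ := exists_nat_gt (1 / α)
  rw [div_lt_iff₀ hα] at hN
  have hsplit : ∀ t ∈ Set.Ioo 0 T, gammaRenewal c α t ≤
      ∑ n ∈ Finset.range N, gammaKernel c (n * α) t +
        ENNReal.ofReal (Real.exp (c * T)) * gammaRenewal c α T := by
    intro t ht
    have e : ∑ n ∈ Finset.range N, gammaKernel c (n * α) t +
        ∑' n : ℕ, gammaKernel c ((n + N : ℕ) * α) t = gammaRenewal c α t :=
      Summable.sum_add_tsum_nat_add' ENNReal.summable
    rw [← e]
    gcongr
    calc _ ≤ ∑' n : ℕ, ENNReal.ofReal (Real.exp (c * T)) * gammaKernel c ((n + N : ℕ) * α) T := by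
          refine ENNReal.tsum_le_tsum fun n => gammaKernel_le_exp_mul hc ?_ ht.1 ht.2.le
          push_cast
          have : 0 ≤ (n : ℝ) * α := by positivity
          linarith
      _ = ENNReal.ofReal (Real.exp (c * T)) * ∑' n : ℕ, gammaKernel c ((n + N : ℕ) * α) T :=
          ENNReal.tsum_mul_left
      _ ≤ _ := by
          gcongr
          exact ENNReal.tsum_comp_le_tsum_of_injective (add_left_injective N)
            (fun n : ℕ => gammaKernel c (n * α) T)
  refine ne_top_of_le_ne_top ?_ (setLIntegral_mono' measurableSet_Ioo hsplit)
  rw [lintegral_add_right _ measurable_const, setLIntegral_const,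
    lintegral_finsetSum _ (fun n _ => by fun_prop)]
  refine ENNReal.add_ne_top.2 ⟨?_, ?_⟩
  · refine ENNReal.sum_ne_top.2 fun n _ => ?_
    refine ne_top_of_le_ne_top ENNReal.one_ne_top ((setLIntegral_le_lintegral _ _).trans ?_)
    rcases n.eq_zero_or_pos with rfl | hn
    · simp [gammaKernel_zero_shape]
    · rw [lintegral_gammaKernel hc (by positivity)]
  · refine ENNReal.mul_ne_top (ENNReal.mul_ne_top ENNReal.ofReal_ne_top
      (gammaRenewal_ne_top hc hα T)) ?_
    simp

lemma lconvolution_of_nonpos {F H : ℝ → ℝ≥0∞} (hF0 : ∀ t ≤ 0, F t = 0) (hH0 : ∀ t ≤ 0, H t = 0)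
    {t : ℝ} (ht : t ≤ 0) : (F ⋆ₗ H) t = 0 := by
  rw [lconvolution_def, ← lintegral_zero (μ := (volume : Measure ℝ))]
  refine lintegral_congr fun s => ?_
  rcases le_or_gt s 0 with hs | hs
  · rw [hF0 s hs, zero_mul]
  · rw [hH0 _ (by linarith), mul_zero]

lemma lintegral_Iio_lconvolution_le {F H : ℝ → ℝ≥0∞} (hF : Measurable F) (hH : Measurable H)
    (hF0 : ∀ t ≤ 0, F t = 0) (hH0 : ∀ t ≤ 0, H t = 0) {T R : ℝ} (hTR : T ≤ R) :
    ∫⁻ t in Set.Iio T, (F ⋆ₗ H) t ≤ (∫⁻ t in Set.Iio R, H t) * ∫⁻ t in Set.Iio T, F t := by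
  simp only [lconvolution_def]
  rw [lintegral_lintegral_swap (by fun_prop), ← lintegral_const_mul _ hF,
    ← lintegral_indicator measurableSet_Iio]
  refine lintegral_mono fun s => ?_
  rw [lintegral_const_mul _ (by fun_prop)]
  by_cases hs : s < T
  · rw [Set.indicator_of_mem (Set.mem_Iio.2 hs), mul_comm]
    rcases le_or_gt s 0 with hs0 | hs0
    · simp [hF0 s hs0]
    refine mul_le_mul_left ?_ _
    calc ∫⁻ t in Set.Iio T, H (-s + t)
        = ∫⁻ t, (Set.Iio (T - s)).indicator H (-s + t) := by
          rw [← lintegral_indicator measurableSet_Iio]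
          refine lintegral_congr fun t => ?_
          have : t ∈ Set.Iio T ↔ -s + t ∈ Set.Iio (T - s) := by
            simp only [Set.mem_Iio]; constructor <;> intro h <;> linarith
          by_cases h : t ∈ Set.Iio T
          · rw [Set.indicator_of_mem h, Set.indicator_of_mem (this.1 h)]
          · rw [Set.indicator_of_notMem h, Set.indicator_of_notMem (mt this.2 h)]
      _ = ∫⁻ t in Set.Iio (T - s), H t := by
          rw [lintegral_add_left_eq_self, lintegral_indicator measurableSet_Iio]
      _ ≤ _ := lintegral_mono_set (Set.Iio_subset_Iio (by linarith))
  · rw [Set.indicator_of_notMem (by simpa using hs)]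
    refine le_of_eq (mul_eq_zero_of_right _ ?_)
    rw [setLIntegral_congr_fun (g := fun _ => 0) measurableSet_Iio, lintegral_zero]
    intro t (ht : t < T)
    exact hH0 _ (by linarith)

lemma lintegral_Iio_lt_one {H : ℝ → ℝ≥0∞} (hH1 : ∫⁻ t, H t = 1)
    (hHpos : ∀ t > 0, 0 < H t) (hHanti : AntitoneOn H (Set.Ioi 0)) {R : ℝ} (hR : 0 < R) :
    ∫⁻ t in Set.Iio R, H t < 1 := by
  have h1 : (∫⁻ t in Set.Iio R, H t) + ∫⁻ t in Set.Icc R (R + 1), H t ≤ 1 := by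
    rw [← lintegral_union measurableSet_Icc, ← hH1]
    · exact setLIntegral_le_lintegral _ _
    · exact Set.disjoint_left.2 fun t (h : t < R) h' => absurd h'.1 (not_le.2 h)
  have h2 : H (R + 1) ≤ ∫⁻ t in Set.Icc R (R + 1), H t := by
    calc H (R + 1) = ∫⁻ _ in Set.Icc R (R + 1), H (R + 1) := by simp
      _ ≤ _ := setLIntegral_mono' measurableSet_Icc fun t ht =>
        hHanti (hR.trans_le ht.1) (Set.mem_Ioi.2 (by linarith)) ht.2
  have h3 : ∫⁻ t in Set.Iio R, H t ≠ ∞ :=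
    ne_top_of_le_ne_top ENNReal.one_ne_top (le_self_add.trans h1)
  calc _ < (∫⁻ t in Set.Iio R, H t) + H (R + 1) :=
        ENNReal.lt_add_right h3 (hHpos _ (by linarith)).ne'
    _ ≤ _ := add_le_add_right h2 _
    _ ≤ 1 := h1

/-- Solutions of a renewal inequality are locally integrable, provided that they are controlled by
the forcing term at the points where the convolution diverges. -/
lemma lintegral_Iio_ne_top_of_renewal {F A H : ℝ → ℝ≥0∞} (hF : Measurable F) (hA : Measurable A)
    (hH : Measurable H) (hF0 : ∀ t ≤ 0, F t = 0) (hH0 : ∀ t ≤ 0, H t = 0)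
    (hAint : ∫⁻ t, A t ≠ ∞) (hH1 : ∫⁻ t, H t = 1)
    (hHpos : ∀ t > 0, 0 < H t) (hHanti : AntitoneOn H (Set.Ioi 0))
    (hle : ∀ t, F t ≤ A t + (F ⋆ₗ H) t) (htop : ∀ t > 0, (F ⋆ₗ H) t = ∞ → F t ≤ A t) (R : ℝ) :
    ∫⁻ t in Set.Iio R, F t ≠ ∞ := by
  have hnonpos : ∀ T ≤ 0, ∫⁻ t in Set.Iio T, F t = 0 := fun T hT => by
    rw [setLIntegral_congr_fun (g := fun _ => 0) measurableSet_Iio, lintegral_zero]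
    intro t (ht : t < T)
    exact hF0 t (ht.le.trans hT)
  intro hRtop
  have hR : 0 < R := by
    by_contra! h
    rw [hnonpos R h] at hRtop
    exact ENNReal.zero_ne_top hRtop
  set q := ∫⁻ t in Set.Iio R, H t with hq
  have hq1 : q < 1 := lintegral_Iio_lt_one hH1 hHpos hHanti hR
  have hbound : ∀ T ≤ R, ∫⁻ t in Set.Iio T, F t ≠ ∞ →
      ∫⁻ t in Set.Iio T, F t ≤ (∫⁻ t, A t) / (1 - q) := by
    intro T hT hfin
    have h1 : ∫⁻ t in Set.Iio T, F t ≤ (∫⁻ t, A t) + q * ∫⁻ t in Set.Iio T, F t := by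
      calc _ ≤ ∫⁻ t in Set.Iio T, (A t + (F ⋆ₗ H) t) := lintegral_mono hle
        _ = (∫⁻ t in Set.Iio T, A t) + ∫⁻ t in Set.Iio T, (F ⋆ₗ H) t := lintegral_add_left hA _
        _ ≤ _ := add_le_add (setLIntegral_le_lintegral _ _)
          (lintegral_Iio_lconvolution_le hF hH hF0 hH0 hT)
    rw [ENNReal.le_div_iff_mul_le (Or.inl (tsub_pos_of_lt hq1).ne')
      (Or.inl (ne_top_of_le_ne_top ENNReal.one_ne_top tsub_le_self)), mul_comm,
      ENNReal.sub_mul fun _ _ => hfin, one_mul]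
    exact tsub_le_iff_right.2 h1
  set S := {T : ℝ | ∫⁻ t in Set.Iio T, F t = ∞} with hS
  have hSne : S.Nonempty := ⟨R, hRtop⟩
  have hSbdd : BddBelow S := ⟨0, fun T hT => by
    by_contra! h
    exact ENNReal.zero_ne_top ((hnonpos T h.le).symm.trans hT)⟩
  set τ := sInf S with hτ
  have hτR : τ ≤ R := csInf_le hSbdd hRtop
  have hτ0 : 0 ≤ τ := le_csInf hSne fun T hT => by
    by_contra! h
    exact ENNReal.zero_ne_top ((hnonpos T h.le).symm.trans hT)
  have hbelow : ∫⁻ t in Set.Iio τ, F t ≤ (∫⁻ t, A t) / (1 - q) := by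
    have hmono : Monotone fun n : ℕ => Set.Iio (τ - 1 / ((n : ℝ) + 1)) := fun m n h =>
      Set.Iio_subset_Iio (sub_le_sub_left (Nat.one_div_le_one_div h) _)
    have hU : Set.Iio τ = ⋃ n : ℕ, Set.Iio (τ - 1 / ((n : ℝ) + 1)) := by
      ext t
      simp only [Set.mem_Iio, Set.mem_iUnion]
      constructor
      · intro ht
        obtain ⟨n, hn⟩ := exists_nat_one_div_lt (sub_pos.2 ht)
        exact ⟨n, by linarith⟩
      · rintro ⟨n, hn⟩
        have : 0 < 1 / ((n : ℝ) + 1) := by positivity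
        linarith
    rw [hU, setLIntegral_iUnion_of_directed _ hmono.directed_le]
    refine iSup_le fun n => ?_
    have : 0 < 1 / ((n : ℝ) + 1) := by positivity
    refine hbound _ (by linarith) fun h => ?_
    have := csInf_le hSbdd h
    linarith
  have habove : ∀ t ∈ Set.Ioo τ R, F t ≤ A t := by
    intro t ht
    obtain ⟨T, hT, hTt⟩ := exists_lt_of_csInf_lt hSne ht.1
    have ht0 : 0 < t := hτ0.trans_lt ht.1
    refine htop t ht0 (top_unique ?_)
    calc ∞ = H t * ∫⁻ s in Set.Iio T, F s := by
          rw [show ∫⁻ s in Set.Iio T, F s = ∞ from hT, ENNReal.mul_top (hHpos t ht0).ne']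
      _ = ∫⁻ s in Set.Iio T, H t * F s := (lintegral_const_mul _ hF).symm
      _ ≤ ∫⁻ s in Set.Iio T, F s * H (-s + t) := by
          refine setLIntegral_mono' measurableSet_Iio fun s (hs : s < T) => ?_
          rw [mul_comm]
          rcases le_or_gt s 0 with h0 | h0
          · simp [hF0 s h0]
          gcongr
          exact hHanti (Set.mem_Ioi.2 (by linarith)) ht0 (by linarith)
      _ ≤ _ := setLIntegral_le_lintegral _ _
  have hsub : Set.Iio R ⊆ Set.Iio τ ∪ ({τ} ∪ Set.Ioo τ R) := by
    intro t (ht : t < R)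
    rcases lt_trichotomy t τ with h | h | h
    · exact Or.inl h
    · exact Or.inr (Or.inl h)
    · exact Or.inr (Or.inr ⟨h, ht⟩)
  have hfin : ∫⁻ t in Set.Iio R, F t ≤ (∫⁻ t, A t) / (1 - q) + (0 + ∫⁻ t, A t) := by
    refine (lintegral_mono_set hsub).trans ((lintegral_union_le _ _ _).trans ?_)
    refine add_le_add hbelow ((lintegral_union_le _ _ _).trans (add_le_add (by simp) ?_))
    exact (setLIntegral_mono' measurableSet_Ioo habove).trans (setLIntegral_le_lintegral _ _)
  rw [hRtop] at hfin
  refine absurd (top_unique hfin) ?_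
  have := ENNReal.div_ne_top hAint (tsub_pos_of_lt hq1).ne'
  finiteness

/-- A locally integrable solution of the renewal equation is given by convolution with the
renewal density. -/
lemma ae_eq_add_lconvolution_gammaRenewal {c α : ℝ} (hc : 0 < c) (hα : 0 < α)
    {F A : ℝ → ℝ≥0∞} (hF : Measurable F) (hA : Measurable A) (hF0 : ∀ t ≤ 0, F t = 0)
    (hFint : ∀ T, ∫⁻ t in Set.Iio T, F t ≠ ∞)
    (heq : F =ᵐ[volume] A + F ⋆ₗ gammaKernel c α) :
    F =ᵐ[volume] A + A ⋆ₗ gammaRenewal c α := by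
  have iter : ∀ n : ℕ, F =ᵐ[volume] fun t => A t +
      ∑ k ∈ Finset.range (n + 1), (A ⋆ₗ gammaKernel c (k * α)) t +
        (F ⋆ₗ gammaKernel c ((n + 1 : ℕ) * α)) t := by
    intro n
    induction n with
    | zero =>
      filter_upwards [heq] with t ht
      rw [ht]
      simp [gammaKernel_zero_shape]
    | succ n ih =>
      filter_upwards [ih] with t ht
      have e : (F ⋆ₗ gammaKernel c ((n + 1 : ℕ) * α)) t =
          (A ⋆ₗ gammaKernel c ((n + 1 : ℕ) * α)) t +
            (F ⋆ₗ gammaKernel c ((n + 1 + 1 : ℕ) * α)) t := by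
        rw [lconvolution_congr_ae heq, add_lconvolution hA (by fun_prop),
          ← lconvolution_assoc hF (by fun_prop) (by fun_prop),
          gammaKernel_lconvolution hc hα (by positivity), Pi.add_apply]
        congr 4
        push_cast
        ring
      rw [ht, e, Finset.sum_range_succ _ (n + 1)]
      ring
  have rem : ∀ t, Tendsto (fun n : ℕ => (F ⋆ₗ gammaKernel c ((n + 1 : ℕ) * α)) t) atTop
      (nhds 0) := by
    intro t
    have hz : Tendsto (fun n : ℕ => gammaKernel c ((n + 1 : ℕ) * α) t) atTop (nhds 0) :=
      (ENNReal.tendsto_atTop_zero_of_tsum_ne_top (gammaRenewal_ne_top hc hα t)).comp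
        (tendsto_add_atTop_nat 1)
    have hz2 : Tendsto (fun n : ℕ => (∫⁻ s in Set.Iio t, F s) *
        (ENNReal.ofReal (Real.exp (c * t)) * gammaKernel c ((n + 1 : ℕ) * α) t)) atTop
        (nhds 0) := by
      have := ENNReal.Tendsto.const_mul (a := ∫⁻ s in Set.Iio t, F s)
        (ENNReal.Tendsto.const_mul (a := ENNReal.ofReal (Real.exp (c * t))) hz
          (Or.inr ENNReal.ofReal_ne_top)) (Or.inr (hFint t))
      simpa using this
    obtain ⟨N, hN⟩ := exists_nat_gt (1 / α)
    rw [div_lt_iff₀ hα] at hN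
    refine tendsto_of_tendsto_of_tendsto_of_le_of_le' tendsto_const_nhds hz2
      (Eventually.of_forall fun _ => zero_le) ?_
    filter_upwards [eventually_ge_atTop N] with n hn
    have hn' : (N : ℝ) ≤ (n + 1 : ℕ) := by exact_mod_cast hn.trans (Nat.le_succ n)
    have h1 : 1 ≤ ((n + 1 : ℕ) : ℝ) * α :=
      hN.le.trans (mul_le_mul_of_nonneg_right hn' hα.le)
    rw [lconvolution_def, ← lintegral_mul_const _ hF, ← lintegral_indicator measurableSet_Iio]
    refine lintegral_mono fun s => ?_
    by_cases hs : s < t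
    · rw [Set.indicator_of_mem (Set.mem_Iio.2 hs)]
      rcases le_or_gt s 0 with h0 | h0
      · simp [hF0 s h0]
      · exact mul_le_mul_right (gammaKernel_le_exp_mul hc h1 (by linarith) (by linarith)) _
    · rw [Set.indicator_of_notMem (by simpa using hs),
        gammaKernel_of_nonpos _ _ (by linarith), mul_zero]
  filter_upwards [ae_all_iff.2 iter] with t ht
  have hsum : Tendsto (fun n : ℕ => ∑ k ∈ Finset.range (n + 1), (A ⋆ₗ gammaKernel c (k * α)) t)
      atTop (nhds ((A ⋆ₗ gammaRenewal c α) t)) := by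
    have e : (A ⋆ₗ gammaRenewal c α) t = ∑' k : ℕ, (A ⋆ₗ gammaKernel c (k * α)) t :=
      lconvolution_tsum (g := fun n : ℕ => gammaKernel c (n * α)) hA (fun n => by fun_prop) t
    rw [e]
    exact (ENNReal.tendsto_nat_tsum _).comp (tendsto_add_atTop_nat 1)
  have hlim := (((tendsto_const_nhds (x := A t)).add hsum).add (rem t)).congr fun n => (ht n).symm
  rw [add_zero] at hlim
  exact tendsto_nhds_unique tendsto_const_nhds hlim

lemma lconvolution_gammaRenewal_ne_top {c α : ℝ} (hc : 0 < c) (hα : 0 < α)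
    {A : ℝ → ℝ≥0∞} (hA0 : ∀ t ≤ 0, A t = 0) {C : ℝ≥0∞}
    (hC : C ≠ ∞) (hAC : ∀ t, A t ≤ C) (t : ℝ) : (A ⋆ₗ gammaRenewal c α) t ≠ ∞ := by
  rw [lconvolution_comm, lconvolution_def]
  refine ne_top_of_le_ne_top
    (ENNReal.mul_ne_top (lintegral_gammaRenewal_Ioo_ne_top hc hα t) hC) ?_
  rw [← lintegral_mul_const _ (by fun_prop), ← lintegral_indicator measurableSet_Ioo]
  refine lintegral_mono fun s => ?_
  by_cases hs : s ∈ Set.Ioo 0 t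
  · rw [Set.indicator_of_mem hs]
    exact mul_le_mul_right (hAC _) _
  · rw [Set.indicator_of_notMem hs]
    rcases le_or_gt s 0 with h | h
    · simp [gammaRenewal_of_nonpos _ _ h]
    · rw [hA0 _ (by by_contra! h'; exact hs ⟨h, by linarith⟩), mul_zero]

lemma tendsto_lconvolution_gammaRenewal {c α : ℝ} (hc : 0 < c) (hα : 0 < α)
    {A : ℝ → ℝ≥0∞} (hA : Measurable A) (hAint : ∫⁻ t, A t ≠ ∞) {C : ℝ≥0∞}
    (hC : C ≠ ∞) (hAC : ∀ t, A t ≤ C) (hAlim : Tendsto A atTop (nhds 0)) :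
    Tendsto (A ⋆ₗ gammaRenewal c α) atTop (nhds (ENNReal.ofReal (c / α) * ∫⁻ t, A t)) := by
  set K := gammaRenewal c α with hK
  have hKm : Measurable K := measurable_gammaRenewal c α
  have hKlim : Tendsto K atTop (nhds (ENNReal.ofReal (c / α))) := tendsto_gammaRenewal hc hα
  obtain ⟨B, hB1, hB2⟩ := exists_between (ENNReal.ofReal_lt_top (r := c / α))
  obtain ⟨T, hT⟩ := eventually_atTop.1 (hKlim.eventually (gt_mem_nhds hB1))
  have hsplit : K = (Set.Iio T).indicator K + (Set.Ici T).indicator K := by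
    rw [← Set.compl_Iio, Set.indicator_self_add_compl]
  have h1 : Tendsto ((Set.Iio T).indicator K ⋆ₗ A) atTop (nhds 0) := by
    have h0 : ∫⁻ s, (Set.Iio T).indicator K s * C ≠ ∞ := by
      rw [lintegral_mul_const _ (hKm.indicator measurableSet_Iio)]
      refine ENNReal.mul_ne_top ?_ hC
      refine ne_top_of_le_ne_top (lintegral_gammaRenewal_Ioo_ne_top hc hα T) ?_
      rw [← lintegral_indicator measurableSet_Ioo]
      refine lintegral_mono fun s => ?_
      rcases le_or_gt s 0 with h | h
      · rw [Set.indicator_apply_eq_zero.2 fun _ => gammaRenewal_of_nonpos _ _ h]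
        exact zero_le
      · by_cases hs : s < T
        · rw [Set.indicator_of_mem (Set.mem_Iio.2 hs), Set.indicator_of_mem (Set.mem_Ioo.2 ⟨h, hs⟩)]
        · rw [Set.indicator_of_notMem (by simpa using hs)]
          exact zero_le
    have key := tendsto_lintegral_filter_of_dominated_convergence (μ := volume) (l := atTop)
      (F := fun (t : ℝ) s => (Set.Iio T).indicator K s * A (-s + t)) (f := fun _ => 0)
      (fun s => (Set.Iio T).indicator K s * C)
      (Eventually.of_forall fun t => (hKm.indicator measurableSet_Iio).mul (by fun_prop))
      (Eventually.of_forall fun t => Eventually.of_forall fun s =>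
        mul_le_mul_right (hAC _) _) h0 (Eventually.of_forall fun s => ?_)
    · rw [lintegral_zero] at key
      exact key
    · have h2 : Tendsto (fun t : ℝ => A (-s + t)) atTop (nhds 0) :=
        hAlim.comp (tendsto_atTop_add_const_left _ _ tendsto_id)
      have h3 : (Set.Iio T).indicator K s ≠ ∞ :=
        ne_top_of_le_ne_top (gammaRenewal_ne_top hc hα s) (Set.indicator_le_self _ _ s)
      simpa using ENNReal.Tendsto.const_mul h2 (Or.inr h3)
  have h2 : Tendsto (A ⋆ₗ (Set.Ici T).indicator K) atTop
      (nhds (ENNReal.ofReal (c / α) * ∫⁻ t, A t)) := by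
    rw [mul_comm, ← lintegral_mul_const _ hA]
    refine tendsto_lintegral_filter_of_dominated_convergence (fun s => A s * B)
      (Eventually.of_forall fun t => hA.mul ((hKm.indicator measurableSet_Ici).comp (by fun_prop)))
      (Eventually.of_forall fun t => Eventually.of_forall fun s => ?_) ?_
      (ae_of_all _ fun s => ?_)
    · refine mul_le_mul_right ?_ _
      refine Set.indicator_le' (fun u hu => (hT u hu).le) (fun _ _ => zero_le) _
    · rw [lintegral_mul_const _ hA]
      exact ENNReal.mul_ne_top hAint hB2.ne
    · have hAs : A s ≠ ∞ := ne_top_of_le_ne_top hC (hAC s)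
      refine ENNReal.Tendsto.const_mul ?_ (Or.inr hAs)
      have h3 : Tendsto ((Set.Ici T).indicator K) atTop (nhds (ENNReal.ofReal (c / α))) :=
        hKlim.congr' (by
          filter_upwards [eventually_ge_atTop T] with u hu
          rw [Set.indicator_of_mem (Set.mem_Ici.2 hu)])
      exact h3.comp (tendsto_atTop_add_const_left _ _ tendsto_id)
  have h3 := h1.add h2
  rw [zero_add] at h3
  refine h3.congr fun t => ?_
  conv_rhs => rw [hsplit, lconvolution_add hA (hKm.indicator measurableSet_Iio)]
  rw [lconvolution_comm, Pi.add_apply]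

/-- The key renewal theorem for Gamma distributed waiting times with shape at most one. -/
lemma tendsto_of_gamma_renewal {c α : ℝ} (hc : 0 < c) (hα : 0 < α) (hα1 : α ≤ 1)
    {F A : ℝ → ℝ≥0∞} (hF : Measurable F) (hA : Measurable A) (hF0 : ∀ t ≤ 0, F t = 0)
    (hA0 : ∀ t ≤ 0, A t = 0) (hAint : ∫⁻ t, A t ≠ ∞) {C : ℝ≥0∞} (hC : C ≠ ∞)
    (hAC : ∀ t, A t ≤ C) (hAlim : Tendsto A atTop (nhds 0))
    (heq : ∀ t > 0, (F ⋆ₗ gammaKernel c α) t ≠ ∞ → F t = A t + (F ⋆ₗ gammaKernel c α) t)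
    (htop : ∀ t > 0, (F ⋆ₗ gammaKernel c α) t = ∞ → F t ≤ A t) :
    Tendsto F atTop (nhds (ENNReal.ofReal (c / α) * ∫⁻ t, A t)) := by
  have hH0 : ∀ t ≤ 0, gammaKernel c α t = 0 := fun t ht => gammaKernel_of_nonpos _ _ ht
  have hHm := measurable_gammaKernel c α
  have hle : ∀ t, F t ≤ A t + (F ⋆ₗ gammaKernel c α) t := fun t => by
    rcases le_or_gt t 0 with ht | ht
    · simp [hF0 t ht]
    by_cases h : (F ⋆ₗ gammaKernel c α) t = ∞
    · simp [h]
    · exact (heq t ht h).le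
  have hFint := lintegral_Iio_ne_top_of_renewal hF hA hHm hF0 hH0 hAint
    (lintegral_gammaKernel hc hα) (fun t ht => gammaKernel_pos hc hα ht)
    (gammaKernel_antitoneOn hc hα hα1) hle htop
  have hfin : ∀ᵐ t, (F ⋆ₗ gammaKernel c α) t ≠ ∞ := by
    have h : ∀ n : ℕ, ∀ᵐ t, t ∈ Set.Iio (n : ℝ) → (F ⋆ₗ gammaKernel c α) t < ∞ := fun n => by
      rw [← ae_restrict_iff' measurableSet_Iio]
      refine ae_lt_top (by fun_prop) (ne_top_of_le_ne_top ?_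
        (lintegral_Iio_lconvolution_le hF hHm hF0 hH0 (le_refl (n : ℝ))))
      refine ENNReal.mul_ne_top (ne_top_of_le_ne_top ENNReal.one_ne_top ?_) (hFint n)
      rw [← lintegral_gammaKernel hc hα]
      exact setLIntegral_le_lintegral _ _
    filter_upwards [ae_all_iff.2 h] with t ht
    obtain ⟨n, hn⟩ := exists_nat_gt t
    exact (ht n hn).ne
  have hae : F =ᵐ[volume] A + F ⋆ₗ gammaKernel c α := by
    filter_upwards [hfin] with t ht
    rcases le_or_gt t 0 with h | h
    · rw [Pi.add_apply, hF0 t h, hA0 t h, lconvolution_of_nonpos hF0 hH0 h, add_zero]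
    · exact heq t h ht
  have hsol := ae_eq_add_lconvolution_gammaRenewal hc hα hF hA hF0 hFint hae
  have hconv : F ⋆ₗ gammaKernel c α = A ⋆ₗ gammaRenewal c α := by
    rw [lconvolution_congr_ae hsol, add_lconvolution hA hHm,
      ← lconvolution_assoc hA (by fun_prop) hHm, ← lconvolution_add hA hHm, ← gammaRenewal_eq hc hα]
  have hlim := hAlim.add (tendsto_lconvolution_gammaRenewal hc hα hA hAint hC hAC hAlim)
  rw [zero_add] at hlim
  refine hlim.congr' ?_
  filter_upwards [eventually_gt_atTop 0] with t ht
  rw [heq t ht (by rw [hconv]; exact lconvolution_gammaRenewal_ne_top hc hα hA0 hC hAC t), hconv]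

/-- The rate `(b Γ(1 - θ)) ^ (1 / (1 - θ))` turns the exponentially tilted power
kernel into the Gamma density of shape `1 - θ`. -/
lemma gammaKernel_rate_eq {θ b t : ℝ} (hθ : θ < 1) (hb : 0 < b) (ht : 0 < t) :
    gammaKernel ((b * Real.Gamma (1 - θ)) ^ (1 / (1 - θ))) (1 - θ) t =
      ENNReal.ofReal
        (b * t ^ (-θ) * Real.exp (-((b * Real.Gamma (1 - θ)) ^ (1 / (1 - θ)) * t))) := by
  have hα : 0 < 1 - θ := by linarith
  have hΓ : 0 < Real.Gamma (1 - θ) := Real.Gamma_pos_of_pos hα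
  have hbΓ : 0 < b * Real.Gamma (1 - θ) := mul_pos hb hΓ
  have hc : 0 < (b * Real.Gamma (1 - θ)) ^ (1 / (1 - θ)) := Real.rpow_pos_of_pos hbΓ _
  have hpow : ((b * Real.Gamma (1 - θ)) ^ (1 / (1 - θ))) ^ (1 - θ) = b * Real.Gamma (1 - θ) := by
    rw [← Real.rpow_mul hbΓ.le, one_div_mul_cancel hα.ne', Real.rpow_one]
  set c := (b * Real.Gamma (1 - θ)) ^ (1 / (1 - θ)) with hcdef
  have hcc : c * c ^ (-θ) = b * Real.Gamma (1 - θ) := by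
    rw [← hpow, sub_eq_add_neg, Real.rpow_add hc, Real.rpow_one]
  rw [gammaKernel_of_pos _ _ ht, gammaWeight, show 1 - θ - 1 = -θ by ring,
    Real.mul_rpow hc.le ht.le]
  congr 1
  calc c * (c ^ (-θ) * t ^ (-θ) * Real.exp (-(c * t)) / Real.Gamma (1 - θ))
      = c * c ^ (-θ) * (t ^ (-θ) * Real.exp (-(c * t)) / Real.Gamma (1 - θ)) := by ring
    _ = b * t ^ (-θ) * Real.exp (-(c * t)) := by rw [hcc]; field_simp

/-- Convolving an exponentially tilted function with the Gamma density of shape `1 - θ` is tilting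
its fractional integral. -/
lemma tilt_lconvolution_gammaKernel {θ b : ℝ} (hθ : θ < 1) (hb : 0 < b) {f : ℝ → ℝ} {c : ℝ}
    (hc : c = (b * Real.Gamma (1 - θ)) ^ (1 / (1 - θ))) (hf : ∀ t > 0, 0 ≤ f t) (t : ℝ) :
    ((Set.Ioi (0 : ℝ)).indicator (fun t => ENNReal.ofReal (Real.exp (-(c * t)) * f t)) ⋆ₗ
        gammaKernel c (1 - θ)) t =
      ENNReal.ofReal (Real.exp (-(c * t)) * b) *
        ∫⁻ s in Set.Ioo 0 t, ENNReal.ofReal (f s * (t - s) ^ (-θ)) := by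
  rw [lconvolution_def, ← lintegral_const_mul' _ _ ENNReal.ofReal_ne_top,
    ← lintegral_indicator measurableSet_Ioo]
  refine lintegral_congr fun s => ?_
  rcases le_or_gt s 0 with hs | hs
  · rw [Set.indicator_of_notMem (by simpa using hs), zero_mul,
      Set.indicator_of_notMem fun h => (not_lt.2 hs) h.1]
  rcases le_or_gt t s with hst | hst
  · rw [gammaKernel_of_nonpos _ _ (by linarith), mul_zero,
      Set.indicator_of_notMem fun h => (not_lt.2 hst) h.2]
  rw [Set.indicator_of_mem (Set.mem_Ioi.2 hs), Set.indicator_of_mem (Set.mem_Ioo.2 ⟨hs, hst⟩), hc,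
    gammaKernel_rate_eq hθ hb (by linarith), ← hc,
    ← ENNReal.ofReal_mul (mul_nonneg (Real.exp_nonneg _) (hf s hs)),
    ← ENNReal.ofReal_mul (mul_nonneg (Real.exp_nonneg _) hb.le), neg_add_eq_sub]
  congr 1
  have he : Real.exp (-(c * t)) = Real.exp (-(c * s)) * Real.exp (-(c * (t - s))) := by
    rw [← Real.exp_add]
    ring_nf
  rw [he]
  ring

/-- Renewal theorem asymptotics: if `f` solves the renewal equation
`f(t) = a(t) + b ∫₀ᵗ f(s)(t-s)^{-θ} ds` and has at most exponential growth,
then `e^{-ct} f(t) → (c/(1-θ)) ∫₀^∞ a(y) e^{-cy} dy`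
where `c = (b Γ(1-θ))^{1/(1-θ)}`. -/
theorem renewal_equation_asymptotics
    (θ b : ℝ) (hθ : θ ∈ Set.Ioo (0 : ℝ) 1) (hb : 0 < b)
    (a : ℝ → ℝ) (ha_meas : Measurable a)
    (ha_nonneg : ∀ t ≥ (0 : ℝ), 0 ≤ a t)
    (ha_anti : ∀ s t : ℝ, 0 ≤ s → s ≤ t → a t ≤ a s)
    (ha_bdd : ∃ C : ℝ, ∀ t ≥ (0 : ℝ), a t ≤ C)
    (f : ℝ → ℝ) (hf_meas : Measurable f)
    (hf_nonneg : ∀ t > (0 : ℝ), 0 ≤ f t)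
    (hf_eq : ∀ t > (0 : ℝ),
      f t = a t + b * ∫ s in Set.Ioo (0 : ℝ) t, f s * (t - s) ^ (-θ))
    (hf_growth :
      limsup (fun t : ℝ => ((Real.log (f t) / t : ℝ) : EReal)) atTop < ⊤) :
    Tendsto
      (fun t : ℝ =>
        Real.exp (-((b * Real.Gamma (1 - θ)) ^ (1 / (1 - θ)) * t)) * f t)
      atTop
      (nhds ((b * Real.Gamma (1 - θ)) ^ (1 / (1 - θ)) / (1 - θ) *
        ∫ y in Set.Ioi (0 : ℝ),
          a y * Real.exp (-((b * Real.Gamma (1 - θ)) ^ (1 / (1 - θ)) * y)))) := by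
  obtain ⟨hθ0, hθ1⟩ := hθ
  obtain ⟨C, hC⟩ := ha_bdd
  have hα : 0 < 1 - θ := by linarith
  have hbΓ : 0 < b * Real.Gamma (1 - θ) := mul_pos hb (Real.Gamma_pos_of_pos hα)
  have hc : 0 < (b * Real.Gamma (1 - θ)) ^ (1 / (1 - θ)) := Real.rpow_pos_of_pos hbΓ _
  generalize hcdef : (b * Real.Gamma (1 - θ)) ^ (1 / (1 - θ)) = c at hc ⊢
  set F := (Set.Ioi (0 : ℝ)).indicator (fun t => ENNReal.ofReal (Real.exp (-(c * t)) * f t))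
    with hFdef
  set A := (Set.Ioi (0 : ℝ)).indicator (fun t => ENNReal.ofReal (Real.exp (-(c * t)) * a t))
    with hAdef
  have hFm : Measurable F := Measurable.indicator (by fun_prop) measurableSet_Ioi
  have hAm : Measurable A := Measurable.indicator (by fun_prop) measurableSet_Ioi
  have hFpos : ∀ t > 0, F t = ENNReal.ofReal (Real.exp (-(c * t)) * f t) := fun t ht =>
    Set.indicator_of_mem (Set.mem_Ioi.2 ht) _
  have hApos : ∀ t > 0, A t = ENNReal.ofReal (Real.exp (-(c * t)) * a t) := fun t ht =>
    Set.indicator_of_mem (Set.mem_Ioi.2 ht) _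
  have hF0 : ∀ t ≤ 0, F t = 0 := fun t ht => Set.indicator_of_notMem (by simpa using ht) _
  have hA0 : ∀ t ≤ 0, A t = 0 := fun t ht => Set.indicator_of_notMem (by simpa using ht) _
  have hC0 : 0 ≤ C := (ha_nonneg 0 le_rfl).trans (hC 0 le_rfl)
  have hexp : ∀ t : ℝ, 0 < t → Real.exp (-(c * t)) * a t ≤ Real.exp (-(c * t)) * C := fun t ht =>
    mul_le_mul_of_nonneg_left (hC t ht.le) (Real.exp_nonneg _)
  have hAC : ∀ t, A t ≤ ENNReal.ofReal C := fun t => by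
    rcases le_or_gt t 0 with ht | ht
    · simp [hA0 t ht]
    rw [hApos t ht]
    refine ENNReal.ofReal_le_ofReal ((hexp t ht).trans (mul_le_of_le_one_left hC0 ?_))
    exact Real.exp_le_one_iff.2 (neg_nonpos.2 (mul_pos hc ht).le)
  have hAlim : Tendsto A atTop (nhds 0) := by
    have h1 : Tendsto (fun t : ℝ => Real.exp (-(c * t)) * C) atTop (nhds 0) := by
      have := (Real.tendsto_exp_neg_atTop_nhds_zero.comp
        (tendsto_id.const_mul_atTop hc)).mul_const C
      simpa using this
    have h2 := ENNReal.tendsto_ofReal h1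
    rw [ENNReal.ofReal_zero] at h2
    refine tendsto_of_tendsto_of_tendsto_of_le_of_le' tendsto_const_nhds h2
      (Eventually.of_forall fun _ => zero_le) ?_
    filter_upwards [eventually_gt_atTop 0] with t ht
    rw [hApos t ht]
    exact ENNReal.ofReal_le_ofReal (hexp t ht)
  have haint : IntegrableOn (fun t => a t * Real.exp (-(c * t))) (Set.Ioi 0) := by
    have h1 : IntegrableOn (fun t => C * Real.exp (-c * t)) (Set.Ioi 0) :=
      (integrableOn_exp_mul_Ioi (by linarith) 0).const_mul C
    refine Integrable.mono' h1 (by fun_prop) ?_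
    filter_upwards [ae_restrict_mem measurableSet_Ioi] with t ht
    have ht' : 0 < t := ht
    rw [Real.norm_of_nonneg (mul_nonneg (ha_nonneg t ht'.le) (Real.exp_nonneg _)), neg_mul]
    exact mul_le_mul_of_nonneg_right (hC t ht'.le) (Real.exp_nonneg _)
  have hAeq : ∫⁻ t, A t = ENNReal.ofReal (∫ t in Set.Ioi 0, a t * Real.exp (-(c * t))) := by
    rw [ofReal_integral_eq_lintegral_ofReal haint, hAdef, lintegral_indicator measurableSet_Ioi]
    · simp only [mul_comm]
    · filter_upwards [ae_restrict_mem measurableSet_Ioi] with t ht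
      exact mul_nonneg (ha_nonneg t (le_of_lt ht)) (Real.exp_nonneg _)
  have hI0 : 0 ≤ ∫ t in Set.Ioi 0, a t * Real.exp (-(c * t)) :=
    setIntegral_nonneg measurableSet_Ioi fun t ht =>
      mul_nonneg (ha_nonneg t (le_of_lt ht)) (Real.exp_nonneg _)
  have hconv := tilt_lconvolution_gammaKernel hθ1 hb hcdef.symm hf_nonneg
  rw [← hFdef] at hconv
  have hnn : ∀ t, 0 ≤ᵐ[volume.restrict (Set.Ioo 0 t)] fun s => f s * (t - s) ^ (-θ) := fun t => by
    filter_upwards [ae_restrict_mem measurableSet_Ioo] with s hs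
    exact mul_nonneg (hf_nonneg s hs.1) (Real.rpow_nonneg (by linarith [hs.2]) _)
  have hms : ∀ t, AEStronglyMeasurable (fun s => f s * (t - s) ^ (-θ))
      (volume.restrict (Set.Ioo 0 t)) := fun t => by
    have : Measurable fun s => f s * (t - s) ^ (-θ) := by fun_prop
    exact this.aestronglyMeasurable
  have hmain : Tendsto F atTop (nhds (ENNReal.ofReal (c / (1 - θ)) * ∫⁻ t, A t)) := by
    refine tendsto_of_gamma_renewal hc hα (by linarith) hFm hAm hF0 hA0
      (by rw [hAeq]; exact ENNReal.ofReal_ne_top) ENNReal.ofReal_ne_top hAC hAlim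
      (fun t ht hfin => ?_) (fun t ht htop => ?_)
    · rw [hconv] at hfin ⊢
      have hpos : ENNReal.ofReal (Real.exp (-(c * t)) * b) ≠ 0 :=
        (ENNReal.ofReal_pos.2 (mul_pos (Real.exp_pos _) hb)).ne'
      have hfin' : ∫⁻ s in Set.Ioo 0 t, ENNReal.ofReal (f s * (t - s) ^ (-θ)) ≠ ⊤ :=
        fun h => hfin (by rw [h, ENNReal.mul_top hpos])
      have hint : IntegrableOn (fun s => f s * (t - s) ^ (-θ)) (Set.Ioo 0 t) :=
        (lintegral_ofReal_ne_top_iff_integrable (hms t) (hnn t)).1 hfin'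
      rw [← ofReal_integral_eq_lintegral_ofReal hint (hnn t),
        ← ENNReal.ofReal_mul (mul_nonneg (Real.exp_nonneg _) hb.le), hFpos t ht, hApos t ht,
        ← ENNReal.ofReal_add (mul_nonneg (Real.exp_nonneg _) (ha_nonneg t ht.le))
          (mul_nonneg (mul_nonneg (Real.exp_nonneg _) hb.le) (integral_nonneg_of_ae (hnn t))),
        hf_eq t ht]
      congr 1
      ring
    · rw [hconv] at htop
      have hnint : ¬ IntegrableOn (fun s => f s * (t - s) ^ (-θ)) (Set.Ioo 0 t) := fun h => by
        rw [← ofReal_integral_eq_lintegral_ofReal h (hnn t)] at htop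
        exact ENNReal.mul_ne_top ENNReal.ofReal_ne_top ENNReal.ofReal_ne_top htop
      rw [hFpos t ht, hApos t ht, hf_eq t ht, integral_undef hnint, mul_zero, add_zero]
  rw [hAeq, ← ENNReal.ofReal_mul (div_pos hc hα).le] at hmain
  have hreal := (ENNReal.tendsto_toReal ENNReal.ofReal_ne_top).comp hmain
  rw [ENNReal.toReal_ofReal (mul_nonneg (div_pos hc hα).le hI0)] at hreal
  refine hreal.congr' ?_
  filter_upwards [eventually_gt_atTop 0] with t ht
  rw [Function.comp_apply, hFpos t ht,
    ENNReal.toReal_ofReal (mul_nonneg (Real.exp_nonneg _) (hf_nonneg t ht))]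
end

section
/- Fix θ ∈ (0,1) and b ∈ (0,∞), set g(τ) := b τ^{-θ}, and let a : [0,∞) → [0,∞) be measurable, non-increasing and bounded. Suppose f : (0,∞) → [0,∞) is measurable, solves f(t) = a(t) + ∫₀ᵗ f(s) g(t-s) ds for all t > 0, and satisfies limsup_{t→∞} (1/t) log f(t) < ∞. If F : (0,∞) → [0,∞) is measurable, satisfies the supersolution inequality F(t) ≥ a(t) + ∫₀ᵗ F(s) g(t-s) ds for all t > 0, and sup_{t>0} e^{-γt} F(t) < ∞ for some γ > 0, then F(t) ≥ f(t) for all t > 0. -/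
open MeasureTheory Filter

/-- An integrable nonnegative function dominated by its convolution with a kernel of mass
less than one vanishes almost everywhere. -/
lemma lintegral_eq_zero_of_le_convolution {φ κ : ℝ → ENNReal} (hφ : Measurable φ)
    (hκ : Measurable κ) (hle : ∀ t, φ t ≤ ∫⁻ s, φ s * κ (t - s))
    (hfin : ∫⁻ s, φ s ≠ ⊤) (hmass : ∫⁻ u, κ u < 1) : ∫⁻ s, φ s = 0 := by
  have h1 : ∫⁻ t, φ t ≤ (∫⁻ s, φ s) * ∫⁻ u, κ u := by
    calc ∫⁻ t, φ t ≤ ∫⁻ t, ∫⁻ s, φ s * κ (t - s) := lintegral_mono hle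
      _ = ∫⁻ s, ∫⁻ t, φ s * κ (t - s) := by
          apply lintegral_lintegral_swap
          apply Measurable.aemeasurable
          exact (hφ.comp measurable_snd).mul (hκ.comp (measurable_fst.sub measurable_snd))
      _ = ∫⁻ s, φ s * ∫⁻ u, κ u := by
          congr 1 with s
          rw [lintegral_const_mul _ (by fun_prop : Measurable fun t => κ (t - s)),
            lintegral_sub_right_eq_self κ s]
      _ = (∫⁻ s, φ s) * ∫⁻ u, κ u := lintegral_mul_const _ hφ
  by_contra h0
  have h2 := ENNReal.mul_lt_mul_right h0 hfin hmass
  rw [mul_one] at h2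
  exact absurd h1 (not_le.mpr h2)

/-- A Gronwall inequality for Volterra kernels with small Laplace transform. -/
lemma setLIntegral_eq_zero_of_le_volterra {h k : ℝ → ENNReal} (hh : Measurable h)
    (hk : Measurable k) {T r : ℝ} (hr : 0 ≤ r)
    (hle : ∀ t ∈ Set.Ioo 0 T, h t ≤ ∫⁻ s in Set.Ioo 0 t, h s * k (t - s))
    (hfin : ∫⁻ s in Set.Ioo 0 T, h s ≠ ⊤)
    (hmass : ∫⁻ u in Set.Ioi 0, ENNReal.ofReal (Real.exp (-(r * u))) * k u < 1) :
    ∫⁻ s in Set.Ioo 0 T, h s = 0 := by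
  let e : ℝ → ENNReal := fun u => ENNReal.ofReal (Real.exp (-(r * u)))
  have he : Measurable e := by fun_prop
  have he0 : ∀ u, e u ≠ 0 := fun u => by simp [e, Real.exp_pos]
  have hadd : ∀ s t, e s * e (t - s) = e t := fun s t => by
    simp only [e]
    rw [← ENNReal.ofReal_mul (Real.exp_nonneg _), ← Real.exp_add]
    congr 2
    ring
  have key := lintegral_eq_zero_of_le_convolution
    (φ := (Set.Ioo 0 T).indicator fun s => e s * h s)
    (κ := (Set.Ioi 0).indicator fun s => e s * k s)
    ((he.mul hh).indicator measurableSet_Ioo) ((he.mul hk).indicator measurableSet_Ioi)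
    ?_ ?_ ?_
  · rw [lintegral_indicator measurableSet_Ioo, lintegral_eq_zero_iff (by fun_prop)] at key
    rw [lintegral_eq_zero_iff hh]
    filter_upwards [key] with s hs
    exact (mul_eq_zero.mp hs).resolve_left (he0 s)
  · intro t
    by_cases ht : t ∈ Set.Ioo 0 T
    · rw [Set.indicator_of_mem ht]
      calc e t * h t ≤ e t * ∫⁻ s in Set.Ioo 0 t, h s * k (t - s) := by gcongr; exact hle t ht
        _ = ∫⁻ s in Set.Ioo 0 t, e t * (h s * k (t - s)) := by
            rw [lintegral_const_mul]
            exact hh.mul (hk.comp (measurable_id.const_sub t))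
        _ = ∫⁻ s, (Set.Ioo 0 t).indicator (fun s => e t * (h s * k (t - s))) s :=
            (lintegral_indicator measurableSet_Ioo _).symm
        _ ≤ _ := by
            apply lintegral_mono
            intro s
            beta_reduce
            refine Set.indicator_apply_le' (fun hs => ?_) fun _ => zero_le
            have h1 : s ∈ Set.Ioo 0 T := ⟨hs.1, hs.2.trans ht.2⟩
            have h2 : t - s ∈ Set.Ioi 0 := sub_pos.mpr hs.2
            rw [Set.indicator_of_mem h1, Set.indicator_of_mem h2, ← hadd s t]
            apply le_of_eq
            ring
    · simp [Set.indicator_of_notMem ht]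
  · rw [lintegral_indicator measurableSet_Ioo]
    refine ne_top_of_le_ne_top hfin (setLIntegral_mono hh fun s hs => ?_)
    have : e s ≤ 1 := by
      simp only [e]
      rw [ENNReal.ofReal_le_one, Real.exp_le_one_iff]
      have := mul_nonneg hr hs.1.le
      linarith
    calc e s * h s ≤ 1 * h s := by gcongr
      _ = h s := one_mul _
  · rwa [lintegral_indicator measurableSet_Ioi]

/-- The Laplace transform of `b * u ^ (-θ)` is eventually less than one. -/
lemma exists_laplace_rpow_lt_one {θ b : ℝ} (hθ : θ < 1) (hb : 0 < b) :
    ∃ r : ℝ, 0 ≤ r ∧ ∫⁻ u in Set.Ioi 0,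
      ENNReal.ofReal (Real.exp (-(r * u))) * ENNReal.ofReal (b * u ^ (-θ)) < 1 := by
  have ht : Tendsto (fun r : ℝ => b * (r ^ (-(1 - θ)) * Real.Gamma (1 - θ))) atTop (nhds 0) := by
    simpa using ((tendsto_rpow_neg_atTop (sub_pos.mpr hθ)).mul_const
      (Real.Gamma (1 - θ))).const_mul b
  obtain ⟨r, hr1, hr0⟩ := ((ht.eventually_lt_const one_pos).and (eventually_gt_atTop 0)).exists
  refine ⟨r, hr0.le, ?_⟩
  have hint := Real.integral_rpow_mul_exp_neg_mul_Ioi (sub_pos.mpr hθ) hr0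
  have hpos : 0 < (1 / r) ^ (1 - θ) * Real.Gamma (1 - θ) :=
    mul_pos (Real.rpow_pos_of_pos (by positivity) _) (Real.Gamma_pos_of_pos (sub_pos.mpr hθ))
  have hi : IntegrableOn (fun u : ℝ => u ^ (1 - θ - 1) * Real.exp (-(r * u))) (Set.Ioi 0) := by
    by_contra hn
    rw [integral_undef hn] at hint
    exact hpos.ne hint
  have heq : ∫⁻ u in Set.Ioi 0,
      ENNReal.ofReal (Real.exp (-(r * u))) * ENNReal.ofReal (b * u ^ (-θ)) =
      ∫⁻ u in Set.Ioi 0, ENNReal.ofReal (b * (u ^ (1 - θ - 1) * Real.exp (-(r * u)))) := by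
    apply setLIntegral_congr_fun measurableSet_Ioi
    intro u _
    simp only
    rw [← ENNReal.ofReal_mul (Real.exp_nonneg _), show 1 - θ - 1 = -θ by ring]
    congr 1
    ring
  rw [heq, ← ofReal_integral_eq_lintegral_ofReal (hi.const_mul b), integral_const_mul, hint,
    ENNReal.ofReal_lt_one, one_div, Real.inv_rpow hr0.le, ← Real.rpow_neg hr0.le]
  · exact hr1
  · filter_upwards [ae_restrict_mem measurableSet_Ioi] with u hu
    have : 0 < u := hu
    positivity

/-- Comparison theorem for the renewal equation: a nonnegative supersolution
of at most exponential growth dominates the solution. -/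
theorem renewal_supersolution_comparison
    (θ b : ℝ) (hθ : θ ∈ Set.Ioo (0 : ℝ) 1) (hb : 0 < b)
    (a : ℝ → ℝ) (ha_meas : Measurable a)
    (ha_nonneg : ∀ t ≥ (0 : ℝ), 0 ≤ a t)
    (ha_anti : ∀ s t : ℝ, 0 ≤ s → s ≤ t → a t ≤ a s)
    (ha_bdd : ∃ C : ℝ, ∀ t ≥ (0 : ℝ), a t ≤ C)
    (f : ℝ → ℝ) (hf_meas : Measurable f)
    (hf_nonneg : ∀ t > (0 : ℝ), 0 ≤ f t)
    (hf_eq : ∀ t > (0 : ℝ),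
      f t = a t + ∫ s in Set.Ioo (0 : ℝ) t, f s * (b * (t - s) ^ (-θ)))
    (hf_growth :
      limsup (fun t : ℝ => ((Real.log (f t) / t : ℝ) : EReal)) atTop < ⊤)
    (F : ℝ → ℝ) (hF_meas : Measurable F)
    (hF_nonneg : ∀ t > (0 : ℝ), 0 ≤ F t)
    (hF_super : ∀ t > (0 : ℝ),
      a t + ∫ s in Set.Ioo (0 : ℝ) t, F s * (b * (t - s) ^ (-θ)) ≤ F t)
    (hF_growth : ∃ γ > (0 : ℝ), ∃ K : ℝ,
      ∀ t > (0 : ℝ), Real.exp (-(γ * t)) * F t ≤ K) :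
    ∀ t > (0 : ℝ), f t ≤ F t := by
  obtain ⟨γ, hγ, K, hK⟩ := hF_growth
  have hker_nonneg : ∀ t s : ℝ, s < t → 0 ≤ b * (t - s) ^ (-θ) := fun t s hs =>
    mul_nonneg hb.le (Real.rpow_nonneg (sub_pos.mpr hs).le _)
  have hker : ∀ t > (0 : ℝ), IntegrableOn (fun s => b * (t - s) ^ (-θ)) (Set.Ioo 0 t) := by
    intro t ht
    have h1 : IntervalIntegrable (fun x : ℝ => x ^ (-θ)) volume 0 t :=
      intervalIntegral.intervalIntegrable_rpow' (by linarith [hθ.2])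
    have h2 := (h1.comp_sub_left t).symm
    simp only [sub_zero, sub_self] at h2
    exact ((intervalIntegrable_iff_integrableOn_Ioo_of_le ht.le).mp h2).const_mul b
  have hF_bound : ∀ t > (0 : ℝ), ∀ s ∈ Set.Ioo 0 t, ‖F s‖ ≤ |K| * Real.exp (γ * t) := by
    intro t _ s hs
    rw [Real.norm_of_nonneg (hF_nonneg s hs.1)]
    have h1 : F s = Real.exp (γ * s) * (Real.exp (-(γ * s)) * F s) := by
      rw [← mul_assoc, ← Real.exp_add]
      simp
    have h2 : Real.exp (-(γ * s)) * F s ≤ |K| := (hK s hs.1).trans (le_abs_self K)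
    have h3 : γ * s ≤ γ * t := by nlinarith [hs.2]
    rw [h1, mul_comm]
    gcongr
  have hFker : ∀ t > (0 : ℝ),
      IntegrableOn (fun s => F s * (b * (t - s) ^ (-θ))) (Set.Ioo 0 t) := by
    intro t ht
    refine (hker t ht).bdd_mul (c := |K| * Real.exp (γ * t)) hF_meas.aestronglyMeasurable ?_
    filter_upwards [ae_restrict_mem measurableSet_Ioo] with s hs using hF_bound t ht s hs
  have hdiff : ∀ t > (0 : ℝ), ENNReal.ofReal (f t - F t) ≤
      ∫⁻ s in Set.Ioo 0 t, ENNReal.ofReal (f s - F s) * ENNReal.ofReal (b * (t - s) ^ (-θ)) := by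
    intro t ht
    by_cases hi : IntegrableOn (fun s => f s * (b * (t - s) ^ (-θ))) (Set.Ioo 0 t)
    · have h1 : f t - F t ≤ ∫ s in Set.Ioo 0 t, (f s - F s) * (b * (t - s) ^ (-θ)) := by
        simp only [sub_mul]
        rw [integral_sub hi (hFker t ht)]
        linarith [hf_eq t ht, hF_super t ht]
      have hi' : IntegrableOn (fun s => (f s - F s) * (b * (t - s) ^ (-θ))) (Set.Ioo 0 t) := by
        simp only [sub_mul]
        exact hi.sub (hFker t ht)
      have h2 : ∫ s in Set.Ioo 0 t, (f s - F s) * (b * (t - s) ^ (-θ)) ≤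
          ∫ s in Set.Ioo 0 t, max ((f s - F s) * (b * (t - s) ^ (-θ))) 0 :=
        integral_mono hi' hi'.pos_part fun s => le_max_left _ _
      refine (ENNReal.ofReal_le_ofReal (h1.trans h2)).trans ?_
      rw [ofReal_integral_eq_lintegral_ofReal hi'.pos_part
        (Eventually.of_forall fun s => le_max_right _ _)]
      apply le_of_eq
      apply setLIntegral_congr_fun measurableSet_Ioo
      intro s hs
      simp only
      rw [← ENNReal.ofReal_mul' (hker_nonneg t s hs.2)]
      simp
    · have h1 := hf_eq t ht
      rw [integral_undef hi] at h1
      have h2 : 0 ≤ ∫ s in Set.Ioo 0 t, F s * (b * (t - s) ^ (-θ)) :=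
        setIntegral_nonneg measurableSet_Ioo fun s hs =>
          mul_nonneg (hF_nonneg s hs.1) (hker_nonneg t s hs.2)
      rw [ENNReal.ofReal_of_nonpos (by linarith [hF_super t ht])]
      exact zero_le
  intro t ht
  by_cases hi : IntegrableOn f (Set.Ioo 0 t)
  · obtain ⟨r, hr, hmass⟩ := exists_laplace_rpow_lt_one hθ.2 hb
    have hmeas : Measurable fun s => ENNReal.ofReal (f s - F s) :=
      (hf_meas.sub hF_meas).ennreal_ofReal
    have hzero : ∫⁻ s in Set.Ioo 0 t, ENNReal.ofReal (f s - F s) = 0 := by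
      refine setLIntegral_eq_zero_of_le_volterra (k := fun u => ENNReal.ofReal (b * u ^ (-θ)))
        hmeas (by fun_prop) hr (fun s hs => hdiff s hs.1) ?_ hmass
      refine ne_top_of_le_ne_top hi.2.ne (setLIntegral_mono hf_meas.enorm fun s hs => ?_)
      rw [Real.enorm_of_nonneg (hf_nonneg s hs.1)]
      exact ENNReal.ofReal_le_ofReal (by linarith [hF_nonneg s hs.1])
    have h1 : ∫⁻ s in Set.Ioo 0 t,
        ENNReal.ofReal (f s - F s) * ENNReal.ofReal (b * (t - s) ^ (-θ)) = 0 := by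
      rw [lintegral_eq_zero_iff (by fun_prop)]
      filter_upwards [(lintegral_eq_zero_iff hmeas).mp hzero] with s hs
      simp only [Pi.zero_apply] at hs ⊢
      rw [hs, zero_mul]
    have h2 := hdiff t ht
    rw [h1, nonpos_iff_eq_zero, ENNReal.ofReal_eq_zero] at h2
    linarith
  · have hn : ¬ IntegrableOn (fun s => f s * (b * (t - s) ^ (-θ))) (Set.Ioo 0 t) := by
      intro hfg
      apply hi
      refine (hfg.const_mul (b * t ^ (-θ))⁻¹).mono' hf_meas.aestronglyMeasurable ?_
      filter_upwards [ae_restrict_mem measurableSet_Ioo] with s hs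
      have hc : 0 < b * t ^ (-θ) := mul_pos hb (Real.rpow_pos_of_pos ht _)
      rw [Real.norm_of_nonneg (hf_nonneg s hs.1), inv_mul_eq_div, le_div_iff₀ hc]
      have h1 : t ^ (-θ) ≤ (t - s) ^ (-θ) :=
        Real.rpow_le_rpow_of_nonpos (sub_pos.mpr hs.2) (by linarith [hs.1]) (by linarith [hθ.1])
      have h2 := hf_nonneg s hs.1
      gcongr
    have h1 := hf_eq t ht
    rw [integral_undef hn] at h1
    have h2 : 0 ≤ ∫ s in Set.Ioo 0 t, F s * (b * (t - s) ^ (-θ)) :=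
      setIntegral_nonneg measurableSet_Ioo fun s hs =>
        mul_nonneg (hF_nonneg s hs.1) (hker_nonneg t s hs.2)
    linarith [hF_super t ht]
end

section
/- Fix θ ∈ (0,1), b ∈ (0,∞) and a ∈ (0,∞), and set c := (b Γ(1-θ))^{1/(1-θ)}. Let I : (0,∞) → [0,∞) be measurable with sup_{t>0} e^{-γt} I(t) < ∞ for some γ > 0, and suppose I(t) ≥ a + b ∫₀ᵗ I(s) (t-s)^{-θ} ds for all t > 0. Then liminf_{t→∞} e^{-ct} I(t) ≥ a/(1-θ); in particular, liminf_{t→∞} (1/t) log I(t) ≥ c = (b Γ(1-θ))^{1/(1-θ)}. -/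
open MeasureTheory Filter

lemma integral_rpow_mul_sub_rpow {u v t : ℝ} (hu : 0 < u) (hv : 0 < v) (ht : 0 < t) :
    ∫ s in Set.Ioo 0 t, s ^ (u - 1) * (t - s) ^ (v - 1) =
      t ^ (u + v - 1) * (Real.Gamma u * Real.Gamma v / Real.Gamma (u + v)) := by
  have h := Complex.betaIntegral_scaled u v ht
  rw [Complex.betaIntegral_eq_Gamma_mul_div u v (by simpa) (by simpa),
    intervalIntegral.integral_of_le ht.le, integral_Ioc_eq_integral_Ioo] at h
  have key : ((∫ s in Set.Ioo 0 t, s ^ (u - 1) * (t - s) ^ (v - 1) : ℝ) : ℂ) =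
      ((t ^ (u + v - 1) * (Real.Gamma u * Real.Gamma v / Real.Gamma (u + v)) : ℝ) : ℂ) := by
    rw [← integral_complex_ofReal]
    have e : ∫ s in Set.Ioo 0 t, ((s ^ (u - 1) * (t - s) ^ (v - 1) : ℝ) : ℂ) =
        ∫ s in Set.Ioo 0 t, (s : ℂ) ^ ((u : ℂ) - 1) * ((t : ℂ) - s) ^ ((v : ℂ) - 1) := by
      refine setIntegral_congr_fun measurableSet_Ioo fun s hs => ?_
      rw [Complex.ofReal_mul, Complex.ofReal_cpow hs.1.le,
        Complex.ofReal_cpow (sub_nonneg.2 hs.2.le)]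
      push_cast
      rfl
    refine e.trans (h.trans ?_)
    rw [Complex.ofReal_mul, Complex.ofReal_cpow ht.le]
    push_cast [← Complex.Gamma_ofReal]
    rfl
  exact_mod_cast key

lemma integrableOn_sub_rpow_neg {θ : ℝ} (hθ : θ < 1) (t : ℝ) :
    IntegrableOn (fun s : ℝ => (t - s) ^ (-θ)) (Set.Ioo 0 t) := by
  have h : IntervalIntegrable (fun s : ℝ => s ^ (-θ)) volume 0 t :=
    intervalIntegral.intervalIntegrable_rpow' (by linarith)
  have h' := (h.comp_sub_left t).symm
  simp only [sub_zero, sub_self] at h'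
  exact h'.1.mono_set Set.Ioo_subset_Ioc_self

lemma integrableOn_mul_sub_rpow_neg {θ t C : ℝ} (hθ : θ < 1) {f : ℝ → ℝ} (hf : Measurable f)
    (hC : ∀ s ∈ Set.Ioo 0 t, |f s| ≤ C) :
    IntegrableOn (fun s : ℝ => f s * (t - s) ^ (-θ)) (Set.Ioo 0 t) := by
  refine (integrableOn_sub_rpow_neg hθ t).bdd_mul (c := C) hf.aestronglyMeasurable ?_
  exact (ae_restrict_iff' measurableSet_Ioo).2 (.of_forall hC)

/-- The terms `x ^ s / Γ(s + 1)` of the Mittag-Leffler series. -/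
noncomputable def rpowDivGamma (x s : ℝ) : ℝ := x ^ s / Real.Gamma (s + 1)

lemma rpowDivGamma_pos {x s : ℝ} (hx : 0 < x) (hs : 0 ≤ s) : 0 < rpowDivGamma x s :=
  div_pos (Real.rpow_pos_of_pos hx s) (Real.Gamma_pos_of_pos (by linarith))

lemma rpowDivGamma_natCast (x : ℝ) (n : ℕ) : rpowDivGamma x n = x ^ n / n.factorial := by
  rw [rpowDivGamma, Real.rpow_natCast, Real.Gamma_nat_eq_factorial]

lemma integral_rpowDivGamma {θ b t r : ℝ} (hθ : θ < 1) (hb : 0 < b) (ht : 0 < t) (hr : 0 ≤ r) :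
    b * ∫ s in Set.Ioo 0 t, rpowDivGamma ((b * Real.Gamma (1 - θ)) ^ (1 / (1 - θ)) * s) r *
        (t - s) ^ (-θ) =
      rpowDivGamma ((b * Real.Gamma (1 - θ)) ^ (1 / (1 - θ)) * t) (r + (1 - θ)) := by
  have hβ : 0 < 1 - θ := by linarith
  have hΓ := Real.Gamma_pos_of_pos hβ
  set L := b * Real.Gamma (1 - θ) with hL
  have hLpos : 0 < L := mul_pos hb hΓ
  have hc : (0 : ℝ) ≤ L ^ (1 / (1 - θ)) := by positivity
  have hcβ : (L ^ (1 / (1 - θ))) ^ (1 - θ) = L := by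
    rw [← Real.rpow_mul hLpos.le, one_div_mul_cancel hβ.ne', Real.rpow_one]
  have e : ∫ s in Set.Ioo 0 t, rpowDivGamma (L ^ (1 / (1 - θ)) * s) r * (t - s) ^ (-θ) =
      ∫ s in Set.Ioo 0 t, (L ^ (1 / (1 - θ))) ^ r / Real.Gamma (r + 1) *
        (s ^ (r + 1 - 1) * (t - s) ^ (1 - θ - 1)) := by
    refine setIntegral_congr_fun measurableSet_Ioo fun s hs => ?_
    simp only [rpowDivGamma]
    rw [Real.mul_rpow hc hs.1.le, add_sub_cancel_right, show 1 - θ - 1 = -θ by ring]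
    ring
  rw [e, integral_const_mul, integral_rpow_mul_sub_rpow (by linarith) hβ ht, rpowDivGamma,
    Real.mul_rpow hc ht.le, Real.rpow_add (by positivity) r, hcβ,
    show r + 1 + (1 - θ) - 1 = r + (1 - θ) by ring,
    show r + 1 + (1 - θ) = r + (1 - θ) + 1 by ring]
  have h1 := (Real.Gamma_pos_of_pos (show 0 < r + 1 by linarith)).ne'
  have h2 := (Real.Gamma_pos_of_pos (show 0 < r + (1 - θ) + 1 by linarith)).ne'
  rw [hL]
  field_simp

lemma sum_rpowDivGamma_le_of_supersolution {θ b a : ℝ} (hθ : θ < 1) (hb : 0 < b)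
    {I : ℝ → ℝ} (hI_meas : Measurable I) (hI_nonneg : ∀ t > (0 : ℝ), 0 ≤ I t)
    (hI_bdd : ∀ t > (0 : ℝ), ∃ C, ∀ s ∈ Set.Ioo 0 t, |I s| ≤ C)
    (hI_super : ∀ t > (0 : ℝ), a + b * ∫ s in Set.Ioo (0 : ℝ) t, I s * (t - s) ^ (-θ) ≤ I t)
    (N : ℕ) {t : ℝ} (ht : 0 < t) :
    a * ∑ n ∈ Finset.range N,
      rpowDivGamma ((b * Real.Gamma (1 - θ)) ^ (1 / (1 - θ)) * t) (n * (1 - θ)) ≤ I t := by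
  have hβ : 0 < 1 - θ := by linarith
  have hLpos : 0 < b * Real.Gamma (1 - θ) := mul_pos hb (Real.Gamma_pos_of_pos hβ)
  set c := (b * Real.Gamma (1 - θ)) ^ (1 / (1 - θ)) with hc
  have hcpos : 0 < c := Real.rpow_pos_of_pos hLpos _
  induction N generalizing t with
  | zero => simpa using hI_nonneg t ht
  | succ N ih =>
    obtain ⟨C, hC⟩ := hI_bdd t ht
    have hint (n : ℕ) : IntegrableOn
        (fun s => rpowDivGamma (c * s) (n * (1 - θ)) * (t - s) ^ (-θ)) (Set.Ioo 0 t) := by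
      by_contra hn
      have h := integral_rpowDivGamma hθ hb ht (show 0 ≤ (n : ℝ) * (1 - θ) by positivity)
      rw [← hc, integral_undef hn, mul_zero] at h
      exact (rpowDivGamma_pos (mul_pos hcpos ht) (by positivity)).ne h
    have hmono : ∫ s in Set.Ioo 0 t,
        (a * ∑ n ∈ Finset.range N, rpowDivGamma (c * s) (n * (1 - θ))) * (t - s) ^ (-θ) ≤
        ∫ s in Set.Ioo 0 t, I s * (t - s) ^ (-θ) := by
      refine setIntegral_mono_on ?_ (integrableOn_mul_sub_rpow_neg hθ hI_meas hC)
        measurableSet_Ioo fun s hs => ?_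
      · simp only [mul_assoc, Finset.sum_mul]
        exact (integrable_finsetSum _ fun n _ => hint n).const_mul a
      · exact mul_le_mul_of_nonneg_right (ih hs.1) (Real.rpow_nonneg (sub_nonneg.2 hs.2.le) _)
    simp only [mul_assoc, Finset.sum_mul] at hmono
    rw [integral_const_mul, integral_finsetSum _ fun n _ => hint n] at hmono
    have hzero : rpowDivGamma (c * t) 0 = 1 := by simp [rpowDivGamma]
    have hsum : b * ∑ n ∈ Finset.range N,
        ∫ s in Set.Ioo 0 t, rpowDivGamma (c * s) (n * (1 - θ)) * (t - s) ^ (-θ) =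
        ∑ n ∈ Finset.range N, rpowDivGamma (c * t) ((n + 1 : ℕ) * (1 - θ)) := by
      rw [Finset.mul_sum]
      refine Finset.sum_congr rfl fun n _ => ?_
      rw [integral_rpowDivGamma hθ hb ht (by positivity)]
      congr 1
      push_cast
      ring
    rw [Finset.sum_range_succ', ← hsum, Nat.cast_zero, zero_mul, hzero]
    have := mul_le_mul_of_nonneg_left hmono hb.le
    linarith [hI_super t ht]

/-- The distance between left Riemann sums and the integral is controlled by the mesh times the
total variation. -/
lemma abs_integral_sub_riemannSum_le {f V : ℝ → ℝ} {R h : ℝ} (hf : ContinuousOn f (Set.Icc 0 R))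
    (hV : ∀ p ∈ Set.Icc 0 R, ∀ q ∈ Set.Icc 0 R, p ≤ q → |f q - f p| ≤ V q - V p)
    (hh : 0 ≤ h) (N : ℕ) (hN : N * h ≤ R) :
    |(∫ s in (0 : ℝ)..(N * h), f s) - h * ∑ n ∈ Finset.range N, f (n * h)| ≤
      h * (V (N * h) - V 0) := by
  induction N with
  | zero => simp
  | succ N ih =>
    push_cast at hN ⊢
    have h0 : 0 ≤ (N : ℝ) * h := by positivity
    have hle : (N : ℝ) * h ≤ (N + 1) * h := by nlinarith
    have hmem : (N : ℝ) * h ∈ Set.Icc 0 R := ⟨h0, hle.trans hN⟩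
    have hmem' : ((N : ℝ) + 1) * h ∈ Set.Icc 0 R := ⟨h0.trans hle, hN⟩
    have hint {p q : ℝ} (hp : p ∈ Set.Icc 0 R) (hq : q ∈ Set.Icc 0 R) :
        IntervalIntegrable f volume p q :=
      (hf.mono (Set.uIcc_subset_Icc hp hq)).intervalIntegrable
    have hstep : |∫ s in (N * h)..((N + 1) * h), (f s - f (N * h))| ≤
        (V ((N + 1) * h) - V (N * h)) * |(N + 1) * h - N * h| := by
      rw [← Real.norm_eq_abs]
      refine intervalIntegral.norm_integral_le_of_norm_le_const fun s hs => ?_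
      rw [Set.uIoc_of_le hle] at hs
      have hs' : s ∈ Set.Icc 0 R := ⟨h0.trans hs.1.le, hs.2.trans hN⟩
      have h1 := hV _ hmem s hs' hs.1.le
      have h2 := (abs_nonneg _).trans (hV s hs' _ hmem' hs.2)
      rw [Real.norm_eq_abs]
      linarith
    rw [intervalIntegral.integral_sub (hint hmem hmem') intervalIntegrable_const,
      intervalIntegral.integral_const, smul_eq_mul, show ((N : ℝ) + 1) * h - N * h = h by ring,
      abs_of_nonneg hh] at hstep
    rw [Finset.sum_range_succ, ← intervalIntegral.integral_add_adjacent_intervals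
      (hint ⟨le_rfl, h0.trans hmem.2⟩ hmem) (hint hmem hmem')]
    have ih' := ih hmem.2
    rw [abs_le] at *
    constructor <;> nlinarith

/-- A continuous quasiconcave function increases up to some point and decreases afterwards, so its
variation is controlled by its supremum. -/
lemma exists_variation_of_quasiconcaveOn {f : ℝ → ℝ} {R M : ℝ} (hR : 0 ≤ R)
    (hf : ContinuousOn f (Set.Icc 0 R)) (hq : QuasiconcaveOn ℝ (Set.Icc 0 R) f)
    (hf0 : ∀ s ∈ Set.Icc 0 R, 0 ≤ f s) (hM : ∀ s ∈ Set.Icc 0 R, f s ≤ M) :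
    ∃ V : ℝ → ℝ, (∀ p ∈ Set.Icc 0 R, 0 ≤ V p ∧ V p ≤ 2 * M) ∧
      ∀ p ∈ Set.Icc 0 R, ∀ q ∈ Set.Icc 0 R, p ≤ q → |f q - f p| ≤ V q - V p := by
  obtain ⟨m, hm, hmax⟩ := isCompact_Icc.exists_isMaxOn (Set.nonempty_Icc.2 hR) hf
  have hmax' : ∀ s ∈ Set.Icc 0 R, f s ≤ f m := hmax
  have hmono : ∀ p ∈ Set.Icc 0 R, ∀ q ∈ Set.Icc 0 R, p ≤ q → q ≤ m → f p ≤ f q :=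
    fun p hp q _ hpq hqm =>
      ((hq (f p)).ordConnected.out ⟨hp, le_rfl⟩ ⟨hm, hmax' p hp⟩ ⟨hpq, hqm⟩).2
  have hanti : ∀ p ∈ Set.Icc 0 R, ∀ q ∈ Set.Icc 0 R, p ≤ q → m ≤ p → f q ≤ f p :=
    fun p _ q hq' hpq hmp =>
      ((hq (f q)).ordConnected.out ⟨hm, hmax' q hq'⟩ ⟨hq', le_rfl⟩ ⟨hmp, hpq⟩).2
  refine ⟨fun s => if s ≤ m then f s else 2 * f m - f s, fun p hp => ?_, fun p hp q hq' hpq => ?_⟩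
  · have h1 := hf0 p hp
    have h2 := hM m hm
    have h3 := hmax' p hp
    dsimp only
    split_ifs <;> constructor <;> linarith
  · have h1 := hmax' p hp
    have h2 := hmax' q hq'
    dsimp only
    rw [abs_le]
    split_ifs with hqm hpm hpm
    · have := hmono p hp q hq' hpq hqm
      constructor <;> linarith
    · exact absurd (hpq.trans hqm) hpm
    · constructor <;> linarith
    · have := hanti p hp q hq' hpq (not_le.1 hpm).le
      constructor <;> linarith

/-- Riemann sums of a quasiconcave function with mesh `1` and with a finer mesh `h` differ by at most
a multiple of its supremum. -/
lemma sum_natCast_sub_le_mul_sum_of_quasiconcaveOn {f : ℝ → ℝ} {M h : ℝ}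
    (hf : ContinuousOn f (Set.Ici 0)) (hq : QuasiconcaveOn ℝ (Set.Ici 0) f)
    (hf0 : ∀ s, 0 ≤ s → 0 ≤ f s) (hM : ∀ s, 0 ≤ s → f s ≤ M) (hh : 0 < h) (hh1 : h ≤ 1) (N : ℕ) :
    ∃ K : ℕ, ∑ n ∈ Finset.range N, f n - 4 * M ≤ h * ∑ n ∈ Finset.range K, f (n * h) := by
  set K := ⌈(N : ℝ) / h⌉₊
  have hNK : (N : ℝ) ≤ K * h := (div_le_iff₀ hh).1 (Nat.le_ceil _)
  have hR : 0 ≤ (K : ℝ) * h := by positivity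
  have hsub : Set.Icc 0 ((K : ℝ) * h) ⊆ Set.Ici 0 := Set.Icc_subset_Ici_self
  have hfR := hf.mono hsub
  have hqR := (convex_Icc 0 ((K : ℝ) * h)).quasiconcaveOn_restrict hq hsub
  obtain ⟨V, hV, hfV⟩ := exists_variation_of_quasiconcaveOn hR hfR hqR
    (fun s hs => hf0 s hs.1) (fun s hs => hM s hs.1)
  have h1 := abs_integral_sub_riemannSum_le hfR hfV zero_le_one N (by simpa using hNK)
  have h2 := abs_integral_sub_riemannSum_le hfR hfV hh.le K le_rfl
  simp only [mul_one, one_mul] at h1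
  have hmono : ∫ s in (0 : ℝ)..N, f s ≤ ∫ s in (0 : ℝ)..(K * h), f s := by
    refine intervalIntegral.integral_mono_interval le_rfl (Nat.cast_nonneg N) hNK ?_ ?_
    · exact (ae_restrict_iff' measurableSet_Ioc).2 (.of_forall fun s hs => hf0 s hs.1.le)
    · exact (hfR.mono (Set.uIcc_subset_Icc ⟨le_rfl, hR⟩ ⟨hR, le_rfl⟩)).intervalIntegrable
  have v0 := hV 0 ⟨le_rfl, hR⟩
  have vN := hV N ⟨Nat.cast_nonneg N, hNK⟩
  have vK := hV (K * h) ⟨hR, le_rfl⟩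
  have hprod : h * (V (K * h) - V 0) ≤ 2 * M := by nlinarith
  exact ⟨K, by linarith [(abs_le.1 h1).1, (abs_le.1 h2).2]⟩

lemma continuousOn_rpowDivGamma {x : ℝ} (hx : 0 < x) :
    ContinuousOn (rpowDivGamma x) (Set.Ici 0) := by
  intro s hs
  have hs1 : (0 : ℝ) < s + 1 := by linarith [Set.mem_Ici.1 hs]
  have hne (m : ℕ) : s + 1 ≠ -m := fun h => by linarith [m.cast_nonneg (α := ℝ)]
  have hΓ : ContinuousAt (fun s : ℝ => Real.Gamma (s + 1)) s :=
    (Real.differentiableAt_Gamma hne).continuousAt.comp (f := fun s : ℝ => s + 1)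
      (by fun_prop)
  exact ((Real.continuous_const_rpow hx.ne').continuousAt.div hΓ
    (Real.Gamma_pos_of_pos hs1).ne').continuousWithinAt

lemma concaveOn_log_rpowDivGamma {x : ℝ} (hx : 0 < x) :
    ConcaveOn ℝ (Set.Ici 0) fun s => Real.log (rpowDivGamma x s) := by
  refine ⟨convex_Ici 0, fun p hp q hq u v hu hv huv => ?_⟩
  rw [Set.mem_Ici] at hp hq
  have hlog {s : ℝ} (hs : 0 ≤ s) :
      Real.log (rpowDivGamma x s) = s * Real.log x - Real.log (Real.Gamma (s + 1)) := by
    rw [rpowDivGamma, Real.log_div (Real.rpow_pos_of_pos hx s).ne'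
      (Real.Gamma_pos_of_pos (by linarith)).ne', Real.log_rpow hx]
  have h := Real.convexOn_log_Gamma.2 (x := p + 1) (y := q + 1)
    (Set.mem_Ioi.2 (by linarith)) (Set.mem_Ioi.2 (by linarith)) hu hv huv
  simp only [Function.comp_apply, smul_eq_mul] at h ⊢
  rw [show u * (p + 1) + v * (q + 1) = u * p + v * q + 1 by linear_combination huv] at h
  rw [hlog hp, hlog hq, hlog (by positivity)]
  linarith

lemma quasiconcaveOn_rpowDivGamma {x : ℝ} (hx : 0 < x) :
    QuasiconcaveOn ℝ (Set.Ici 0) (rpowDivGamma x) := by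
  have h := (concaveOn_log_rpowDivGamma hx).quasiconcaveOn.monotone_comp Real.exp_monotone
  have heq : Set.EqOn (Real.exp ∘ fun s => Real.log (rpowDivGamma x s)) (rpowDivGamma x)
      (Set.Ici 0) := fun s hs => Real.exp_log (rpowDivGamma_pos hx hs)
  intro r
  have hset : {s ∈ Set.Ici 0 | r ≤ rpowDivGamma x s} =
      {s ∈ Set.Ici 0 | r ≤ (Real.exp ∘ fun s => Real.log (rpowDivGamma x s)) s} := by
    ext s
    exact and_congr_right fun hs => by rw [heq hs]
  rw [hset]
  exact h r

lemma rpowDivGamma_le_of_natCast {x M s : ℝ} (hx : 0 < x) (hs : 0 ≤ s)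
    (hM : ∀ n : ℕ, rpowDivGamma x n ≤ M) : rpowDivGamma x s ≤ 3 * M := by
  set n := ⌊s⌋₊
  have hn : (n : ℝ) ≤ s := Nat.floor_le hs
  have hn' : s ≤ n + 1 := (Nat.lt_floor_add_one s).le
  have hn0 : (0 : ℝ) ≤ n := Nat.cast_nonneg n
  have hpos := rpowDivGamma_pos hx hs
  have h1 := hM n
  have h2 := hM (n + 1)
  have p1 := rpowDivGamma_pos hx (Nat.cast_nonneg n)
  have p2 := rpowDivGamma_pos hx (Nat.cast_nonneg (n + 1))
  have hrec (r : ℝ) (hr : 0 ≤ r) : rpowDivGamma x (r + 1) * (r + 1) = rpowDivGamma x r * x := by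
    have := (Real.Gamma_pos_of_pos (show 0 < r + 1 by linarith)).ne'
    rw [rpowDivGamma, rpowDivGamma, Real.Gamma_add_one (by positivity), Real.rpow_add_one hx.ne']
    field_simp
  by_cases hle : rpowDivGamma x s ≤ rpowDivGamma x (n + 1 : ℕ)
  · linarith
  rw [not_le] at hle
  have hsn : s < n + 1 := lt_of_le_of_ne hn' fun h => by
    rw [h] at hle
    push_cast at hle
    exact lt_irrefl _ hle
  have hlt := Real.log_lt_log p2 hle
  push_cast at hlt p2 h2 hle
  have hslope := (concaveOn_log_rpowDivGamma hx).slope_anti_adjacent (x := s) (y := n + 1)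
    (z := n + 1 + 1) hs (Set.mem_Ici.2 (by positivity)) hsn (by linarith)
  have p3 := rpowDivGamma_pos hx (show (0 : ℝ) ≤ n + 1 + 1 by positivity)
  rw [show (n : ℝ) + 1 + 1 - (n + 1) = 1 by ring, div_one, le_div_iff₀ (by linarith)] at hslope
  have hlog : Real.log (rpowDivGamma x s) + Real.log (rpowDivGamma x (n + 1 + 1)) ≤
      Real.log (rpowDivGamma x (n + 1)) + Real.log (rpowDivGamma x (n + 1)) := by
    nlinarith
  rw [← Real.log_mul hpos.ne' p3.ne', ← Real.log_mul p2.ne' p2.ne',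
    Real.log_le_log_iff (by positivity) (by positivity)] at hlog
  have r1 := hrec n hn0
  have r2 := hrec (n + 1) (by positivity)
  have h3 : rpowDivGamma x s * x ≤ rpowDivGamma x (n + 1) * (n + 1 + 1) := by
    refine le_of_mul_le_mul_right ?_ p2
    calc rpowDivGamma x s * x * rpowDivGamma x (n + 1)
        = rpowDivGamma x s * rpowDivGamma x (n + 1 + 1) * (n + 1 + 1) := by
          linear_combination - rpowDivGamma x s * r2
      _ ≤ rpowDivGamma x (n + 1) * rpowDivGamma x (n + 1) * (n + 1 + 1) := by gcongr
      _ = _ := by ring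
  have h4 : rpowDivGamma x s * x ≤ 2 * rpowDivGamma x n * x := by nlinarith
  linarith [le_of_mul_le_mul_right h4 hx]

/-- The Poisson weights of mean `x` tend to zero uniformly as `x → ∞`. -/
lemma eventually_forall_rpowDivGamma_natCast_le {ε : ℝ} (hε : 0 < ε) :
    ∀ᶠ x : ℝ in atTop, ∀ n : ℕ, rpowDivGamma x n ≤ ε * Real.exp x := by
  have hlim : Tendsto (fun n : ℕ => (√(2 * Real.pi * n))⁻¹) atTop (nhds 0) :=
    tendsto_inv_atTop_zero.comp (Real.tendsto_sqrt_atTop.comp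
      (tendsto_natCast_atTop_atTop.const_mul_atTop (by positivity)))
  obtain ⟨N, hN⟩ := eventually_atTop.1
    ((hlim.eventually_le_const hε).and (eventually_ge_atTop 1))
  have hsmall : ∀ᶠ x : ℝ in atTop, ∀ n ∈ Finset.range N, x ^ n * Real.exp (-x) ≤ ε :=
    (eventually_all_finset _).2 fun n _ =>
      (Real.tendsto_pow_mul_exp_neg_atTop_nhds_zero n).eventually_le_const hε
  filter_upwards [hsmall, eventually_gt_atTop 0] with x hx hx0 n
  rw [rpowDivGamma_natCast, div_le_iff₀ (by positivity)]
  have hfac : (1 : ℝ) ≤ n.factorial := by exact_mod_cast n.factorial_pos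
  by_cases hn : n < N
  · have h := hx n (Finset.mem_range.2 hn)
    rw [Real.exp_neg, ← div_eq_mul_inv, div_le_iff₀ (Real.exp_pos x)] at h
    exact h.trans (le_mul_of_one_le_right (by positivity) hfac)
  · obtain ⟨h1, h2⟩ := hN n (not_lt.1 hn)
    have hn0 : (0 : ℝ) < n := by exact_mod_cast h2
    have hsqrt : 0 < √(2 * Real.pi * n) := by positivity
    have hpow : x ^ n ≤ (n / Real.exp 1) ^ n * Real.exp x := by
      have h3 : x ≤ n / Real.exp 1 * Real.exp (x / n) := by
        have h4 := Real.add_one_le_exp (x / n - 1)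
        rw [sub_add_cancel, Real.exp_sub, div_le_iff₀ hn0] at h4
        exact h4.trans_eq (by ring)
      calc x ^ n ≤ (n / Real.exp 1 * Real.exp (x / n)) ^ n := by gcongr
        _ = _ := by rw [mul_pow, ← Real.exp_nat_mul, mul_div_cancel₀ _ hn0.ne']
    have h5 : 1 ≤ ε * √(2 * Real.pi * n) := (inv_le_iff_one_le_mul₀ hsqrt).1 h1
    calc x ^ n ≤ 1 * ((n / Real.exp 1) ^ n * Real.exp x) := by rwa [one_mul]
      _ ≤ ε * √(2 * Real.pi * n) * ((n / Real.exp 1) ^ n * Real.exp x) := by gcongr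
      _ = ε * Real.exp x * (√(2 * Real.pi * n) * (n / Real.exp 1) ^ n) := by ring
      _ ≤ ε * Real.exp x * n.factorial := by
        gcongr
        exact Stirling.le_factorial_stirling n

lemma eventually_exists_mul_exp_le_sum_rpowDivGamma {h r : ℝ} (hh : 0 < h) (hh1 : h ≤ 1)
    (hr : r * h < 1) :
    ∀ᶠ x : ℝ in atTop,
      ∃ K : ℕ, r * Real.exp x ≤ ∑ n ∈ Finset.range K, rpowDivGamma x (n * h) := by
  set ε := (1 - r * h) / 13 with hε
  have hε0 : 0 < ε := by positivity [sub_pos.2 hr]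
  filter_upwards [eventually_forall_rpowDivGamma_natCast_le hε0, eventually_gt_atTop 0]
    with x hx hx0
  have hsum : Tendsto (fun N : ℕ => ∑ n ∈ Finset.range N, rpowDivGamma x n) atTop
      (nhds (Real.exp x)) := by
    simp only [rpowDivGamma_natCast]
    rw [Real.exp_eq_exp_ℝ]
    exact (NormedSpace.expSeries_div_hasSum_exp x).tendsto_sum_nat
  have hexp := Real.exp_pos x
  obtain ⟨N, hN⟩ := (hsum.eventually_const_le
    (show (1 - ε) * Real.exp x < Real.exp x by nlinarith)).exists
  obtain ⟨K, hK⟩ := sum_natCast_sub_le_mul_sum_of_quasiconcaveOn (continuousOn_rpowDivGamma hx0)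
    (quasiconcaveOn_rpowDivGamma hx0) (fun s hs => (rpowDivGamma_pos hx0 hs).le)
    (fun s hs => rpowDivGamma_le_of_natCast hx0 hs hx) hh hh1 N
  refine ⟨K, le_of_mul_le_mul_left ?_ hh⟩
  have hrε : h * r = 1 - 13 * ε := by rw [hε]; ring
  rw [← mul_assoc, hrε]
  linarith

lemma eventually_le_exp_neg_mul_of_supersolution {θ b a r : ℝ} (hθ : θ ∈ Set.Ioo (0 : ℝ) 1)
    (hb : 0 < b) (ha : 0 < a) {I : ℝ → ℝ} (hI_meas : Measurable I)
    (hI_nonneg : ∀ t > (0 : ℝ), 0 ≤ I t)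
    (hI_bdd : ∀ t > (0 : ℝ), ∃ C, ∀ s ∈ Set.Ioo 0 t, |I s| ≤ C)
    (hI_super : ∀ t > (0 : ℝ), a + b * ∫ s in Set.Ioo (0 : ℝ) t, I s * (t - s) ^ (-θ) ≤ I t)
    (hr : r < a / (1 - θ)) :
    ∀ᶠ t : ℝ in atTop,
      r ≤ Real.exp (-((b * Real.Gamma (1 - θ)) ^ (1 / (1 - θ)) * t)) * I t := by
  have hβ : 0 < 1 - θ := by linarith [hθ.2]
  have hc : 0 < (b * Real.Gamma (1 - θ)) ^ (1 / (1 - θ)) :=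
    Real.rpow_pos_of_pos (mul_pos hb (Real.Gamma_pos_of_pos hβ)) _
  have hr' : r / a * (1 - θ) < 1 := by
    rw [div_mul_eq_mul_div, div_lt_one ha]
    exact (lt_div_iff₀ hβ).1 hr
  filter_upwards [(tendsto_id.const_mul_atTop hc).eventually
    (eventually_exists_mul_exp_le_sum_rpowDivGamma hβ (by linarith [hθ.1]) hr'),
    eventually_gt_atTop 0] with t ⟨K, hK⟩ ht
  have h := sum_rpowDivGamma_le_of_supersolution hθ.2 hb hI_meas hI_nonneg hI_bdd hI_super K ht
  have h' := (mul_le_mul_of_nonneg_left hK ha.le).trans h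
  rw [← mul_assoc, mul_div_cancel₀ _ ha.ne'] at h'
  rw [Real.exp_neg, ← div_eq_inv_mul, le_div_iff₀ (Real.exp_pos _)]
  exact h'

lemma EReal.coe_le_liminf_of_forall_lt {f : ℝ → ℝ} {x : ℝ}
    (h : ∀ r < x, ∀ᶠ t in atTop, r ≤ f t) :
    (x : EReal) ≤ liminf (fun t => (f t : EReal)) atTop := by
  refine EReal.ge_of_forall_gt_iff_ge.1 fun r hr => ?_
  refine le_liminf_of_le (by isBoundedDefault) ?_
  filter_upwards [h r (EReal.coe_lt_coe_iff.1 hr)] with t ht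
  exact EReal.coe_le_coe_iff.2 ht

/-- Renewal-theoretic lower bound: if `I(t) ≥ a + b ∫₀ᵗ I(s)(t-s)^{-θ} ds` and `I`
has at most exponential growth, then `liminf_{t→∞} e^{-ct} I(t) ≥ a/(1-θ)` and
`liminf_{t→∞} (1/t) log I(t) ≥ c`, where `c = (b Γ(1-θ))^{1/(1-θ)}`. -/
theorem renewal_supersolution_exponential_growth
    (θ b a : ℝ) (hθ : θ ∈ Set.Ioo (0 : ℝ) 1) (hb : 0 < b) (ha : 0 < a)
    (I : ℝ → ℝ) (hI_meas : Measurable I)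
    (hI_nonneg : ∀ t > (0 : ℝ), 0 ≤ I t)
    (hI_growth : ∃ γ > (0 : ℝ), ∃ K : ℝ,
      ∀ t > (0 : ℝ), Real.exp (-(γ * t)) * I t ≤ K)
    (hI_super : ∀ t > (0 : ℝ),
      a + b * ∫ s in Set.Ioo (0 : ℝ) t, I s * (t - s) ^ (-θ) ≤ I t) :
    ((a / (1 - θ) : ℝ) : EReal) ≤
      liminf
        (fun t : ℝ =>
          ((Real.exp (-((b * Real.Gamma (1 - θ)) ^ (1 / (1 - θ)) * t)) * I t : ℝ) :
            EReal)) atTop ∧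
    (((b * Real.Gamma (1 - θ)) ^ (1 / (1 - θ)) : ℝ) : EReal) ≤
      liminf (fun t : ℝ => ((Real.log (I t) / t : ℝ) : EReal)) atTop := by
  obtain ⟨γ, hγ, C, hC⟩ := hI_growth
  have hI_bdd : ∀ t > (0 : ℝ), ∃ C, ∀ s ∈ Set.Ioo 0 t, |I s| ≤ C := by
    refine fun t _ => ⟨C * Real.exp (γ * t), fun s hs => ?_⟩
    have h0 := hI_nonneg s hs.1
    have h := hC s hs.1
    have hC0 : 0 ≤ C := (mul_nonneg (Real.exp_pos _).le h0).trans h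
    rw [Real.exp_neg, ← div_eq_inv_mul, div_le_iff₀ (Real.exp_pos _)] at h
    rw [abs_of_nonneg h0]
    refine h.trans (mul_le_mul_of_nonneg_left (Real.exp_le_exp.2 ?_) hC0)
    exact mul_le_mul_of_nonneg_left hs.2.le hγ.le
  have hev {r : ℝ} (hr : r < a / (1 - θ)) :=
    eventually_le_exp_neg_mul_of_supersolution hθ hb ha hI_meas hI_nonneg hI_bdd hI_super hr
  refine ⟨EReal.coe_le_liminf_of_forall_lt fun r hr => hev hr,
    EReal.coe_le_liminf_of_forall_lt fun r hr => ?_⟩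
  set c := (b * Real.Gamma (1 - θ)) ^ (1 / (1 - θ))
  have hpos : 0 < a / (1 - θ) := div_pos ha (by linarith [hθ.2])
  filter_upwards [hev (half_lt_self hpos), eventually_gt_atTop 0,
    (tendsto_id.const_mul_atTop (sub_pos.2 hr)).eventually_ge_atTop
      (-Real.log (a / (1 - θ) / 2))] with t ht ht0 hlog
  rw [Real.exp_neg, ← div_eq_inv_mul, le_div_iff₀ (Real.exp_pos _)] at ht
  have h := Real.log_le_log (by positivity) ht
  rw [Real.log_mul (by positivity) (Real.exp_pos _).ne', Real.log_exp] at h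
  rw [le_div_iff₀ ht0]
  simp only [id] at hlog
  linarith
end

section
/- Let β ∈ (0,1] and a ≥ 0, and let λ > 0 satisfy λ^β > a. Then t ↦ e^{-λt} E_β(-a t^β) is Lebesgue integrable on (0,∞) and ∫₀^∞ e^{-λt} E_β(-a t^β) dt = λ^{β-1}/(λ^β + a). -/
open MeasureTheory

/-- The Mittag-Leffler function `E_β(x) = ∑_{k=0}^∞ x^k / Γ(1 + βk)`. -/
noncomputable def mittagLeffler (β x : ℝ) : ℝ :=
  ∑' k : ℕ, x ^ k / Real.Gamma (1 + β * k)

/-- The integral `∫₀^∞ e^{-λt} (c t^β)^k / Γ(1 + βk) dt` converges. -/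
lemma integrableOn_exp_mul_mittagLeffler_term {β lam : ℝ} (hβ : 0 ≤ β) (hlam : 0 < lam)
    (c : ℝ) (k : ℕ) :
    IntegrableOn
      (fun t : ℝ => Real.exp (-(lam * t)) * ((c * t ^ β) ^ k / Real.Gamma (1 + β * k)))
      (Set.Ioi (0 : ℝ)) := by
  have hk : 0 ≤ β * k := by positivity
  have h := (integrableOn_rpow_mul_exp_neg_mul_rpow (p := 1) (by linarith : -1 < β * k)
    one_pos hlam).const_mul (c ^ k / Real.Gamma (1 + β * k))
  refine IntegrableOn.congr_fun h (fun t ht => ?_) measurableSet_Ioi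
  simp only [Real.rpow_one, mul_pow, Real.rpow_mul_natCast (le_of_lt ht), neg_mul]
  ring

/-- The Laplace transform of a term of the Mittag-Leffler series is a geometric term. -/
lemma integral_exp_mul_mittagLeffler_term {β lam : ℝ} (hβ : 0 ≤ β) (hlam : 0 < lam)
    (c : ℝ) (k : ℕ) :
    ∫ t in Set.Ioi (0 : ℝ),
        Real.exp (-(lam * t)) * ((c * t ^ β) ^ k / Real.Gamma (1 + β * k))
      = lam⁻¹ * (c / lam ^ β) ^ k := by
  have hk : 0 < 1 + β * k := by positivity
  have hG := (Real.Gamma_pos_of_pos hk).ne'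
  have h : ∀ t ∈ Set.Ioi (0 : ℝ),
      Real.exp (-(lam * t)) * ((c * t ^ β) ^ k / Real.Gamma (1 + β * k))
        = c ^ k / Real.Gamma (1 + β * k) *
          (t ^ (1 + β * k - 1) * Real.exp (-(lam * t))) := fun t ht => by
    rw [add_sub_cancel_left, Real.rpow_mul_natCast (le_of_lt ht), mul_pow]
    ring
  rw [setIntegral_congr_fun measurableSet_Ioi h, integral_const_mul,
    Real.integral_rpow_mul_exp_neg_mul_Ioi hk hlam, one_div, Real.inv_rpow hlam.le,
    Real.rpow_add hlam, Real.rpow_one, Real.rpow_mul_natCast hlam.le, div_pow]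
  field_simp

/-- Laplace transform of `t ↦ E_β(-a t^β)`:
for `λ > 0` with `λ^β > a`, it is integrable on `(0,∞)` and
`∫₀^∞ e^{-λt} E_β(-a t^β) dt = λ^{β-1}/(λ^β + a)`. -/
theorem laplace_transform_mittagLeffler
    (β : ℝ) (hβ : β ∈ Set.Ioc (0 : ℝ) 1) (a : ℝ) (ha : 0 ≤ a)
    (lam : ℝ) (hlam : 0 < lam) (hgt : a < lam ^ β) :
    IntegrableOn
      (fun t : ℝ => Real.exp (-(lam * t)) * mittagLeffler β (-(a * t ^ β)))
      (Set.Ioi (0 : ℝ)) ∧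
    ∫ t in Set.Ioi (0 : ℝ),
        Real.exp (-(lam * t)) * mittagLeffler β (-(a * t ^ β))
      = lam ^ (β - 1) / (lam ^ β + a) := by
  have hβ0 := hβ.1.le
  have hL : 0 < lam ^ β := Real.rpow_pos_of_pos hlam β
  have hnorm : ∀ k : ℕ, ∫ t in Set.Ioi (0 : ℝ),
      ‖Real.exp (-(lam * t)) * ((-a * t ^ β) ^ k / Real.Gamma (1 + β * k))‖
        = lam⁻¹ * (a / lam ^ β) ^ k := fun k => by
    rw [← integral_exp_mul_mittagLeffler_term hβ0 hlam]
    refine setIntegral_congr_fun measurableSet_Ioi fun t ht => ?_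
    have hG : 0 < Real.Gamma (1 + β * k) := Real.Gamma_pos_of_pos (by positivity)
    have ht' : 0 ≤ t ^ β := Real.rpow_nonneg (le_of_lt ht) β
    simp only [norm_mul, norm_div, norm_pow, norm_neg, Real.norm_eq_abs, Real.abs_exp,
      abs_of_pos hG, abs_of_nonneg ha, abs_of_nonneg ht']
  have hlt : a / lam ^ β < 1 := (div_lt_one hL).2 hgt
  have hsum := hasSum_integral_of_summable_integral_norm
    (fun k => integrableOn_exp_mul_mittagLeffler_term hβ0 hlam (-a) k)
    (by
      simp only [hnorm]
      exact (summable_geometric_of_lt_one (by positivity) hlt).mul_left _)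
  simp only [integral_exp_mul_mittagLeffler_term hβ0 hlam, tsum_mul_left] at hsum
  have hgeom : HasSum (fun k : ℕ => lam⁻¹ * (-a / lam ^ β) ^ k)
      (lam⁻¹ * (1 - -a / lam ^ β)⁻¹) := by
    refine (hasSum_geometric_of_abs_lt_one ?_).mul_left _
    rwa [neg_div, abs_neg, abs_of_nonneg (by positivity)]
  have hint : ∫ t in Set.Ioi (0 : ℝ),
      Real.exp (-(lam * t)) * mittagLeffler β (-(a * t ^ β))
        = lam ^ (β - 1) / (lam ^ β + a) := by
    simp only [mittagLeffler, ← neg_mul]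
    simp only [neg_mul lam] at hsum ⊢
    rw [hsum.unique hgeom, Real.rpow_sub_one hlam.ne', neg_div, sub_neg_eq_add,
      one_add_div hL.ne']
    field_simp
  refine ⟨not_imp_comm.1 integral_undef ?_, hint⟩
  rw [hint]
  have := Real.rpow_pos_of_pos hlam (β - 1)
  positivity
end

section
/- Let β ∈ (0,1) and p > 0, and suppose that the Mittag-Leffler function satisfies the two-sided bound 1/(1 + Γ(1-β) x) ≤ E_β(-x) ≤ 1/(1 + Γ(1+β)^{-1} x) for all x > 0 (in particular E_β(-x) ≥ 0). Then ∫₀^∞ z^{p-1} (E_β(-z))² dz < ∞ if and only if p < 2; moreover, when p < 2, ∫₀^∞ z^{p-1} (E_β(-z))² dz ≤ Γ(1+β)^p · B(p, 2-p), where B denotes the Beta function. -/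
open MeasureTheory

/-- The Beta function `B(x,y) = Γ(x)Γ(y)/Γ(x+y)`. -/
noncomputable def betaFn (x y : ℝ) : ℝ :=
  Real.Gamma x * Real.Gamma y / Real.Gamma (x + y)

/-- The Gamma integral `∫₀^∞ t^{s-1} e^{-rt} dt = r^{-s} Γ(s)` as a Lebesgue integral. -/
theorem lintegral_rpow_mul_exp_neg_mul_Ioi {s r : ℝ} (hs : 0 < s) (hr : 0 < r) :
    ∫⁻ t in Set.Ioi (0 : ℝ), ENNReal.ofReal (t ^ (s - 1) * Real.exp (-(r * t))) =
      ENNReal.ofReal ((1 / r) ^ s * Real.Gamma s) := by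
  have h := Real.integral_rpow_mul_exp_neg_mul_Ioi hs hr
  have hpos : 0 < (1 / r) ^ s * Real.Gamma s := by
    have := Real.Gamma_pos_of_pos hs
    positivity
  have hint : IntegrableOn (fun t : ℝ => t ^ (s - 1) * Real.exp (-(r * t))) (Set.Ioi 0) := by
    by_contra hn
    rw [integral_undef hn] at h
    exact hpos.ne h
  rw [← h, ofReal_integral_eq_lintegral_ofReal hint]
  filter_upwards [ae_restrict_mem measurableSet_Ioi] with t ht
  have : (0 : ℝ) < t := ht
  positivity

/-- A scaled Beta integral of the second kind. -/
theorem lintegral_rpow_mul_one_div_one_add_mul_sq {a p : ℝ} (ha : 0 < a) (hp : 0 < p)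
    (hp2 : p < 2) :
    ∫⁻ z in Set.Ioi (0 : ℝ), ENNReal.ofReal (z ^ (p - 1) * (1 / (1 + a * z)) ^ 2) =
      ENNReal.ofReal ((1 / a) ^ p * betaFn p (2 - p)) := by
  have hΓ := Real.Gamma_pos_of_pos hp
  calc
    _ = ∫⁻ z in Set.Ioi (0 : ℝ), ∫⁻ t in Set.Ioi (0 : ℝ),
          ENNReal.ofReal (z ^ (p - 1) * (t * Real.exp (-((1 + a * z) * t)))) := by
      refine setLIntegral_congr_fun measurableSet_Ioi fun z (hz : 0 < z) => ?_
      have h := lintegral_rpow_mul_exp_neg_mul_Ioi (s := 2) (r := 1 + a * z) two_pos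
        (by positivity)
      have hz' : 0 ≤ z ^ (p - 1) := by positivity
      simp only [ENNReal.ofReal_mul hz']
      rw [lintegral_const_mul' _ _ ENNReal.ofReal_ne_top]
      norm_num [Real.Gamma_two] at h ⊢
      rw [h]
    _ = ∫⁻ t in Set.Ioi (0 : ℝ), ∫⁻ z in Set.Ioi (0 : ℝ),
          ENNReal.ofReal (z ^ (p - 1) * (t * Real.exp (-((1 + a * z) * t)))) := by
      refine lintegral_lintegral_swap (Measurable.aemeasurable ?_)
      unfold Function.uncurry
      fun_prop
    _ = ∫⁻ t in Set.Ioi (0 : ℝ), ENNReal.ofReal ((1 / a) ^ p * Real.Gamma p) *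
          ENNReal.ofReal (t ^ ((2 - p) - 1) * Real.exp (-(1 * t))) := by
      refine setLIntegral_congr_fun measurableSet_Ioi fun t (ht : 0 < t) => ?_
      have h := lintegral_rpow_mul_exp_neg_mul_Ioi (s := p) (r := a * t) hp (by positivity)
      have hc : 0 ≤ t * Real.exp (-t) := by positivity
      calc
        _ = ∫⁻ z in Set.Ioi (0 : ℝ), ENNReal.ofReal (t * Real.exp (-t)) *
              ENNReal.ofReal (z ^ (p - 1) * Real.exp (-(a * t * z))) := by
          refine lintegral_congr fun z => ?_
          rw [← ENNReal.ofReal_mul hc,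
            show -((1 + a * z) * t) = -t + -(a * t * z) by ring, Real.exp_add]
          ring_nf
        _ = _ := by
          rw [lintegral_const_mul' _ _ ENNReal.ofReal_ne_top, h, ← ENNReal.ofReal_mul hc,
            ← ENNReal.ofReal_mul (by positivity), show 2 - p - 1 = 1 - p by ring,
            Real.rpow_sub ht, Real.rpow_one, one_mul, Real.div_rpow zero_le_one (by positivity),
            Real.div_rpow zero_le_one ha.le, Real.mul_rpow ha.le ht.le, Real.one_rpow]
          congr 1
          field_simp
    _ = _ := by
      rw [lintegral_const_mul' _ _ ENNReal.ofReal_ne_top,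
        lintegral_rpow_mul_exp_neg_mul_Ioi (by linarith) one_pos,
        ← ENNReal.ofReal_mul (by positivity)]
      simp [betaFn, mul_assoc]

/-- A function dominating a multiple of `z^{-2}` on `(1, ∞)` has infinite `p`-th Mellin integral
for every `p ≥ 2`. -/
theorem lintegral_rpow_mul_eq_top {f : ℝ → ℝ} {p c : ℝ} (hc : 0 < c) (hp : 2 ≤ p)
    (hf : ∀ z > 1, c * z ^ (-2 : ℝ) ≤ f z) :
    ∫⁻ z in Set.Ioi (0 : ℝ), ENNReal.ofReal (z ^ (p - 1) * f z) = ⊤ := by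
  by_contra hfin
  have hle : ∫⁻ z in Set.Ioi (1 : ℝ), ENNReal.ofReal (c * z ^ (p - 3)) ≤
      ∫⁻ z in Set.Ioi (0 : ℝ), ENNReal.ofReal (z ^ (p - 1) * f z) := by
    refine (setLIntegral_mono' measurableSet_Ioi fun z (hz : 1 < z) => ?_).trans
      (lintegral_mono_set (Set.Ioi_subset_Ioi zero_le_one))
    have hz0 : 0 < z := one_pos.trans hz
    refine ENNReal.ofReal_le_ofReal ?_
    calc
      c * z ^ (p - 3) = z ^ (p - 1) * (c * z ^ (-2 : ℝ)) := by
        rw [show p - 3 = p - 1 + -2 by ring, Real.rpow_add hz0]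
        ring
      _ ≤ _ := by gcongr; exact hf z hz
  have hint : IntegrableOn (fun z : ℝ => c * z ^ (p - 3)) (Set.Ioi 1) := by
    refine ⟨by fun_prop, ?_⟩
    rw [hasFiniteIntegral_iff_ofReal]
    · exact hle.trans_lt (lt_top_iff_ne_top.2 hfin)
    · filter_upwards [ae_restrict_mem measurableSet_Ioi] with z hz
      have : (0 : ℝ) < z := one_pos.trans hz
      positivity
  have hint' : IntegrableOn (fun z : ℝ => z ^ (p - 3)) (Set.Ioi 1) := by
    simpa [IntegrableOn, ← mul_assoc, hc.ne'] using hint.const_mul c⁻¹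
  rw [integrableOn_Ioi_rpow_iff one_pos] at hint'
  linarith

/-- Under Simon's two-sided bound on `E_β(-x)`, the integral
`∫₀^∞ z^{p-1} E_β(-z)² dz` is finite iff `p < 2`, and when `p < 2` it is at
most `Γ(1+β)^p B(p, 2-p)`. -/
theorem mittagLeffler_square_integral_finiteness
    (β p : ℝ) (hβ : β ∈ Set.Ioo (0 : ℝ) 1) (hp : 0 < p)
    (hbound : ∀ x > (0 : ℝ),
      1 / (1 + Real.Gamma (1 - β) * x) ≤ mittagLeffler β (-x) ∧
      mittagLeffler β (-x) ≤ 1 / (1 + (Real.Gamma (1 + β))⁻¹ * x)) :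
    ((∫⁻ z in Set.Ioi (0 : ℝ),
        ENNReal.ofReal (z ^ (p - 1) * (mittagLeffler β (-z)) ^ 2)) < ⊤ ↔ p < 2) ∧
    (p < 2 →
      (∫⁻ z in Set.Ioi (0 : ℝ),
          ENNReal.ofReal (z ^ (p - 1) * (mittagLeffler β (-z)) ^ 2))
        ≤ ENNReal.ofReal (Real.Gamma (1 + β) ^ p * betaFn p (2 - p))) := by
  have hΓ : 0 < Real.Gamma (1 + β) := Real.Gamma_pos_of_pos (by linarith [hβ.1])
  have hΓ' : 0 < Real.Gamma (1 - β) := Real.Gamma_pos_of_pos (by linarith [hβ.2])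
  have hnonneg : ∀ z > (0 : ℝ), 0 ≤ mittagLeffler β (-z) := fun z hz =>
    le_trans (by positivity) (hbound z hz).1
  have hupper : p < 2 → (∫⁻ z in Set.Ioi (0 : ℝ),
      ENNReal.ofReal (z ^ (p - 1) * (mittagLeffler β (-z)) ^ 2))
        ≤ ENNReal.ofReal (Real.Gamma (1 + β) ^ p * betaFn p (2 - p)) := fun hp2 => by
    have h := lintegral_rpow_mul_one_div_one_add_mul_sq (inv_pos.2 hΓ) hp hp2
    rw [one_div, inv_inv] at h
    rw [← h]
    refine setLIntegral_mono' measurableSet_Ioi fun z (hz : 0 < z) => ?_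
    refine ENNReal.ofReal_le_ofReal ?_
    have := hnonneg z hz
    gcongr
    exact (hbound z hz).2
  refine ⟨⟨fun hfin => ?_, fun hp2 => (hupper hp2).trans_lt ENNReal.ofReal_lt_top⟩, hupper⟩
  by_contra! hp2
  refine hfin.ne (lintegral_rpow_mul_eq_top
    (c := (1 / (1 + Real.Gamma (1 - β))) ^ 2) (by positivity) hp2 fun z hz => ?_)
  have hz0 : 0 < z := one_pos.trans hz
  have hle : 1 / ((1 + Real.Gamma (1 - β)) * z) ≤ mittagLeffler β (-z) := by
    refine le_trans ?_ (hbound z hz0).1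
    gcongr
    linarith
  calc
    _ = (1 / ((1 + Real.Gamma (1 - β)) * z)) ^ 2 := by
      rw [Real.rpow_neg hz0.le, Real.rpow_two]
      field_simp
    _ ≤ _ := by gcongr
end

section
/- Let β ∈ (0,1) and s > 0. Let (Ω, 𝓕, P) be a probability space and X : Ω → [0,∞) a random variable whose moments satisfy E[X^k] = Γ(1+k) s^{βk} / Γ(1+βk) for every integer k ≥ 0. Then for every w ≥ 0, e^{wX} is integrable and E[e^{wX}] = E_β(w s^β) = ∑_{k=0}^∞ w^k s^{βk} / Γ(1+βk). -/
open MeasureTheory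

/-- Restricting the Gamma integral to `(A, ∞)` bounds `Γ` below by an exponential. -/
lemma rpow_mul_exp_neg_le_Gamma_one_add {A x : ℝ} (hA : 0 < A) (hx : 0 ≤ x) :
    A ^ x * Real.exp (-A) ≤ Real.Gamma (1 + x) := by
  have hpos : 0 < 1 + x := by linarith
  have hconv := Real.GammaIntegral_convergent hpos
  have hsub : Set.Ioi A ⊆ Set.Ioi 0 := Set.Ioi_subset_Ioi hA.le
  rw [Real.Gamma_eq_integral hpos, ← integral_exp_neg_Ioi A, ← integral_const_mul]
  calc ∫ t in Set.Ioi A, A ^ x * Real.exp (-t)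
      ≤ ∫ t in Set.Ioi A, Real.exp (-t) * t ^ (1 + x - 1) := by
        refine setIntegral_mono_on ((integrableOn_exp_neg_Ioi A).const_mul _)
          (hconv.mono_set hsub) measurableSet_Ioi fun t ht => ?_
        rw [mul_comm, add_sub_cancel_left]
        gcongr
        exact (Set.mem_Ioi.mp ht).le
    _ ≤ ∫ t in Set.Ioi 0, Real.exp (-t) * t ^ (1 + x - 1) := by
        refine setIntegral_mono_set hconv ?_ hsub.eventuallyLE
        filter_upwards [ae_restrict_mem measurableSet_Ioi] with t ht
        have : 0 < t := ht
        simp only [Pi.zero_apply]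
        positivity

/-- The Mittag-Leffler series converges at every nonnegative argument. -/
lemma summable_pow_div_Gamma_one_add_mul {β y : ℝ} (hβ : 0 < β) (hy : 0 ≤ y) :
    Summable fun k : ℕ => y ^ k / Real.Gamma (1 + β * k) := by
  have hB : 0 < y + 1 := by linarith
  set A : ℝ := (y + 1) ^ β⁻¹
  have hA : 0 < A := Real.rpow_pos_of_pos hB _
  have hAβ : A ^ β = y + 1 := Real.rpow_inv_rpow hB.le hβ.ne'
  have hgeom : Summable fun k : ℕ => Real.exp A * (y / (y + 1)) ^ k :=
    (summable_geometric_of_lt_one (by positivity)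
      ((div_lt_one hB).mpr (lt_add_one y))).mul_left _
  refine hgeom.of_nonneg_of_le (fun k => ?_) fun k => ?_
  · have := Real.Gamma_pos_of_pos (show 0 < 1 + β * k by positivity)
    positivity
  · have hΓ := rpow_mul_exp_neg_le_Gamma_one_add hA (show 0 ≤ β * k by positivity)
    rw [Real.rpow_mul_natCast hA.le, hAβ] at hΓ
    calc y ^ k / Real.Gamma (1 + β * k)
        ≤ y ^ k / ((y + 1) ^ k * Real.exp (-A)) := by gcongr
      _ = Real.exp A * (y / (y + 1)) ^ k := by
        rw [Real.exp_neg, div_pow]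
        field_simp

/-- A nonnegative random variable with the moments of the inverse β-stable
subordinator, `E[X^k] = Γ(1+k) s^{βk} / Γ(1+βk)`, has moment generating
function `E[e^{wX}] = E_β(w s^β)` for every `w ≥ 0`. -/
theorem mgf_of_inverse_stable_subordinator_moments
    {Ω : Type*} [MeasurableSpace Ω] (P : Measure Ω) [IsProbabilityMeasure P]
    (β s : ℝ) (hβ : β ∈ Set.Ioo (0 : ℝ) 1) (hs : 0 < s)
    (X : Ω → ℝ) (hX_meas : Measurable X) (hX_nonneg : ∀ ω, 0 ≤ X ω)
    (hmom_int : ∀ k : ℕ, Integrable (fun ω => X ω ^ k) P)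
    (hmom : ∀ k : ℕ,
      ∫ ω, X ω ^ k ∂P
        = Real.Gamma (1 + (k : ℝ)) * s ^ (β * k) / Real.Gamma (1 + β * k)) :
    ∀ w ≥ (0 : ℝ),
      Integrable (fun ω => Real.exp (w * X ω)) P ∧
      ∫ ω, Real.exp (w * X ω) ∂P = mittagLeffler β (w * s ^ β) := by
  intro w hw
  have hterm_int (k : ℕ) : Integrable (fun ω => (w * X ω) ^ k / (k.factorial : ℝ)) P := by
    simp_rw [mul_pow]
    exact ((hmom_int k).const_mul _).div_const _
  have hterm (k : ℕ) : ∫ ω, (w * X ω) ^ k / (k.factorial : ℝ) ∂P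
      = (w * s ^ β) ^ k / Real.Gamma (1 + β * k) := by
    simp_rw [mul_pow]
    rw [integral_div, integral_const_mul, hmom, add_comm 1 (k : ℝ), Real.Gamma_nat_eq_factorial,
      Real.rpow_mul_natCast hs.le]
    field_simp
  have hy : 0 ≤ w * s ^ β := by positivity
  have hsum := summable_pow_div_Gamma_one_add_mul hβ.1 hy
  have hnorm : Summable fun k : ℕ => ∫ ω, ‖(w * X ω) ^ k / (k.factorial : ℝ)‖ ∂P := by
    refine hsum.congr fun k => ?_
    rw [← hterm k]
    congr 1 with ω
    have := hX_nonneg ω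
    exact (Real.norm_of_nonneg (by positivity)).symm
  have hmgf : ∫ ω, Real.exp (w * X ω) ∂P = mittagLeffler β (w * s ^ β) := by
    rw [mittagLeffler, ← tsum_congr hterm,
      integral_tsum_of_summable_integral_norm hterm_int hnorm]
    simp_rw [Real.exp_eq_exp_ℝ, (NormedSpace.expSeries_div_hasSum_exp _).tsum_eq]
  have hpos : 0 < mittagLeffler β (w * s ^ β) := by
    refine hsum.tsum_pos (fun k => ?_) 0 (by simp)
    have hβ0 := hβ.1
    have := Real.Gamma_pos_of_pos (show 0 < 1 + β * k by positivity)
    positivity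
  exact ⟨Integrable.of_integral_ne_zero (hmgf ▸ hpos.ne'), hmgf⟩
end

section
/- Let β ∈ (0,1) and b > 0. Then for every t ≥ 0, e^{-(2b)^{1/β} t} · E_β(b t^β) ≤ 2; equivalently, E_β(b t^β) ≤ 2 e^{γ t} whenever γ^β = 2b. -/
open Set MeasureTheory in
theorem Real.rpow_mul_exp_neg_le_Gamma {a s : ℝ} (ha : 0 ≤ a) (hs : 0 ≤ s) :
    s ^ a * Real.exp (-s) ≤ Real.Gamma (1 + a) := by
  have hint : IntegrableOn (fun x : ℝ => Real.exp (-x) * x ^ a) (Ioi 0) := by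
    simpa using Real.GammaIntegral_convergent (s := 1 + a) (by linarith)
  calc s ^ a * Real.exp (-s) = ∫ x in Ioi s, s ^ a * Real.exp (-x) := by
        rw [integral_const_mul, integral_exp_neg_Ioi]
    _ ≤ ∫ x in Ioi s, Real.exp (-x) * x ^ a := by
        refine setIntegral_mono_on ((integrableOn_exp_neg_Ioi s).const_mul _)
          (hint.mono_set (Ioi_subset_Ioi hs)) measurableSet_Ioi fun x hx => ?_
        rw [mul_comm]
        gcongr
        exact (mem_Ioi.1 hx).le
    _ ≤ ∫ x in Ioi 0, Real.exp (-x) * x ^ a := by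
        refine setIntegral_mono_set hint ?_ (Ioi_subset_Ioi hs).eventuallyLE
        filter_upwards [ae_restrict_mem measurableSet_Ioi] with x hx
        have := (mem_Ioi.1 hx).le
        simp only [Pi.zero_apply]
        positivity
    _ = Real.Gamma (1 + a) := by
        rw [Real.Gamma_eq_integral (by linarith)]
        simp

theorem mittagLeffler_half_rpow_le {β s : ℝ} (hβ : 0 ≤ β) (hs : 0 ≤ s) :
    mittagLeffler β (s ^ β / 2) ≤ 2 * Real.exp s := by
  have hgeom := hasSum_geometric_two.mul_right (Real.exp s)
  have hterm (k : ℕ) :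
      (s ^ β / 2) ^ k / Real.Gamma (1 + β * k) ≤ (1 / 2 : ℝ) ^ k * Real.exp s := by
    have hk : 0 ≤ β * k := by positivity
    have hΓ : 0 < Real.Gamma (1 + β * k) := Real.Gamma_pos_of_pos (by linarith)
    have hle := Real.rpow_mul_exp_neg_le_Gamma hk hs
    rw [Real.exp_neg, ← div_eq_mul_inv, div_le_iff₀ (Real.exp_pos s), Real.rpow_mul hs,
      Real.rpow_natCast] at hle
    rw [div_le_iff₀ hΓ, div_eq_mul_one_div, mul_pow, mul_comm, mul_assoc]
    gcongr
    linarith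
  have hnonneg (k : ℕ) : 0 ≤ (s ^ β / 2) ^ k / Real.Gamma (1 + β * k) := by
    have hk : 0 ≤ β * k := by positivity
    have hΓ : 0 < Real.Gamma (1 + β * k) := Real.Gamma_pos_of_pos (by linarith)
    positivity
  exact hasSum_le hterm
    (Summable.of_nonneg_of_le hnonneg hterm hgeom.summable).hasSum hgeom

/-- Uniform bound: `e^{-(2b)^{1/β} t} E_β(b t^β) ≤ 2` for all `t ≥ 0`;
equivalently, `E_β(b t^β) ≤ 2 e^{γt}` whenever `γ ≥ 0` and `γ^β = 2b`. -/
theorem mittagLeffler_exp_bound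
    (β b : ℝ) (hβ : β ∈ Set.Ioo (0 : ℝ) 1) (hb : 0 < b) :
    (∀ t ≥ (0 : ℝ),
      Real.exp (-((2 * b) ^ (1 / β) * t)) * mittagLeffler β (b * t ^ β) ≤ 2) ∧
    (∀ γ ≥ (0 : ℝ), γ ^ β = 2 * b →
      ∀ t ≥ (0 : ℝ), mittagLeffler β (b * t ^ β) ≤ 2 * Real.exp (γ * t)) := by
  have hbound (γ : ℝ) (hγ : 0 ≤ γ) (h : γ ^ β = 2 * b) (t : ℝ) (ht : 0 ≤ t) :
      mittagLeffler β (b * t ^ β) ≤ 2 * Real.exp (γ * t) := by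
    have hx : b * t ^ β = (γ * t) ^ β / 2 := by
      rw [Real.mul_rpow hγ ht, h]
      ring
    rw [hx]
    exact mittagLeffler_half_rpow_le hβ.1.le (mul_nonneg hγ ht)
  refine ⟨fun t ht => ?_, hbound⟩
  have h2b : 0 ≤ 2 * b := by positivity
  have hpow : ((2 * b) ^ (1 / β)) ^ β = 2 * b := by
    rw [← Real.rpow_mul h2b, one_div_mul_cancel hβ.1.ne', Real.rpow_one]
  rw [Real.exp_neg, inv_mul_le_iff₀ (Real.exp_pos _), mul_comm _ (2 : ℝ)]
  exact hbound _ (Real.rpow_nonneg h2b _) hpow t ht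
end

section
/- Let M, A, T : (0,∞) → [0,∞) be measurable and suppose M(t) ≥ A(t) + ∫₀ᵗ T(t-s) M(s) ds for all t > 0. Fix λ > 0 and suppose that ∫₀^∞ e^{-λt} A(t) dt > 0 and ∫₀^∞ e^{-λt} T(t) dt ≥ 1. Then ∫₀^∞ e^{-λt} M(t) dt = ∞. -/
open MeasureTheory

/-- The integral over the line of a convolution is the product of the integrals. -/
lemma lintegral_lintegral_sub_mul {k m : ℝ → ENNReal} (hk : Measurable k) (hm : Measurable m) :
    ∫⁻ t, ∫⁻ s, k (t - s) * m s = (∫⁻ t, k t) * ∫⁻ t, m t := by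
  rw [lintegral_lintegral_swap (by fun_prop)]
  calc ∫⁻ s, ∫⁻ t, k (t - s) * m s
      = ∫⁻ s, (∫⁻ t, k t) * m s := by
        refine lintegral_congr fun s => ?_
        rw [lintegral_mul_const _ (by fun_prop), lintegral_sub_right_eq_self k s]
    _ = (∫⁻ t, k t) * ∫⁻ t, m t := lintegral_const_mul _ hm

/-- A supersolution of the renewal equation on the line with kernel of mass at least one and
nontrivial forcing has infinite mass. -/
lemma lintegral_eq_top_of_renewal_le {a k m : ℝ → ENNReal}
    (ha : Measurable a) (hk : Measurable k) (hm : Measurable m)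
    (h : ∀ t, a t + ∫⁻ s, k (t - s) * m s ≤ m t)
    (ha_pos : 0 < ∫⁻ t, a t) (hk_ge : 1 ≤ ∫⁻ t, k t) :
    ∫⁻ t, m t = ⊤ := by
  by_contra hfin
  have hle : (∫⁻ t, a t) + ∫⁻ t, m t ≤ ∫⁻ t, m t :=
    calc (∫⁻ t, a t) + ∫⁻ t, m t
        ≤ (∫⁻ t, a t) + (∫⁻ t, k t) * ∫⁻ t, m t := by
          gcongr
          exact le_mul_of_one_le_left' hk_ge
      _ = ∫⁻ t, (a t + ∫⁻ s, k (t - s) * m s) := by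
          rw [lintegral_add_left ha, lintegral_lintegral_sub_mul hk hm]
      _ ≤ ∫⁻ t, m t := lintegral_mono h
  have hlt := ENNReal.add_lt_add_right hfin ha_pos
  rw [zero_add] at hlt
  exact (hlt.trans_le hle).false

/-- Laplace-transform divergence lemma: if `M(t) ≥ A(t) + ∫₀ᵗ T(t-s) M(s) ds`,
`∫₀^∞ e^{-λt} A(t) dt > 0` and `∫₀^∞ e^{-λt} T(t) dt ≥ 1`, then
`∫₀^∞ e^{-λt} M(t) dt = ∞`. -/
theorem laplace_transform_divergence
    (M A T : ℝ → ℝ)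
    (hM_meas : Measurable M) (hA_meas : Measurable A) (hT_meas : Measurable T)
    (hM_nonneg : ∀ t > (0 : ℝ), 0 ≤ M t)
    (hA_nonneg : ∀ t > (0 : ℝ), 0 ≤ A t)
    (hT_nonneg : ∀ t > (0 : ℝ), 0 ≤ T t)
    (hineq : ∀ t > (0 : ℝ),
      ENNReal.ofReal (A t) +
          ∫⁻ s in Set.Ioo (0 : ℝ) t, ENNReal.ofReal (T (t - s) * M s)
        ≤ ENNReal.ofReal (M t))
    (lam : ℝ) (hlam : 0 < lam)
    (hA_pos :
      0 < ∫⁻ t in Set.Ioi (0 : ℝ), ENNReal.ofReal (Real.exp (-(lam * t)) * A t))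
    (hT_ge :
      1 ≤ ∫⁻ t in Set.Ioi (0 : ℝ), ENNReal.ofReal (Real.exp (-(lam * t)) * T t)) :
    ∫⁻ t in Set.Ioi (0 : ℝ), ENNReal.ofReal (Real.exp (-(lam * t)) * M t) = ⊤ := by
  let w (f : ℝ → ℝ) : ℝ → ENNReal :=
    (Set.Ioi (0 : ℝ)).indicator fun t => ENNReal.ofReal (Real.exp (-(lam * t)) * f t)
  have hw_meas {f : ℝ → ℝ} (hf : Measurable f) : Measurable (w f) :=
    Measurable.indicator (by fun_prop) measurableSet_Ioi
  have hw_int (f : ℝ → ℝ) :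
      ∫⁻ t, w f t = ∫⁻ t in Set.Ioi (0 : ℝ), ENNReal.ofReal (Real.exp (-(lam * t)) * f t) :=
    lintegral_indicator measurableSet_Ioi _
  have hconv (t s : ℝ) : w T (t - s) * w M s = (Set.Ioo (0 : ℝ) t).indicator
      (fun s => ENNReal.ofReal (Real.exp (-(lam * t))) * ENNReal.ofReal (T (t - s) * M s)) s := by
    by_cases hs : 0 < s
    · by_cases hst : s < t
      · have hts : 0 < t - s := sub_pos.2 hst
        rw [Set.indicator_of_mem (Set.mem_Ioo.2 ⟨hs, hst⟩)]
        simp only [w, Set.indicator_of_mem (Set.mem_Ioi.2 hs),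
          Set.indicator_of_mem (Set.mem_Ioi.2 hts)]
        rw [← ENNReal.ofReal_mul (mul_nonneg (Real.exp_pos _).le (hT_nonneg _ hts)),
          ← ENNReal.ofReal_mul (Real.exp_pos _).le,
          show -(lam * t) = -(lam * (t - s)) + -(lam * s) by ring, Real.exp_add]
        congr 1
        ring
      · simp [w, hst]
    · simp [w, hs]
  rw [← hw_int] at hA_pos hT_ge ⊢
  refine lintegral_eq_top_of_renewal_le (hw_meas hA_meas) (hw_meas hT_meas) (hw_meas hM_meas)
    (fun t => ?_) hA_pos hT_ge
  simp_rw [hconv]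
  rw [lintegral_indicator measurableSet_Ioo, lintegral_const_mul _ (by fun_prop)]
  by_cases ht : 0 < t
  · simp only [w, Set.indicator_of_mem (Set.mem_Ioi.2 ht), ENNReal.ofReal_mul (Real.exp_pos _).le]
    rw [← mul_add]
    gcongr
    exact hineq t ht
  · simp [w, ht]
end
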